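/- There are exactly 34 isomorphism classes of real 6-dimensional nilpotent Lie algebras; of these, exactly 15 admit both a complex structure and a symplectic structure, exactly 3 admit a complex structure but no symplectic structure, exactly 11 admit a symplectic structure but no complex structure, and exactly 5 admit neither a complex structure nor a symplectic structure. -/

import Mathlib

/-- A Lie algebra structure on `ℝ^n`: a bilinear, alternating bracket satisfying the
Jacobi identity. -/
structure LieStruct (n : ℕ) where
  bracket : (Fin n → ℝ) → (Fin n → ℝ) → (Fin n → ℝ)
  add_left : ∀ x y z, bracket (x + y) z = bracket x z + bracket y z
  add_right : ∀ x y z, bracket x (y + z) = bracket x y + bracket x z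
  smul_left : ∀ (c : ℝ) x y, bracket (c • x) y = c • bracket x y
  smul_right : ∀ (c : ℝ) x y, bracket x (c • y) = c • bracket x y
  alt : ∀ x, bracket x x = 0
  jacobi : ∀ x y z,
    bracket x (bracket y z) + bracket y (bracket z x) + bracket z (bracket x y) = 0

/-- The lower central series of a Lie algebra structure: `C⁰ = g`,
`Cᵏ⁺¹ = [g, Cᵏ]`. -/
def lcs {n : ℕ} (L : LieStruct n) : ℕ → Submodule ℝ (Fin n → ℝ)
  | 0 => ⊤
  | k + 1 => Submodule.span ℝ {z | ∃ x y, y ∈ lcs L k ∧ z = L.bracket x y}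

/-- A Lie algebra is nilpotent if its lower central series terminates at zero. -/
def LieStruct.IsNilpotent {n : ℕ} (L : LieStruct n) : Prop := ∃ k, lcs L k = ⊥

/-- Two Lie algebra structures are isomorphic if some linear bijection intertwines the
brackets. -/
def LieStruct.Iso {n : ℕ} (L L' : LieStruct n) : Prop :=
  ∃ f : (Fin n → ℝ) ≃ₗ[ℝ] (Fin n → ℝ), ∀ x y, f (L.bracket x y) = L'.bracket (f x) (f y)

/-- A complex structure on a Lie algebra: a linear `J` with `J² = −id` and vanishing
Nijenhuis tensor. -/
def LieStruct.AdmitsComplex {n : ℕ} (L : LieStruct n) : Prop :=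
  ∃ J : (Fin n → ℝ) →ₗ[ℝ] (Fin n → ℝ),
    (∀ x, J (J x) = -x) ∧
    (∀ x y, L.bracket (J x) (J y) - L.bracket x y
      - J (L.bracket (J x) y) - J (L.bracket x (J y)) = 0)

/-- A symplectic structure on a Lie algebra: a nondegenerate alternating bilinear form
satisfying the closedness (2-cocycle) condition. -/
def LieStruct.AdmitsSymplectic {n : ℕ} (L : LieStruct n) : Prop :=
  ∃ ω : (Fin n → ℝ) →ₗ[ℝ] (Fin n → ℝ) →ₗ[ℝ] ℝ,
    (∀ x, ω x x = 0) ∧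
    (∀ x, (∀ y, ω x y = 0) → x = 0) ∧
    (∀ x y z, ω (L.bracket x y) z + ω (L.bracket y z) x + ω (L.bracket z x) y = 0)

/-- Isomorphism of Lie algebra structures, restricted to those satisfying `P`. -/
def IsoOn {n : ℕ} (P : LieStruct n → Prop) :
    {L : LieStruct n // P L} → {L : LieStruct n // P L} → Prop :=
  fun L L' => L.1.Iso L'.1


/-- `L` becomes the bracket `F` in suitable linear coordinates. -/
def IsoF {n : ℕ} (L : LieStruct n)
    (F : (Fin n → ℝ) → (Fin n → ℝ) → (Fin n → ℝ)) : Prop :=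
  ∃ f : (Fin n → ℝ) ≃ₗ[ℝ] (Fin n → ℝ), ∀ x y, f (L.bracket x y) = F (f x) (f y)

theorem IsoF.jacobi {n : ℕ} {L : LieStruct n} {F : (Fin n → ℝ) → (Fin n → ℝ) → (Fin n → ℝ)}
    (h : IsoF L F) (x y z : Fin n → ℝ) :
    F x (F y z) + F y (F z x) + F z (F x y) = 0 := by
  obtain ⟨f, hf⟩ := h
  obtain ⟨x, rfl⟩ := f.surjective x
  obtain ⟨y, rfl⟩ := f.surjective y
  obtain ⟨z, rfl⟩ := f.surjective z
  simp only [← hf, ← map_add, L.jacobi, map_zero]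

theorem IsoF.step {n : ℕ} {L : LieStruct n} {F : (Fin n → ℝ) → (Fin n → ℝ) → (Fin n → ℝ)}
    (h : IsoF L F) (G : (Fin n → ℝ) → (Fin n → ℝ) → (Fin n → ℝ))
    (B : Fin n → ((Fin n → ℝ) →ₗ[ℝ] ℝ))
    (hB : ∀ x, (∀ i, B i x = 0) → ∀ i, x i = 0)
    (hG : ∀ x y i, B i (F x y) = G (fun j => B j x) (fun j => B j y) i) : IsoF L G := by
  obtain ⟨f, hf⟩ := h
  have hinj : Function.Injective (LinearMap.pi B) := by
    rw [injective_iff_map_eq_zero]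
    intro x hx
    funext i
    exact hB x (fun j => congrFun hx j) i
  refine ⟨f.trans (LinearEquiv.ofInjectiveEndo _ hinj), fun x y => ?_⟩
  funext i
  simp only [LinearEquiv.trans_apply, hf]
  exact hG (f x) (f y) i

theorem LieStruct.exists_central {n : ℕ} (L : LieStruct (n + 1)) (h : L.IsNilpotent) :
    ∃ z, z ≠ 0 ∧ ∀ y, L.bracket y z = 0 := by
  classical
  have hk := Nat.find_spec h
  have hm := fun m => Nat.find_min (m := m) h
  rcases hkk : Nat.find h with _ | k
  · rw [hkk] at hk
    exact absurd hk (by simp [lcs])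
  · rw [hkk] at hk hm
    have h1 := hm k (Nat.lt_succ_self k)
    obtain ⟨z, hz, hz0⟩ := Submodule.exists_mem_ne_zero_of_ne_bot h1
    refine ⟨z, hz0, fun y => ?_⟩
    have : L.bracket y z ∈ lcs L (k + 1) := Submodule.subset_span ⟨y, z, hz, rfl⟩
    rw [hk] at this
    simpa using this

theorem LieStruct.isNilpotent_of_surj {n m : ℕ} {L : LieStruct n} {M : LieStruct m}
    (p : (Fin n → ℝ) →ₗ[ℝ] (Fin m → ℝ)) (hp : Function.Surjective p)
    (hb : ∀ x y, p (L.bracket x y) = M.bracket (p x) (p y)) (h : L.IsNilpotent) :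
    M.IsNilpotent := by
  obtain ⟨k, hk⟩ := h
  have key : ∀ k, lcs M k ≤ (lcs L k).map p := by
    intro k
    induction k with
    | zero => intro x _; obtain ⟨y, rfl⟩ := hp x; exact ⟨y, trivial, rfl⟩
    | succ k ih =>
      rw [lcs, Submodule.span_le]
      rintro _ ⟨x, y, hy, rfl⟩
      obtain ⟨x, rfl⟩ := hp x
      obtain ⟨y, hy', rfl⟩ := ih hy
      exact ⟨L.bracket x y, Submodule.subset_span ⟨x, y, hy', rfl⟩, hb x y⟩
  refine ⟨k, ?_⟩
  have := key k
  rw [hk] at this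
  simpa using this

theorem LieStruct.zero_right {n : ℕ} (L : LieStruct n) (x : Fin n → ℝ) : L.bracket x 0 = 0 := by
  have := L.smul_right 0 x 0
  simpa using this

theorem LieStruct.skew {n : ℕ} (L : LieStruct n) (x y : Fin n → ℝ) :
    L.bracket x y = - L.bracket y x := by
  have := L.alt (x + y)
  rw [L.add_left, L.add_right, L.add_right, L.alt, L.alt] at this
  simpa [add_eq_zero_iff_eq_neg] using this

/-- The bracket as a bilinear map. -/
def LieStruct.bil {n : ℕ} (L : LieStruct n) :
    (Fin n → ℝ) →ₗ[ℝ] (Fin n → ℝ) →ₗ[ℝ] (Fin n → ℝ) :=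
  LinearMap.mk₂ ℝ L.bracket L.add_left L.smul_left L.add_right L.smul_right

@[simp] theorem LieStruct.bil_apply {n : ℕ} (L : LieStruct n) (x y : Fin n → ℝ) :
    L.bil x y = L.bracket x y := rfl

/-- Transport of structure. -/
def LieStruct.transport {n : ℕ} (L : LieStruct n) (f : (Fin n → ℝ) ≃ₗ[ℝ] (Fin n → ℝ)) :
    LieStruct n where
  bracket x y := f (L.bracket (f.symm x) (f.symm y))
  add_left x y z := by simp [L.add_left]
  add_right x y z := by simp [L.add_right]
  smul_left x y z := by simp [L.smul_left]
  smul_right x y z := by simp [L.smul_right]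
  alt x := by simp [L.alt]
  jacobi x y z := by simp [← map_add, L.jacobi]

/-- The linear map forgetting the last coordinate. -/
def initL (n : ℕ) : (Fin (n + 1) → ℝ) →ₗ[ℝ] (Fin n → ℝ) where
  toFun x := fun i => x i.castSucc
  map_add' _ _ := rfl
  map_smul' _ _ := rfl

/-- The linear map extending by zero. -/
def snocL (n : ℕ) : (Fin n → ℝ) →ₗ[ℝ] (Fin (n + 1) → ℝ) where
  toFun x := Fin.snoc x 0
  map_add' x y := by
    funext i
    refine Fin.lastCases ?_ (fun i => ?_) i <;> simp
  map_smul' c x := by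
    funext i
    refine Fin.lastCases ?_ (fun i => ?_) i <;> simp

theorem initL_snocL {n : ℕ} (x : Fin n → ℝ) : initL n (snocL n x) = x := by
  funext i; simp [initL, snocL]

theorem decomp_last {n : ℕ} (x : Fin (n + 1) → ℝ) :
    x = snocL n (initL n x) + x (Fin.last n) • (Pi.single (Fin.last n) (1 : ℝ)) := by
  funext i
  refine Fin.lastCases ?_ (fun i => ?_) i
  · simp [initL, snocL]
  · simp [initL, snocL]

/-- Every nilpotent Lie algebra is a one-dimensional central extension of a nilpotent one. -/
theorem LieStruct.exists_ext {n : ℕ} (L : LieStruct (n + 1)) (h : L.IsNilpotent) :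
    ∃ M : LieStruct n, M.IsNilpotent ∧ ∀ F, IsoF M F → ∃ t : Fin n → Fin n → ℝ,
      (∀ i j, t i j = - t j i) ∧
      IsoF L (fun x y => Fin.snoc (F (fun i => x i.castSucc) (fun i => y i.castSucc))
        (∑ i, ∑ j, t i j * (x i.castSucc * y j.castSucc)) : _ → _ → (Fin (n+1) → ℝ)) := by
  obtain ⟨z, hz, hc⟩ := L.exists_central h
  have he : (Pi.single (Fin.last n) (1 : ℝ) : Fin (n + 1) → ℝ) ≠ 0 := by simp
  obtain ⟨f0, hf0⟩ := SeparatingDual.exists_continuousLinearEquiv_apply_eq (R := ℝ) hz he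
  set f : (Fin (n + 1) → ℝ) ≃ₗ[ℝ] (Fin (n + 1) → ℝ) := f0.toLinearEquiv with hfdef
  have hf : f z = Pi.single (Fin.last n) (1 : ℝ) := hf0
  set K := L.transport f with hK
  have hKc : ∀ y, K.bracket y (Pi.single (Fin.last n) (1 : ℝ)) = 0 := by
    intro y
    simp only [hK, LieStruct.transport, ← hf, LinearEquiv.symm_apply_apply, hc, map_zero]
  have hKc' : ∀ y, K.bracket (Pi.single (Fin.last n) (1 : ℝ)) y = 0 := by
    intro y
    rw [K.skew, hKc, neg_zero]
  have hdep : ∀ x y, K.bracket x y = K.bracket (snocL n (initL n x)) (snocL n (initL n y)) := by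
    intro x y
    conv_lhs => rw [decomp_last x, decomp_last y]
    simp only [K.add_left, K.add_right, K.smul_left, K.smul_right, hKc, hKc', smul_zero, add_zero]
  let M : LieStruct n :=
    { bracket := fun x y => initL n (K.bracket (snocL n x) (snocL n y))
      add_left := fun x y z => by simp [K.add_left]
      add_right := fun x y z => by simp [K.add_right]
      smul_left := fun x y z => by simp [K.smul_left]
      smul_right := fun x y z => by simp [K.smul_right]
      alt := fun x => by simp [K.alt]
      jacobi := fun x y z => by
        have := congrArg (initL n) (K.jacobi (snocL n x) (snocL n y) (snocL n z))
        rw [hdep _ (K.bracket _ _), hdep _ (K.bracket (snocL n z) _),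
          hdep _ (K.bracket (snocL n x) _)] at this
        simpa [initL_snocL] using this }
  refine ⟨M, ?_, ?_⟩
  · refine LieStruct.isNilpotent_of_surj (L := L) ((initL n).comp f.toLinearMap) ?_ ?_ h
    · intro x
      exact ⟨f.symm (snocL n x), by simp [initL_snocL]⟩
    · intro x y
      have : f (L.bracket x y) = K.bracket (f x) (f y) := by simp [hK, LieStruct.transport]
      simp only [LinearMap.comp_apply, LinearEquiv.coe_coe, this]
      rw [hdep]
  · rintro F ⟨g, hg⟩
    let th : (Fin n → ℝ) → (Fin n → ℝ) → ℝ := fun x y =>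
      K.bil (snocL n (g.symm x)) (snocL n (g.symm y)) (Fin.last n)
    refine ⟨fun i j => th (Pi.single i 1) (Pi.single j 1), ?_, ?_⟩
    · intro i j
      simp only [th, LieStruct.bil_apply]
      rw [K.skew]; rfl
    have hth : ∀ x y, th x y = ∑ i, ∑ j, th (Pi.single i 1) (Pi.single j 1) * (x i * y j) := by
      intro x y
      have hx : x = ∑ i, x i • (Pi.single i (1 : ℝ) : Fin n → ℝ) := by
        simpa using (pi_eq_sum_univ' x)
      have hy : y = ∑ i, y i • (Pi.single i (1 : ℝ) : Fin n → ℝ) := by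
        simpa using (pi_eq_sum_univ' y)
      simp only [th]
      conv_lhs => rw [hx, hy]
      simp only [map_sum, map_smul, LinearMap.sum_apply, LinearMap.smul_apply, Finset.sum_apply,
        Pi.smul_apply, smul_eq_mul, Finset.mul_sum]
      rw [Finset.sum_comm]
      refine Finset.sum_congr rfl fun i _ => Finset.sum_congr rfl fun j _ => ?_
      ring
    let hh : (Fin (n+1) → ℝ) →ₗ[ℝ] (Fin (n+1) → ℝ) :=
      (snocL n).comp (g.toLinearMap.comp (initL n)) +
        (LinearMap.single ℝ (fun _ => ℝ) (Fin.last n)).comp (LinearMap.proj (Fin.last n))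
    have hh1 : ∀ x, initL n (hh x) = g (initL n x) := by
      intro x
      funext i
      simp [hh, initL, snocL]
    have hh2 : ∀ x, hh x (Fin.last n) = x (Fin.last n) := by
      intro x
      simp [hh, snocL]
    have hinj : Function.Injective hh := by
      rw [injective_iff_map_eq_zero]
      intro x hx
      have a1 : initL n x = 0 := by
        apply g.injective
        rw [← hh1, hx, map_zero, map_zero]
      have a2 : x (Fin.last n) = 0 := by rw [← hh2 x, hx]; rfl
      rw [decomp_last x, a1, a2]; simp
    refine ⟨f.trans (LinearEquiv.ofInjectiveEndo _ hinj), fun x y => ?_⟩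
    have : f (L.bracket x y) = K.bracket (f x) (f y) := by simp [hK, LieStruct.transport]
    simp only [LinearEquiv.trans_apply, LinearEquiv.coe_ofInjectiveEndo, this]
    have e1 : ∀ u, (fun i : Fin n => hh u i.castSucc) = g (initL n u) := fun u => hh1 u
    rw [e1, e1, ← hg]
    have e2 := hth (g (initL n (f x))) (g (initL n (f y)))
    have e3 : ∀ u (i : Fin n), hh u i.castSucc = g (initL n u) i := fun u i => congrFun (hh1 u) i
    simp only [e3, ← e2]
    funext i
    refine Fin.lastCases ?_ (fun i => ?_) i
    · rw [hh2, Fin.snoc_last, hdep]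
      simp [th]
    · rw [Fin.snoc_castSucc, e3, hdep]

set_option linter.unusedVariables false
set_option linter.unusedSimpArgs false

/-- The `i`-th coordinate functional. -/
abbrev e {n : ℕ} (i : Fin n) : (Fin n → ℝ) →ₗ[ℝ] ℝ := LinearMap.proj i

/-- The elementary two-form. -/
def w {n : ℕ} (x y : Fin n → ℝ) (i j : Fin n) : ℝ := x i * y j - x j * y i

theorem IsoF.step3 {L : LieStruct 3} {F : (Fin 3 → ℝ) → (Fin 3 → ℝ) → (Fin 3 → ℝ)}
    (h : IsoF L F) (G : (Fin 3 → ℝ) → (Fin 3 → ℝ) → (Fin 3 → ℝ))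
    (B0 B1 B2 : (Fin 3 → ℝ) →ₗ[ℝ] ℝ)
    (hB : ∀ x, B0 x = 0 → B1 x = 0 → B2 x = 0 →
       x 0 = 0 ∧ x 1 = 0 ∧ x 2 = 0 := by
      intro x
      simp only [w, Matrix.cons_val, LinearMap.add_apply, LinearMap.smul_apply, LinearMap.sub_apply,
        LinearMap.neg_apply, LinearMap.proj_apply, smul_eq_mul]
      grind)
    (hG : ∀ x y, B0 (F x y) = G ![B0 x, B1 x, B2 x] ![B0 y, B1 y, B2 y] 0 ∧ B1 (F x y) = G ![B0 x, B1 x, B2 x] ![B0 y, B1 y, B2 y] 1 ∧ B2 (F x y) = G ![B0 x, B1 x, B2 x] ![B0 y, B1 y, B2 y] 2 := by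
      intro x y
      refine ⟨?_, ?_, ?_⟩ <;>
      simp only [w, Matrix.cons_val, LinearMap.add_apply, LinearMap.smul_apply, LinearMap.sub_apply,
        LinearMap.neg_apply, LinearMap.proj_apply, smul_eq_mul] <;>
      first
        | done
        | ring1
        | (field_simp; ring1)
        | (field_simp; done)) :
    IsoF L G := by
  have hh : ∀ x, (fun j => (![B0, B1, B2] : Fin 3 → ((Fin 3 → ℝ) →ₗ[ℝ] ℝ)) j x) =
      ![B0 x, B1 x, B2 x] := by
    intro x; funext i; fin_cases i <;> rfl
  refine h.step G ![B0, B1, B2] (fun x hx => ?_) ?_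
  · have := hB x (hx 0) (hx 1) (hx 2)
    intro i
    fin_cases i <;> simp [this]
  · intro x y i
    rw [hh, hh]
    obtain ⟨h0, h1, h2⟩ := hG x y
    fin_cases i
    exacts [h0, h1, h2]

theorem IsoF.step4 {L : LieStruct 4} {F : (Fin 4 → ℝ) → (Fin 4 → ℝ) → (Fin 4 → ℝ)}
    (h : IsoF L F) (G : (Fin 4 → ℝ) → (Fin 4 → ℝ) → (Fin 4 → ℝ))
    (B0 B1 B2 B3 : (Fin 4 → ℝ) →ₗ[ℝ] ℝ)
    (hB : ∀ x, B0 x = 0 → B1 x = 0 → B2 x = 0 → B3 x = 0 →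
       x 0 = 0 ∧ x 1 = 0 ∧ x 2 = 0 ∧ x 3 = 0 := by
      intro x
      simp only [w, Matrix.cons_val, LinearMap.add_apply, LinearMap.smul_apply, LinearMap.sub_apply,
        LinearMap.neg_apply, LinearMap.proj_apply, smul_eq_mul]
      grind)
    (hG : ∀ x y, B0 (F x y) = G ![B0 x, B1 x, B2 x, B3 x] ![B0 y, B1 y, B2 y, B3 y] 0 ∧ B1 (F x y) = G ![B0 x, B1 x, B2 x, B3 x] ![B0 y, B1 y, B2 y, B3 y] 1 ∧ B2 (F x y) = G ![B0 x, B1 x, B2 x, B3 x] ![B0 y, B1 y, B2 y, B3 y] 2 ∧ B3 (F x y) = G ![B0 x, B1 x, B2 x, B3 x] ![B0 y, B1 y, B2 y, B3 y] 3 := by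
      intro x y
      refine ⟨?_, ?_, ?_, ?_⟩ <;>
      simp only [w, Matrix.cons_val, LinearMap.add_apply, LinearMap.smul_apply, LinearMap.sub_apply,
        LinearMap.neg_apply, LinearMap.proj_apply, smul_eq_mul] <;>
      first
        | done
        | ring1
        | (field_simp; ring1)
        | (field_simp; done)) :
    IsoF L G := by
  have hh : ∀ x, (fun j => (![B0, B1, B2, B3] : Fin 4 → ((Fin 4 → ℝ) →ₗ[ℝ] ℝ)) j x) =
      ![B0 x, B1 x, B2 x, B3 x] := by
    intro x; funext i; fin_cases i <;> rfl
  refine h.step G ![B0, B1, B2, B3] (fun x hx => ?_) ?_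
  · have := hB x (hx 0) (hx 1) (hx 2) (hx 3)
    intro i
    fin_cases i <;> simp [this]
  · intro x y i
    rw [hh, hh]
    obtain ⟨h0, h1, h2, h3⟩ := hG x y
    fin_cases i
    exacts [h0, h1, h2, h3]

theorem IsoF.step5 {L : LieStruct 5} {F : (Fin 5 → ℝ) → (Fin 5 → ℝ) → (Fin 5 → ℝ)}
    (h : IsoF L F) (G : (Fin 5 → ℝ) → (Fin 5 → ℝ) → (Fin 5 → ℝ))
    (B0 B1 B2 B3 B4 : (Fin 5 → ℝ) →ₗ[ℝ] ℝ)
    (hB : ∀ x, B0 x = 0 → B1 x = 0 → B2 x = 0 → B3 x = 0 → B4 x = 0 →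
       x 0 = 0 ∧ x 1 = 0 ∧ x 2 = 0 ∧ x 3 = 0 ∧ x 4 = 0 := by
      intro x
      simp only [w, Matrix.cons_val, LinearMap.add_apply, LinearMap.smul_apply, LinearMap.sub_apply,
        LinearMap.neg_apply, LinearMap.proj_apply, smul_eq_mul]
      grind)
    (hG : ∀ x y, B0 (F x y) = G ![B0 x, B1 x, B2 x, B3 x, B4 x] ![B0 y, B1 y, B2 y, B3 y, B4 y] 0 ∧ B1 (F x y) = G ![B0 x, B1 x, B2 x, B3 x, B4 x] ![B0 y, B1 y, B2 y, B3 y, B4 y] 1 ∧ B2 (F x y) = G ![B0 x, B1 x, B2 x, B3 x, B4 x] ![B0 y, B1 y, B2 y, B3 y, B4 y] 2 ∧ B3 (F x y) = G ![B0 x, B1 x, B2 x, B3 x, B4 x] ![B0 y, B1 y, B2 y, B3 y, B4 y] 3 ∧ B4 (F x y) = G ![B0 x, B1 x, B2 x, B3 x, B4 x] ![B0 y, B1 y, B2 y, B3 y, B4 y] 4 := by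
      intro x y
      refine ⟨?_, ?_, ?_, ?_, ?_⟩ <;>
      simp only [w, Matrix.cons_val, LinearMap.add_apply, LinearMap.smul_apply, LinearMap.sub_apply,
        LinearMap.neg_apply, LinearMap.proj_apply, smul_eq_mul] <;>
      first
        | done
        | ring1
        | (field_simp; ring1)
        | (field_simp; done)) :
    IsoF L G := by
  have hh : ∀ x, (fun j => (![B0, B1, B2, B3, B4] : Fin 5 → ((Fin 5 → ℝ) →ₗ[ℝ] ℝ)) j x) =
      ![B0 x, B1 x, B2 x, B3 x, B4 x] := by
    intro x; funext i; fin_cases i <;> rfl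
  refine h.step G ![B0, B1, B2, B3, B4] (fun x hx => ?_) ?_
  · have := hB x (hx 0) (hx 1) (hx 2) (hx 3) (hx 4)
    intro i
    fin_cases i <;> simp [this]
  · intro x y i
    rw [hh, hh]
    obtain ⟨h0, h1, h2, h3, h4⟩ := hG x y
    fin_cases i
    exacts [h0, h1, h2, h3, h4]

theorem IsoF.step6 {L : LieStruct 6} {F : (Fin 6 → ℝ) → (Fin 6 → ℝ) → (Fin 6 → ℝ)}
    (h : IsoF L F) (G : (Fin 6 → ℝ) → (Fin 6 → ℝ) → (Fin 6 → ℝ))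
    (B0 B1 B2 B3 B4 B5 : (Fin 6 → ℝ) →ₗ[ℝ] ℝ)
    (hB : ∀ x, B0 x = 0 → B1 x = 0 → B2 x = 0 → B3 x = 0 → B4 x = 0 → B5 x = 0 →
       x 0 = 0 ∧ x 1 = 0 ∧ x 2 = 0 ∧ x 3 = 0 ∧ x 4 = 0 ∧ x 5 = 0 := by
      intro x
      simp only [w, Matrix.cons_val, LinearMap.add_apply, LinearMap.smul_apply, LinearMap.sub_apply,
        LinearMap.neg_apply, LinearMap.proj_apply, smul_eq_mul]
      grind)
    (hG : ∀ x y, B0 (F x y) = G ![B0 x, B1 x, B2 x, B3 x, B4 x, B5 x] ![B0 y, B1 y, B2 y, B3 y, B4 y, B5 y] 0 ∧ B1 (F x y) = G ![B0 x, B1 x, B2 x, B3 x, B4 x, B5 x] ![B0 y, B1 y, B2 y, B3 y, B4 y, B5 y] 1 ∧ B2 (F x y) = G ![B0 x, B1 x, B2 x, B3 x, B4 x, B5 x] ![B0 y, B1 y, B2 y, B3 y, B4 y, B5 y] 2 ∧ B3 (F x y) = G ![B0 x, B1 x, B2 x, B3 x, B4 x, B5 x] ![B0 y, B1 y, B2 y,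 B3 y, B4 y, B5 y] 3 ∧ B4 (F x y) = G ![B0 x, B1 x, B2 x, B3 x, B4 x, B5 x] ![B0 y, B1 y, B2 y, B3 y, B4 y, B5 y] 4 ∧ B5 (F x y) = G ![B0 x, B1 x, B2 x, B3 x, B4 x, B5 x] ![B0 y, B1 y, B2 y, B3 y, B4 y, B5 y] 5 := by
      intro x y
      refine ⟨?_, ?_, ?_, ?_, ?_, ?_⟩ <;>
      simp only [w, Matrix.cons_val, LinearMap.add_apply, LinearMap.smul_apply, LinearMap.sub_apply,
        LinearMap.neg_apply, LinearMap.proj_apply, smul_eq_mul] <;>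
      first
        | done
        | ring1
        | (field_simp; ring1)
        | (field_simp; done)) :
    IsoF L G := by
  have hh : ∀ x, (fun j => (![B0, B1, B2, B3, B4, B5] : Fin 6 → ((Fin 6 → ℝ) →ₗ[ℝ] ℝ)) j x) =
      ![B0 x, B1 x, B2 x, B3 x, B4 x, B5 x] := by
    intro x; funext i; fin_cases i <;> rfl
  refine h.step G ![B0, B1, B2, B3, B4, B5] (fun x hx => ?_) ?_
  · have := hB x (hx 0) (hx 1) (hx 2) (hx 3) (hx 4) (hx 5)
    intro i
    fin_cases i <;> simp [this]
  · intro x y i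
    rw [hh, hh]
    obtain ⟨h0, h1, h2, h3, h4, h5⟩ := hG x y
    fin_cases i
    exacts [h0, h1, h2, h3, h4, h5]

theorem LieStruct.ext3 (L : LieStruct 3) (h : L.IsNilpotent) :
    ∃ M : LieStruct 2, M.IsNilpotent ∧ ∀ F, IsoF M F → ∃ a12 : ℝ,
      IsoF L (fun x y => ![F (fun i => x i.castSucc) (fun i => y i.castSucc) 0, F (fun i => x i.castSucc) (fun i => y i.castSucc) 1,
        a12 * w x y 0 1]) := by
  obtain ⟨M, hM, hF⟩ := L.exists_ext h
  refine ⟨M, hM, fun F hI => ?_⟩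
  obtain ⟨t, ht, f, hf⟩ := hF F hI
  refine ⟨t 0 1, f, fun x y => ?_⟩
  rw [hf]
  funext i
  have d : ∀ i, t i i = 0 := fun i => by linarith [ht i i]
  fin_cases i
  · rfl
  · rfl
  · change (∑ i, ∑ j, t i j * (f x i.castSucc * f y j.castSucc)) =
      t 0 1 * w (f x) (f y) 0 1
    simp only [Fin.sum_univ_two, d, ht 1 0, w, Fin.reduceCastSucc,
      Fin.castSucc_zero, Fin.castSucc_one]
    ring

theorem LieStruct.ext4 (L : LieStruct 4) (h : L.IsNilpotent) :
    ∃ M : LieStruct 3, M.IsNilpotent ∧ ∀ F, IsoF M F → ∃ a12 a13 a23 : ℝ,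
      IsoF L (fun x y => ![F (fun i => x i.castSucc) (fun i => y i.castSucc) 0, F (fun i => x i.castSucc) (fun i => y i.castSucc) 1, F (fun i => x i.castSucc) (fun i => y i.castSucc) 2,
        a12 * w x y 0 1 + a13 * w x y 0 2 + a23 * w x y 1 2]) := by
  obtain ⟨M, hM, hF⟩ := L.exists_ext h
  refine ⟨M, hM, fun F hI => ?_⟩
  obtain ⟨t, ht, f, hf⟩ := hF F hI
  refine ⟨t 0 1, t 0 2, t 1 2, f, fun x y => ?_⟩
  rw [hf]
  funext i
  have d : ∀ i, t i i = 0 := fun i => by linarith [ht i i]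
  fin_cases i
  · rfl
  · rfl
  · rfl
  · change (∑ i, ∑ j, t i j * (f x i.castSucc * f y j.castSucc)) =
      t 0 1 * w (f x) (f y) 0 1 + t 0 2 * w (f x) (f y) 0 2 + t 1 2 * w (f x) (f y) 1 2
    simp only [Fin.sum_univ_three, d, ht 1 0, ht 2 0, ht 2 1, w, Fin.reduceCastSucc,
      Fin.castSucc_zero, Fin.castSucc_one]
    ring

theorem LieStruct.ext5 (L : LieStruct 5) (h : L.IsNilpotent) :
    ∃ M : LieStruct 4, M.IsNilpotent ∧ ∀ F, IsoF M F → ∃ a12 a13 a14 a23 a24 a34 : ℝ,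
      IsoF L (fun x y => ![F (fun i => x i.castSucc) (fun i => y i.castSucc) 0, F (fun i => x i.castSucc) (fun i => y i.castSucc) 1, F (fun i => x i.castSucc) (fun i => y i.castSucc) 2, F (fun i => x i.castSucc) (fun i => y i.castSucc) 3,
        a12 * w x y 0 1 + a13 * w x y 0 2 + a14 * w x y 0 3 + a23 * w x y 1 2 + a24 * w x y 1 3 + a34 * w x y 2 3]) := by
  obtain ⟨M, hM, hF⟩ := L.exists_ext h
  refine ⟨M, hM, fun F hI => ?_⟩
  obtain ⟨t, ht, f, hf⟩ := hF F hI
  refine ⟨t 0 1, t 0 2, t 0 3, t 1 2, t 1 3, t 2 3, f, fun x y => ?_⟩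
  rw [hf]
  funext i
  have d : ∀ i, t i i = 0 := fun i => by linarith [ht i i]
  fin_cases i
  · rfl
  · rfl
  · rfl
  · rfl
  · change (∑ i, ∑ j, t i j * (f x i.castSucc * f y j.castSucc)) =
      t 0 1 * w (f x) (f y) 0 1 + t 0 2 * w (f x) (f y) 0 2 + t 0 3 * w (f x) (f y) 0 3 + t 1 2 * w (f x) (f y) 1 2 + t 1 3 * w (f x) (f y) 1 3 + t 2 3 * w (f x) (f y) 2 3
    simp only [Fin.sum_univ_four, d, ht 1 0, ht 2 0, ht 3 0, ht 2 1, ht 3 1, ht 3 2, w, Fin.reduceCastSucc,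
      Fin.castSucc_zero, Fin.castSucc_one]
    ring

theorem LieStruct.ext6 (L : LieStruct 6) (h : L.IsNilpotent) :
    ∃ M : LieStruct 5, M.IsNilpotent ∧ ∀ F, IsoF M F → ∃ a12 a13 a14 a15 a23 a24 a25 a34 a35 a45 : ℝ,
      IsoF L (fun x y => ![F (fun i => x i.castSucc) (fun i => y i.castSucc) 0, F (fun i => x i.castSucc) (fun i => y i.castSucc) 1, F (fun i => x i.castSucc) (fun i => y i.castSucc) 2, F (fun i => x i.castSucc) (fun i => y i.castSucc) 3, F (fun i => x i.castSucc) (fun i => y i.castSucc) 4,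
        a12 * w x y 0 1 + a13 * w x y 0 2 + a14 * w x y 0 3 + a15 * w x y 0 4 + a23 * w x y 1 2 + a24 * w x y 1 3 + a25 * w x y 1 4 + a34 * w x y 2 3 + a35 * w x y 2 4 + a45 * w x y 3 4]) := by
  obtain ⟨M, hM, hF⟩ := L.exists_ext h
  refine ⟨M, hM, fun F hI => ?_⟩
  obtain ⟨t, ht, f, hf⟩ := hF F hI
  refine ⟨t 0 1, t 0 2, t 0 3, t 0 4, t 1 2, t 1 3, t 1 4, t 2 3, t 2 4, t 3 4, f, fun x y => ?_⟩
  rw [hf]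
  funext i
  have d : ∀ i, t i i = 0 := fun i => by linarith [ht i i]
  fin_cases i
  · rfl
  · rfl
  · rfl
  · rfl
  · rfl
  · change (∑ i, ∑ j, t i j * (f x i.castSucc * f y j.castSucc)) =
      t 0 1 * w (f x) (f y) 0 1 + t 0 2 * w (f x) (f y) 0 2 + t 0 3 * w (f x) (f y) 0 3 + t 0 4 * w (f x) (f y) 0 4 + t 1 2 * w (f x) (f y) 1 2 + t 1 3 * w (f x) (f y) 1 3 + t 1 4 * w (f x) (f y) 1 4 + t 2 3 * w (f x) (f y) 2 3 + t 2 4 * w (f x) (f y) 2 4 + t 3 4 * w (f x) (f y) 3 4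
    simp only [Fin.sum_univ_five, d, ht 1 0, ht 2 0, ht 3 0, ht 4 0, ht 2 1, ht 3 1, ht 4 1, ht 3 2, ht 4 2, ht 4 3, w, Fin.reduceCastSucc,
      Fin.castSucc_zero, Fin.castSucc_one]
    ring


set_option linter.unusedVariables false

theorem cls2 (L : LieStruct 2) (h : L.IsNilpotent) : IsoF L (fun x y => ![0, 0]) := by
  obtain ⟨M, hM, hF⟩ := L.exists_ext h
  have h1 : IsoF M (fun _ _ => 0) := by
    refine ⟨LinearEquiv.refl ℝ _, fun x y => ?_⟩
    have hx : ∀ x : Fin 1 → ℝ, x = x 0 • (fun _ => 1) := fun x => by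
      funext i; fin_cases i; simp
    rw [hx x, hx y, M.smul_left, M.smul_right, M.alt]
    simp
  obtain ⟨t, ht, f, hf⟩ := hF _ h1
  have d : t 0 0 = 0 := by linarith [ht 0 0]
  refine ⟨f, fun x y => ?_⟩
  rw [hf]
  funext i
  fin_cases i
  · rfl
  · change (∑ i, ∑ j, t i j * (f x i.castSucc * f y j.castSucc)) = 0
    simp [d]

theorem cls3 (L : LieStruct 3) (h : L.IsNilpotent) :
    IsoF L (fun x y => ![0, 0, 0]) ∨ IsoF L (fun x y => ![0, 0, w x y 0 1]) := by
  obtain ⟨M, hM, hF⟩ := L.ext3 h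
  obtain ⟨a12, h⟩ := hF _ (cls2 M hM)
  replace h : IsoF L (fun x y => ![0, 0, a12 * w x y 0 1]) := h
  by_cases h0 : a12 = 0
  · subst h0
    exact .inl (h.step3 _ (e 0) (e 1) (e 2))
  · exact .inr (h.step3 _ (e 0) (a12 • e 1) (e 2))

theorem cls4 (L : LieStruct 4) (h : L.IsNilpotent) :
    IsoF L (fun x y => ![0, 0, 0, 0]) ∨ IsoF L (fun x y => ![0, 0, 0, w x y 0 1]) ∨ IsoF L (fun x y => ![0, 0, w x y 0 1, w x y 0 2]) := by
  obtain ⟨M, hM, hF⟩ := L.ext4 h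
  rcases cls3 M hM with hM | hM
  · obtain ⟨a, b, c, h⟩ := hF _ hM
    replace h : IsoF L (fun x y => ![0, 0, 0, a * w x y 0 1 + b * w x y 0 2 + c * w x y 1 2]) := h
    by_cases ha : a = 0
    · subst ha
      by_cases hb : b = 0
      · subst hb
        by_cases hc : c = 0
        · subst hc
          exact .inl (h.step4 _ (e 0) (e 1) (e 2) (e 3))
        · exact .inr (.inl (h.step4 _ (e 1) (c • e 2) (e 0) (e 3)))
      · exact .inr (.inl (h.step4 _ (e 0 + (c/b) • e 1) (b • e 2) (e 1) (e 3)))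
    · exact .inr (.inl (h.step4 _ (e 0-(c/a) • e 2) (a • e 1 + b • e 2) (e 2) (e 3)))
  · obtain ⟨a, b, c, h⟩ := hF _ hM
    replace h : IsoF L (fun x y => ![0, 0, w x y 0 1, a * w x y 0 1 + b * w x y 0 2 + c * w x y 1 2]) := h
    by_cases hb : b = 0
    · subst hb
      by_cases hc : c = 0
      · subst hc
        exact .inr (.inl (h.step4 _ (e 0) (e 1) (e 3-a • e 2) (e 2)))
      · exact .inr (.inr (h.step4 _ (c • e 1) (e 0) (-c • e 2) (-c • e 3 + (c*a) • e 2)))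
    · exact .inr (.inr (h.step4 _ (b • e 0 + c • e 1) (e 1) (b • e 2) (b • e 3-(b*a) • e 2)))

theorem alt5a (L : LieStruct 5) (a12 a13 a14 a23 a24 a34 : ℝ) (h0 : a12 ≠ 0)
    (h : IsoF L (fun x y => ![0, 0, 0, 0, a12 * w x y 0 1 + a13 * w x y 0 2 + a14 * w x y 0 3 + a23 * w x y 1 2 + a24 * w x y 1 3 + a34 * w x y 2 3])) :
    IsoF L (fun x y => ![0, 0, 0, 0, w x y 0 1]) ∨ IsoF L (fun x y => ![0, 0, 0, 0, w x y 0 1 + w x y 2 3]) := by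
  have h1 := h.step5 (fun x y => ![0, 0, 0, 0, w x y 0 1 + (a34 + (a23 * a14-a24 * a13)/a12) * w x y 2 3])
    (e 0-(a23/a12) • e 2-(a24/a12) • e 3) (a12 • e 1 + a13 • e 2 + a14 • e 3) (e 2) (e 3) (e 4)
  generalize a34+(a23*a14-a24*a13)/a12 = r at h1
  by_cases hr : r = 0
  · subst hr
    exact .inl (h1.step5 _ (e 0) (e 1) (e 2) (e 3) (e 4))
  · exact .inr (h1.step5 _ (e 0) (e 1) (r • e 2) (e 3) (e 4))

theorem alt5 (L : LieStruct 5) (a12 a13 a14 a23 a24 a34 : ℝ)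
    (h : IsoF L (fun x y => ![0, 0, 0, 0, a12 * w x y 0 1 + a13 * w x y 0 2 + a14 * w x y 0 3 + a23 * w x y 1 2 + a24 * w x y 1 3 + a34 * w x y 2 3])) :
    IsoF L (fun x y => ![0, 0, 0, 0, 0]) ∨ IsoF L (fun x y => ![0, 0, 0, 0, w x y 0 1]) ∨ IsoF L (fun x y => ![0, 0, 0, 0, w x y 0 1 + w x y 2 3]) := by
  by_cases ha12 : a12 = 0
  swap
  · exact .inr (alt5a L a12 a13 a14 a23 a24 a34 ha12 (h.step5 _
      (e 0) (e 1) (e 2) (e 3) (e 4)))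
  by_cases ha13 : a13 = 0
  swap
  · exact .inr (alt5a L a13 a12 a14 (-a23) a34 a24 ha13 (h.step5 _
      (e 0) (e 2) (e 1) (e 3) (e 4)))
  by_cases ha14 : a14 = 0
  swap
  · exact .inr (alt5a L a14 a12 a13 (-a24) (-a34) a23 ha14 (h.step5 _
      (e 0) (e 3) (e 1) (e 2) (e 4)))
  by_cases ha23 : a23 = 0
  swap
  · exact .inr (alt5a L a23 (-a12) a24 (-a13) a34 a14 ha23 (h.step5 _
      (e 1) (e 2) (e 0) (e 3) (e 4)))
  by_cases ha24 : a24 = 0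
  swap
  · exact .inr (alt5a L a24 (-a12) a23 (-a14) (-a34) a13 ha24 (h.step5 _
      (e 1) (e 3) (e 0) (e 2) (e 4)))
  by_cases ha34 : a34 = 0
  swap
  · exact .inr (alt5a L a34 (-a13) (-a23) (-a14) (-a24) a12 ha34 (h.step5 _
      (e 2) (e 3) (e 0) (e 1) (e 4)))
  subst ha12 ha13 ha14 ha23 ha24 ha34
  exact .inl (h.step5 _ (e 0) (e 1) (e 2) (e 3) (e 4))

/-- The nine five-dimensional nilpotent Lie algebras. -/
def Cls5 (L : LieStruct 5) : Prop :=
  IsoF L (fun x y => ![0, 0, 0, 0, 0]) ∨ IsoF L (fun x y => ![0, 0, 0, 0, w x y 0 1]) ∨ IsoF L (fun x y => ![0, 0, 0, 0, w x y 0 1 + w x y 2 3]) ∨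
  IsoF L (fun x y => ![0, 0, 0, w x y 0 1, w x y 0 2]) ∨ IsoF L (fun x y => ![0, 0, 0, w x y 0 1, w x y 0 3]) ∨ IsoF L (fun x y => ![0, 0, 0, w x y 0 1, w x y 0 3 + w x y 1 2]) ∨
  IsoF L (fun x y => ![0, 0, w x y 0 1, w x y 0 2, w x y 1 2]) ∨ IsoF L (fun x y => ![0, 0, w x y 0 1, w x y 0 2, w x y 0 3]) ∨ IsoF L (fun x y => ![0, 0, w x y 0 1, w x y 0 2, w x y 0 3 + w x y 1 2])

theorem cls5b1 (L : LieStruct 5) (a12 a13 a14 a23 a24 : ℝ) (h0 : a14 ≠ 0)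
    (h : IsoF L (fun x y => ![0, 0, 0, w x y 0 1, a12 * w x y 0 1 + a13 * w x y 0 2 + a14 * w x y 0 3 + a23 * w x y 1 2 + a24 * w x y 1 3])) : Cls5 L := by
  have h1 := h.step5 (fun x y => ![0, 0, 0, w x y 0 1, w x y 0 3 + (a14 * a23-a13 * a24) * w x y 1 2])
    (a14 • e 0 + a24 • e 1) (e 1) (e 2) (a14 • e 3 + a13 • e 2) (a14 • e 4-(a14*a12) • e 3)
  generalize a14*a23-a13*a24 = r at h1
  by_cases hr : r = 0
  · subst hr
    exact .inr (.inr (.inr (.inr (.inl (h1.step5 _ (e 0) (e 1) (e 2) (e 3) (e 4))))))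
  · exact .inr (.inr (.inr (.inr (.inr (.inl (h1.step5 _ (e 0) (e 1) (r • e 2) (e 3) (e 4)))))))

theorem cls5b (L : LieStruct 5) (a12 a13 a14 a23 a24 a34 : ℝ)
    (h : IsoF L (fun x y => ![0, 0, 0, w x y 0 1, a12 * w x y 0 1 + a13 * w x y 0 2 + a14 * w x y 0 3 + a23 * w x y 1 2 + a24 * w x y 1 3 + a34 * w x y 2 3])) : Cls5 L := by
  have j1 := congrFun (h.jacobi ![1,0,0,0,0] ![0,1,0,0,0] ![0,0,1,0,0]) 4
  simp [w] at j1
  subst j1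
  by_cases h14 : a14 = 0
  swap
  · exact cls5b1 L a12 a13 a14 a23 a24 h14 (h.step5 _ (e 0) (e 1) (e 2) (e 3) (e 4))
  by_cases h24 : a24 = 0
  swap
  · exact cls5b1 L (-a12) a23 (-a24) a13 (-a14) (neg_ne_zero.2 h24) (h.step5 _ (e 1) (e 0) (e 2) (-e 3) (e 4))
  subst h14 h24
  by_cases h13 : a13 = 0
  swap
  · exact .inr (.inr (.inr (.inl (h.step5 _ (a13 • e 0 + a23 • e 1) (e 1) (e 2) (a13 • e 3) (e 4-a12 • e 3)))))
  subst h13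
  by_cases h23 : a23 = 0
  swap
  · exact .inr (.inr (.inr (.inl (h.step5 _ (a23 • e 1) (e 0) (e 2) (-a23 • e 3) (e 4-a12 • e 3)))))
  subst h23
  exact .inr (.inl (h.step5 _ (e 0) (e 1) (e 2) (e 4-a12 • e 3) (e 3)))

theorem cls5c (L : LieStruct 5) (a12 a13 a14 a23 a24 a34 : ℝ)
    (h : IsoF L (fun x y => ![0, 0, w x y 0 1, w x y 0 2, a12 * w x y 0 1 + a13 * w x y 0 2 + a14 * w x y 0 3 + a23 * w x y 1 2 + a24 * w x y 1 3 + a34 * w x y 2 3])) : Cls5 L := by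
  have j1 := congrFun (h.jacobi ![1,0,0,0,0] ![0,1,0,0,0] ![0,0,1,0,0]) 4
  have j2 := congrFun (h.jacobi ![1,0,0,0,0] ![0,1,0,0,0] ![0,0,0,1,0]) 4
  simp [w] at j1 j2
  subst j1 j2
  replace h := h.step5 (fun x y => ![0, 0, w x y 0 1, w x y 0 2, a14 * w x y 0 3 + a23 * w x y 1 2]) (e 0) (e 1) (e 2) (e 3) (e 4-a12 • e 2-a13 • e 3)
  by_cases ha : a14 = 0
  · subst ha
    by_cases hb : a23 = 0
    · subst hb
      exact .inr (.inr (.inr (.inr (.inl (h.step5 _ (e 0) (e 1) (e 4) (e 2) (e 3))))))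
    · exact .inr (.inr (.inr (.inr (.inr (.inr (.inl (h.step5 _ (e 0) (e 1) (e 2) (e 3) ((1/a23) • e 4))))))))
  · by_cases hb : a23 = 0
    · subst hb
      exact .inr (.inr (.inr (.inr (.inr (.inr (.inr (.inl (h.step5 _
        (e 0) (e 1) (e 2) (e 3) ((1/a14) • e 4)))))))))
    · exact .inr (.inr (.inr (.inr (.inr (.inr (.inr (.inr (h.step5 _
        (a14 • e 0) ((a14*a23) • e 1) ((a14^2*a23) • e 2) ((a14^3*a23) • e 3) ((a14^3*a23) • e 4)))))))))

theorem cls5 (L : LieStruct 5) (h : L.IsNilpotent) : Cls5 L := by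
  obtain ⟨M, hM, hF⟩ := L.ext5 h
  rcases cls4 M hM with hM | hM | hM
  · obtain ⟨a12, a13, a14, a23, a24, a34, h⟩ := hF _ hM
    rcases alt5 L a12 a13 a14 a23 a24 a34 h with h | h | h
    · exact .inl h
    · exact .inr (.inl h)
    · exact .inr (.inr (.inl h))
  · obtain ⟨a12, a13, a14, a23, a24, a34, h⟩ := hF _ hM
    exact cls5b L a12 a13 a14 a23 a24 a34 h
  · obtain ⟨a12, a13, a14, a23, a24, a34, h⟩ := hF _ hM
    exact cls5c L a12 a13 a14 a23 a24 a34 h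

set_option linter.unusedVariables false

/-- The thirty-four model brackets. -/
def mdl : Fin 34 → (Fin 6 → ℝ) → (Fin 6 → ℝ) → (Fin 6 → ℝ) := ![
  (fun x y => ![0, 0, w x y 0 1, w x y 0 2, w x y 0 3 + w x y 1 2, w x y 2 3-w x y 1 4]),
  (fun x y => ![0, 0, w x y 0 1, w x y 0 2, w x y 0 3, w x y 2 3-w x y 1 4]),
  (fun x y => ![0, 0, w x y 0 1, w x y 0 2, w x y 0 3, w x y 0 4]),
  (fun x y => ![0, 0, w x y 0 1, w x y 0 2, w x y 0 3 + w x y 1 2, w x y 1 3 + w x y 0 4]),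
  (fun x y => ![0, 0, w x y 0 1, w x y 0 2, w x y 0 3, w x y 1 2 + w x y 0 4]),
  (fun x y => ![0, 0, w x y 0 1, w x y 0 2, w x y 1 2, w x y 0 3]),
  (fun x y => ![0, 0, w x y 0 1, w x y 0 2, w x y 1 2, w x y 0 3-w x y 1 4]),
  (fun x y => ![0, 0, w x y 0 1, w x y 0 2, w x y 1 2, w x y 0 3 + w x y 1 4]),
  (fun x y => ![0, 0, 0, w x y 0 1, w x y 0 3-w x y 1 2, w x y 0 4 + w x y 2 3]),
  (fun x y => ![0, 0, 0, w x y 0 1, w x y 0 3, w x y 0 4 + w x y 1 2]),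
  (fun x y => ![0, 0, 0, w x y 0 1, w x y 0 3, w x y 0 4 + w x y 1 2 + w x y 1 3]),
  (fun x y => ![0, 0, 0, w x y 0 1, w x y 0 3, w x y 0 4 + w x y 1 3]),
  (fun x y => ![0, 0, 0, w x y 0 1, w x y 0 3, w x y 0 4]),
  (fun x y => ![0, 0, 0, w x y 0 1, w x y 0 2, w x y 0 3 + w x y 2 4]),
  (fun x y => ![0, 0, 0, w x y 0 1, w x y 1 2, w x y 0 3 + w x y 2 4]),
  (fun x y => ![0, 0, 0, w x y 0 1, w x y 1 2, w x y 0 3-w x y 2 4]),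
  (fun x y => ![0, 0, 0, w x y 0 1, w x y 0 3, w x y 1 3]),
  (fun x y => ![0, 0, 0, w x y 0 1, w x y 0 2-w x y 1 3, w x y 0 3 + w x y 1 2]),
  (fun x y => ![0, 0, 0, w x y 0 1, w x y 0 3, w x y 0 2-w x y 1 3]),
  (fun x y => ![0, 0, 0, w x y 0 1, w x y 0 2 + w x y 0 3, w x y 1 3]),
  (fun x y => ![0, 0, 0, w x y 0 1, w x y 0 2, w x y 0 3 + w x y 1 2]),
  (fun x y => ![0, 0, 0, w x y 0 1, w x y 0 2, w x y 1 3]),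
  (fun x y => ![0, 0, 0, w x y 0 1, w x y 0 2, w x y 0 3]),
  (fun x y => ![0, 0, 0, w x y 0 1, w x y 0 2, w x y 1 2]),
  (fun x y => ![0, 0, 0, 0, w x y 0 1, w x y 0 4 + w x y 2 3]),
  (fun x y => ![0, 0, 0, 0, w x y 0 1, w x y 0 4]),
  (fun x y => ![0, 0, 0, 0, w x y 0 1, w x y 0 3 + w x y 1 4]),
  (fun x y => ![0, 0, 0, 0, w x y 0 2-w x y 1 3, w x y 0 3 + w x y 1 2]),
  (fun x y => ![0, 0, 0, 0, w x y 0 1, w x y 0 3 + w x y 1 2]),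
  (fun x y => ![0, 0, 0, 0, w x y 0 1, w x y 2 3]),
  (fun x y => ![0, 0, 0, 0, w x y 0 1, w x y 0 2]),
  (fun x y => ![0, 0, 0, 0, 0, w x y 0 1 + w x y 2 3]),
  (fun x y => ![0, 0, 0, 0, 0, w x y 0 1]),
  (fun x y => ![0, 0, 0, 0, 0, 0])]

/-- `L` is isomorphic to one of the thirty-four models. -/
def Cls (L : LieStruct 6) : Prop := ∃ i, IsoF L (mdl i)

theorem Cls.m1 {L : LieStruct 6} (h : IsoF L (fun x y => ![0, 0, w x y 0 1, w x y 0 2, w x y 0 3 + w x y 1 2, w x y 2 3-w x y 1 4])) : Cls L :=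
  ⟨0, h⟩
theorem Cls.m2 {L : LieStruct 6} (h : IsoF L (fun x y => ![0, 0, w x y 0 1, w x y 0 2, w x y 0 3, w x y 2 3-w x y 1 4])) : Cls L :=
  ⟨1, h⟩
theorem Cls.m3 {L : LieStruct 6} (h : IsoF L (fun x y => ![0, 0, w x y 0 1, w x y 0 2, w x y 0 3, w x y 0 4])) : Cls L :=
  ⟨2, h⟩
theorem Cls.m4 {L : LieStruct 6} (h : IsoF L (fun x y => ![0, 0, w x y 0 1, w x y 0 2, w x y 0 3 + w x y 1 2, w x y 1 3 + w x y 0 4])) : Cls L :=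
  ⟨3, h⟩
theorem Cls.m5 {L : LieStruct 6} (h : IsoF L (fun x y => ![0, 0, w x y 0 1, w x y 0 2, w x y 0 3, w x y 1 2 + w x y 0 4])) : Cls L :=
  ⟨4, h⟩
theorem Cls.m6 {L : LieStruct 6} (h : IsoF L (fun x y => ![0, 0, w x y 0 1, w x y 0 2, w x y 1 2, w x y 0 3])) : Cls L :=
  ⟨5, h⟩
theorem Cls.m7 {L : LieStruct 6} (h : IsoF L (fun x y => ![0, 0, w x y 0 1, w x y 0 2, w x y 1 2, w x y 0 3-w x y 1 4])) : Cls L :=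
  ⟨6, h⟩
theorem Cls.m8 {L : LieStruct 6} (h : IsoF L (fun x y => ![0, 0, w x y 0 1, w x y 0 2, w x y 1 2, w x y 0 3 + w x y 1 4])) : Cls L :=
  ⟨7, h⟩
theorem Cls.m9 {L : LieStruct 6} (h : IsoF L (fun x y => ![0, 0, 0, w x y 0 1, w x y 0 3-w x y 1 2, w x y 0 4 + w x y 2 3])) : Cls L :=
  ⟨8, h⟩
theorem Cls.m10 {L : LieStruct 6} (h : IsoF L (fun x y => ![0, 0, 0, w x y 0 1, w x y 0 3, w x y 0 4 + w x y 1 2])) : Cls L :=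
  ⟨9, h⟩
theorem Cls.m11 {L : LieStruct 6} (h : IsoF L (fun x y => ![0, 0, 0, w x y 0 1, w x y 0 3, w x y 0 4 + w x y 1 2 + w x y 1 3])) : Cls L :=
  ⟨10, h⟩
theorem Cls.m12 {L : LieStruct 6} (h : IsoF L (fun x y => ![0, 0, 0, w x y 0 1, w x y 0 3, w x y 0 4 + w x y 1 3])) : Cls L :=
  ⟨11, h⟩
theorem Cls.m13 {L : LieStruct 6} (h : IsoF L (fun x y => ![0, 0, 0, w x y 0 1, w x y 0 3, w x y 0 4])) : Cls L :=
  ⟨12, h⟩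
theorem Cls.m14 {L : LieStruct 6} (h : IsoF L (fun x y => ![0, 0, 0, w x y 0 1, w x y 0 2, w x y 0 3 + w x y 2 4])) : Cls L :=
  ⟨13, h⟩
theorem Cls.m15 {L : LieStruct 6} (h : IsoF L (fun x y => ![0, 0, 0, w x y 0 1, w x y 1 2, w x y 0 3 + w x y 2 4])) : Cls L :=
  ⟨14, h⟩
theorem Cls.m16 {L : LieStruct 6} (h : IsoF L (fun x y => ![0, 0, 0, w x y 0 1, w x y 1 2, w x y 0 3-w x y 2 4])) : Cls L :=
  ⟨15, h⟩
theorem Cls.m17 {L : LieStruct 6} (h : IsoF L (fun x y => ![0, 0, 0, w x y 0 1, w x y 0 3, w x y 1 3])) : Cls L :=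
  ⟨16, h⟩
theorem Cls.m18 {L : LieStruct 6} (h : IsoF L (fun x y => ![0, 0, 0, w x y 0 1, w x y 0 2-w x y 1 3, w x y 0 3 + w x y 1 2])) : Cls L :=
  ⟨17, h⟩
theorem Cls.m19 {L : LieStruct 6} (h : IsoF L (fun x y => ![0, 0, 0, w x y 0 1, w x y 0 3, w x y 0 2-w x y 1 3])) : Cls L :=
  ⟨18, h⟩
theorem Cls.m20 {L : LieStruct 6} (h : IsoF L (fun x y => ![0, 0, 0, w x y 0 1, w x y 0 2 + w x y 0 3, w x y 1 3])) : Cls L :=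
  ⟨19, h⟩
theorem Cls.m21 {L : LieStruct 6} (h : IsoF L (fun x y => ![0, 0, 0, w x y 0 1, w x y 0 2, w x y 0 3 + w x y 1 2])) : Cls L :=
  ⟨20, h⟩
theorem Cls.m22 {L : LieStruct 6} (h : IsoF L (fun x y => ![0, 0, 0, w x y 0 1, w x y 0 2, w x y 1 3])) : Cls L :=
  ⟨21, h⟩
theorem Cls.m23 {L : LieStruct 6} (h : IsoF L (fun x y => ![0, 0, 0, w x y 0 1, w x y 0 2, w x y 0 3])) : Cls L :=
  ⟨22, h⟩
theorem Cls.m24 {L : LieStruct 6} (h : IsoF L (fun x y => ![0, 0, 0, w x y 0 1, w x y 0 2, w x y 1 2])) : Cls L :=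
  ⟨23, h⟩
theorem Cls.m25 {L : LieStruct 6} (h : IsoF L (fun x y => ![0, 0, 0, 0, w x y 0 1, w x y 0 4 + w x y 2 3])) : Cls L :=
  ⟨24, h⟩
theorem Cls.m26 {L : LieStruct 6} (h : IsoF L (fun x y => ![0, 0, 0, 0, w x y 0 1, w x y 0 4])) : Cls L :=
  ⟨25, h⟩
theorem Cls.m27 {L : LieStruct 6} (h : IsoF L (fun x y => ![0, 0, 0, 0, w x y 0 1, w x y 0 3 + w x y 1 4])) : Cls L :=
  ⟨26, h⟩
theorem Cls.m28 {L : LieStruct 6} (h : IsoF L (fun x y => ![0, 0, 0, 0, w x y 0 2-w x y 1 3, w x y 0 3 + w x y 1 2])) : Cls L :=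
  ⟨27, h⟩
theorem Cls.m29 {L : LieStruct 6} (h : IsoF L (fun x y => ![0, 0, 0, 0, w x y 0 1, w x y 0 3 + w x y 1 2])) : Cls L :=
  ⟨28, h⟩
theorem Cls.m30 {L : LieStruct 6} (h : IsoF L (fun x y => ![0, 0, 0, 0, w x y 0 1, w x y 2 3])) : Cls L :=
  ⟨29, h⟩
theorem Cls.m31 {L : LieStruct 6} (h : IsoF L (fun x y => ![0, 0, 0, 0, w x y 0 1, w x y 0 2])) : Cls L :=
  ⟨30, h⟩
theorem Cls.m32 {L : LieStruct 6} (h : IsoF L (fun x y => ![0, 0, 0, 0, 0, w x y 0 1 + w x y 2 3])) : Cls L :=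
  ⟨31, h⟩
theorem Cls.m33 {L : LieStruct 6} (h : IsoF L (fun x y => ![0, 0, 0, 0, 0, w x y 0 1])) : Cls L :=
  ⟨32, h⟩
theorem Cls.m34 {L : LieStruct 6} (h : IsoF L (fun x y => ![0, 0, 0, 0, 0, 0])) : Cls L :=
  ⟨33, h⟩

theorem alt6b (L : LieStruct 6) (p q r : ℝ)
    (h : IsoF L (fun x y => ![0, 0, 0, 0, 0, w x y 0 1 + p * w x y 2 3 + q * w x y 2 4 + r * w x y 3 4])) : Cls L := by
  by_cases hp : p = 0
  swap
  · exact .m32 (h.step6 _ (e 0) (e 1) (e 2-(r/p) • e 4) (p • e 3 + q • e 4) (e 4) (e 5))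
  subst hp
  by_cases hq : q = 0
  swap
  · exact .m32 (h.step6 _ (e 0) (e 1) (e 2 + (r/q) • e 3) (q • e 4) (e 3) (e 5))
  subst hq
  by_cases hr : r = 0
  swap
  · exact .m32 (h.step6 _ (e 0) (e 1) (e 3) (r • e 4) (e 2) (e 5))
  subst hr
  exact .m33 (h.step6 _ (e 0) (e 1) (e 2) (e 3) (e 4) (e 5))

theorem alt6a (L : LieStruct 6) (a12 a13 a14 a15 a23 a24 a25 a34 a35 a45 : ℝ) (h0 : a12 ≠ 0)
    (h : IsoF L (fun x y => ![0, 0, 0, 0, 0, a12 * w x y 0 1 + a13 * w x y 0 2 + a14 * w x y 0 3 + a15 * w x y 0 4 + a23 * w x y 1 2 + a24 * w x y 1 3 + a25 * w x y 1 4 + a34 * w x y 2 3 + a35 * w x y 2 4 + a45 * w x y 3 4])) : Cls L := by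
  exact alt6b L (a34+(a23*a14-a24*a13)/a12) (a35+(a23*a15-a25*a13)/a12)
    (a45+(a24*a15-a25*a14)/a12) (h.step6 _
    (e 0-(a23/a12) • e 2-(a24/a12) • e 3-(a25/a12) • e 4) (a12 • e 1 + a13 • e 2 + a14 • e 3 + a15 • e 4) (e 2) (e 3) (e 4) (e 5))

theorem clsA (L : LieStruct 6) (a12 a13 a14 a15 a23 a24 a25 a34 a35 a45 : ℝ)
    (h : IsoF L (fun x y => ![0, 0, 0, 0, 0, a12 * w x y 0 1 + a13 * w x y 0 2 + a14 * w x y 0 3 + a15 * w x y 0 4 + a23 * w x y 1 2 + a24 * w x y 1 3 + a25 * w x y 1 4 + a34 * w x y 2 3 + a35 * w x y 2 4 + a45 * w x y 3 4])) : Cls L := by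
  by_cases ha12 : a12 = 0
  swap
  · exact alt6a L a12 a13 a14 a15 a23 a24 a25 a34 a35 a45
      ha12 (h.step6 _ (e 0) (e 1) (e 2) (e 3) (e 4) (e 5))
  by_cases ha13 : a13 = 0
  swap
  · exact alt6a L a13 a12 a14 a15 (-a23) a34 a35 a24 a25 a45
      ha13 (h.step6 _ (e 0) (e 2) (e 1) (e 3) (e 4) (e 5))
  by_cases ha14 : a14 = 0
  swap
  · exact alt6a L a14 a12 a13 a15 (-a24) (-a34) a45 a23 a25 a35
      ha14 (h.step6 _ (e 0) (e 3) (e 1) (e 2) (e 4) (e 5))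
  by_cases ha15 : a15 = 0
  swap
  · exact alt6a L a15 a12 a13 a14 (-a25) (-a35) (-a45) a23 a24 a34
      ha15 (h.step6 _ (e 0) (e 4) (e 1) (e 2) (e 3) (e 5))
  by_cases ha23 : a23 = 0
  swap
  · exact alt6a L a23 (-a12) a24 a25 (-a13) a34 a35 a14 a15 a45
      ha23 (h.step6 _ (e 1) (e 2) (e 0) (e 3) (e 4) (e 5))
  by_cases ha24 : a24 = 0
  swap
  · exact alt6a L a24 (-a12) a23 a25 (-a14) (-a34) a45 a13 a15 a35
      ha24 (h.step6 _ (e 1) (e 3) (e 0) (e 2) (e 4) (e 5))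
  by_cases ha25 : a25 = 0
  swap
  · exact alt6a L a25 (-a12) a23 a24 (-a15) (-a35) (-a45) a13 a14 a34
      ha25 (h.step6 _ (e 1) (e 4) (e 0) (e 2) (e 3) (e 5))
  by_cases ha34 : a34 = 0
  swap
  · exact alt6a L a34 (-a13) (-a23) a35 (-a14) (-a24) a45 a12 a15 a25
      ha34 (h.step6 _ (e 2) (e 3) (e 0) (e 1) (e 4) (e 5))
  by_cases ha35 : a35 = 0
  swap
  · exact alt6a L a35 (-a13) (-a23) a34 (-a15) (-a25) (-a45) a12 a14 a24
      ha35 (h.step6 _ (e 2) (e 4) (e 0) (e 1) (e 3) (e 5))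
  by_cases ha45 : a45 = 0
  swap
  · exact alt6a L a45 (-a14) (-a24) (-a34) (-a15) (-a25) (-a35) a12 a13 a23
      ha45 (h.step6 _ (e 3) (e 4) (e 0) (e 1) (e 2) (e 5))
  subst ha12 ha13 ha14 ha15 ha23 ha24 ha25 ha34 ha35 ha45
  exact .m34 (h.step6 _ (e 0) (e 1) (e 2) (e 3) (e 4) (e 5))

theorem clsB1 (L : LieStruct 6) (p q r : ℝ)
    (h : IsoF L (fun x y => ![0, 0, 0, 0, w x y 0 1, w x y 0 4 + p * w x y 1 2 + q * w x y 1 3 + r * w x y 2 3])) : Cls L := by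
  by_cases hr : r = 0
  swap
  · exact .m25 (h.step6 _ (e 0) (e 1) (r • e 2 + q • e 1) (e 3-(p/r) • e 1) (e 4) (e 5))
  subst hr
  by_cases hp : p = 0
  swap
  · exact .m27 (h.step6 _ (e 1) (e 0) (e 3) (-p • e 2-q • e 3) (-e 4) (-e 5))
  subst hp
  by_cases hq : q = 0
  swap
  · exact .m27 (h.step6 _ (e 1) (e 0) (e 2) (-q • e 3) (-e 4) (-e 5))
  subst hq
  exact .m26 (h.step6 _ (e 0) (e 1) (e 2) (e 3) (e 4) (e 5))

theorem clsB2a (L : LieStruct 6) (a13 a14 a23 a24 : ℝ) (h13 : a13 ≠ 0)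
    (D : a13 * a24 - a14 * a23 = 0)
    (h : IsoF L (fun x y => ![0, 0, 0, 0, w x y 0 1, a13 * w x y 0 2 + a14 * w x y 0 3 + a23 * w x y 1 2 + a24 * w x y 1 3])) : Cls L := by
  obtain rfl : a24 = a14 * a23 / a13 := by field_simp; linarith
  exact .m31 (h.step6 _ (a13 • e 0 + a23 • e 1) (e 1) (a13 • e 2 + a14 • e 3) (e 3) (a13 • e 4) (a13 • e 5))

theorem clsB2 (L : LieStruct 6) (a13 a14 a23 a24 a34 : ℝ)
    (h : IsoF L (fun x y => ![0, 0, 0, 0, w x y 0 1, a13 * w x y 0 2 + a14 * w x y 0 3 + a23 * w x y 1 2 + a24 * w x y 1 3 + a34 * w x y 2 3])) : Cls L := by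
  by_cases h34 : a34 = 0
  swap
  · exact .m30 (h.step6 _ (e 0) (e 1) (a34 • e 2 + a14 • e 0 + a24 • e 1) (e 3-(a13/a34) • e 0-(a23/a34) • e 1) (e 4) (e 5 + ((a24*a13-a14*a23)/a34) • e 4))
  subst h34
  by_cases D : a13 * a24 - a14 * a23 = 0
  swap
  · refine .m29 (h.step6 _ (e 0) (e 1) (a23 • e 2 + a24 • e 3) (a13 • e 2 + a14 • e 3) (e 4) (e 5) ?_)
    intro x
    simp only [LinearMap.add_apply, LinearMap.smul_apply, LinearMap.proj_apply, smul_eq_mul]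
    intro k1 k2 k3 k4 k5 k6
    have k7 : x 2 = 0 := (mul_eq_zero.1 (show (a13 * a24 - a14 * a23) * x 2 = 0 by grind)).resolve_left D
    have k8 : x 3 = 0 := (mul_eq_zero.1 (show (a13 * a24 - a14 * a23) * x 3 = 0 by grind)).resolve_left D
    exact ⟨k1, k2, k7, k8, k5, k6⟩
  by_cases h13 : a13 = 0
  swap
  · exact clsB2a L a13 a14 a23 a24 h13 D (h.step6 _ (e 0) (e 1) (e 2) (e 3) (e 4) (e 5))
  by_cases h14 : a14 = 0
  swap
  · exact clsB2a L a14 a13 a24 a23 h14 (by linarith) (h.step6 _ (e 0) (e 1) (e 3) (e 2) (e 4) (e 5))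
  by_cases h23 : a23 = 0
  swap
  · exact clsB2a L a23 a24 a13 a14 h23 (by linarith) (h.step6 _ (e 1) (e 0) (e 2) (e 3) (-e 4) (e 5))
  by_cases h24 : a24 = 0
  swap
  · exact clsB2a L a24 a23 a14 a13 h24 (by linarith) (h.step6 _ (e 1) (e 0) (e 3) (e 2) (-e 4) (e 5))
  subst h13 h14 h23 h24
  exact .m33 (h.step6 _ (e 0) (e 1) (e 2) (e 3) (e 5) (e 4))

theorem clsB (L : LieStruct 6) (a12 a13 a14 a15 a23 a24 a25 a34 a35 a45 : ℝ)
    (h : IsoF L (fun x y => ![0, 0, 0, 0, w x y 0 1, a12 * w x y 0 1 + a13 * w x y 0 2 + a14 * w x y 0 3 + a15 * w x y 0 4 + a23 * w x y 1 2 + a24 * w x y 1 3 + a25 * w x y 1 4 + a34 * w x y 2 3 + a35 * w x y 2 4 + a45 * w x y 3 4])) : Cls L := by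
  have j1 := congrFun (h.jacobi ![1,0,0,0,0,0] ![0,1,0,0,0,0] ![0,0,1,0,0,0]) 5
  have j2 := congrFun (h.jacobi ![1,0,0,0,0,0] ![0,1,0,0,0,0] ![0,0,0,1,0,0]) 5
  simp [w] at j1 j2
  subst j1 j2
  by_cases h15 : a15 = 0
  swap
  · exact clsB1 L (a15*a23-a13*a25) (a15*a24-a14*a25) (a15*a34) (h.step6 _
      (a15 • e 0 + a25 • e 1) (e 1) (e 2) (e 3) (a15 • e 4 + a13 • e 2 + a14 • e 3) (a15 • e 5-(a15*a12) • e 4))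
  subst h15
  by_cases h25 : a25 = 0
  swap
  · exact clsB1 L (-a25*a13) (-a25*a14) (-a25*a34) (h.step6 _
      (-a25 • e 1) (e 0) (e 2) (e 3) (a25 • e 4 + a23 • e 2 + a24 • e 3) (-a25 • e 5 + (a25*a12) • e 4))
  subst h25
  exact clsB2 L a13 a14 a23 a24 a34 (h.step6 _ (e 0) (e 1) (e 2) (e 3) (e 4) (e 5-a12 • e 4))

theorem clsC1 (L : LieStruct 6) (P t a13 a14 a23 a24 : ℝ) (hP : P ≠ 0)
    (hD : P * t = a13 * a24 - a14 * a23)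
    (h : IsoF L (fun x y => ![0, 0, 0, 0, w x y 0 1 + w x y 2 3, P * w x y 0 1 + a13 * w x y 0 2 + a14 * w x y 0 3 + a23 * w x y 1 2 + a24 * w x y 1 3 + t * w x y 2 3])) : Cls L := by
  obtain rfl : t = (a13 * a24 - a14 * a23) / P := by field_simp; linarith
  exact clsB L (1/P) (-a13/P) (-a14/P) 0 (-a23/P^2) (-a24/P^2) 0
    (1+((a13 * a24 - a14 * a23) / P)/P) 0 0 (h.step6 _
      (e 0-(a23/P) • e 2-(a24/P) • e 3) (P • e 1 + a13 • e 2 + a14 • e 3) (e 2) (e 3) (e 5) (e 4))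

theorem clsC2 (L : LieStruct 6) (a13 a14 a23 a24 : ℝ) (h13 : a13 ≠ 0)
    (hD : 0 = a13 * a24 - a14 * a23)
    (h : IsoF L (fun x y => ![0, 0, 0, 0, w x y 0 1 + w x y 2 3, a13 * w x y 0 2 + a14 * w x y 0 3 + a23 * w x y 1 2 + a24 * w x y 1 3])) : Cls L := by
  obtain rfl : a24 = a14 * a23 / a13 := by field_simp; linarith
  exact clsB2 L 1 0 0 1 0 (h.step6 _
      (a13 • e 0 + a23 • e 1) (a13 • e 2 + a14 • e 3) (e 1) (e 3) (a13 • e 5) (a13 • e 4))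

theorem clsC3 (L : LieStruct 6) (P t a13 a14 a23 a24 : ℝ)
    (hD : P * t = a13 * a24 - a14 * a23)
    (h : IsoF L (fun x y => ![0, 0, 0, 0, w x y 0 1 + w x y 2 3, P * w x y 0 1 + a13 * w x y 0 2 + a14 * w x y 0 3 + a23 * w x y 1 2 + a24 * w x y 1 3 + t * w x y 2 3])) : Cls L := by
  by_cases hP : P = 0
  swap
  · exact clsC1 L P t a13 a14 a23 a24 hP hD h
  by_cases ht : t = 0
  swap
  · exact clsC1 L t P (-a13) (-a23) (-a14) (-a24) ht (by linarith) (h.step6 _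
      (e 2) (e 3) (e 0) (e 1) (e 4) (e 5))
  subst hP ht
  rw [zero_mul] at hD
  by_cases h13 : a13 = 0
  swap
  · exact clsC2 L a13 a14 a23 a24 h13 hD (h.step6 _ (e 0) (e 1) (e 2) (e 3) (e 4) (e 5))
  by_cases h14 : a14 = 0
  swap
  · exact clsC2 L a14 (-a13) a24 (-a23) h14 (by linarith) (h.step6 _ (e 0) (e 1) (e 3) (-e 2) (e 4) (e 5))
  by_cases h23 : a23 = 0
  swap
  · exact clsC2 L a23 a24 (-a13) (-a14) h23 (by linarith) (h.step6 _ (e 1) (-e 0) (e 2) (e 3) (e 4) (e 5))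
  by_cases h24 : a24 = 0
  swap
  · exact clsC2 L a24 (-a23) (-a14) a13 h24 (by linarith) (h.step6 _ (e 1) (-e 0) (e 3) (-e 2) (e 4) (e 5))
  subst h13 h14 h23 h24
  exact .m32 (h.step6 _ (e 0) (e 1) (e 2) (e 3) (e 5) (e 4))

theorem clsC4 (L : LieStruct 6) (p r a13 a14 a23 a24 : ℝ) (hr : r ≠ 0)
    (hD : r ^ 2 = a14 * a23 - a13 * a24 - p ^ 2)
    (h : IsoF L (fun x y => ![0, 0, 0, 0, w x y 0 1 + w x y 2 3, (2 * p) * w x y 0 1 + a13 * w x y 0 2 + a14 * w x y 0 3 + a23 * w x y 1 2 + a24 * w x y 1 3])) : Cls L := by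
  refine .m28 (h.step6 _ (r • e 1) (p • e 1 + a13 • e 2 + a14 • e 3) (-r • e 0) (-p • e 0 + a23 • e 2 + a24 • e 3) ((r^2 + p^2) • e 4-p • e 5) (r • e 5) ?_ ?_)
  · intro x
    simp only [LinearMap.add_apply, LinearMap.sub_apply, LinearMap.neg_apply, LinearMap.smul_apply,
      LinearMap.proj_apply, smul_eq_mul]
    intro k1 k2 k3 k4 k5 k6
    have z0 : x 0 = 0 := by grind
    have z1 : x 1 = 0 := by grind
    have z5 : x 5 = 0 := by grind
    rw [z1] at k2
    rw [z0] at k4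
    rw [z5] at k5
    have hq : r ^ 2 + p ^ 2 ≠ 0 := by positivity
    have z4 : x 4 = 0 := by grind
    have z2 : x 2 = 0 := (mul_eq_zero.1 (show (r ^ 2 + p ^ 2) * x 2 = 0 by rw [hD]; grind)).resolve_left hq
    have z3 : x 3 = 0 := (mul_eq_zero.1 (show (r ^ 2 + p ^ 2) * x 3 = 0 by rw [hD]; grind)).resolve_left hq
    exact ⟨z0, z1, z2, z3, z4, z5⟩
  · intro x y
    refine ⟨?_, ?_, ?_, ?_, ?_, ?_⟩ <;>
    simp only [w, Matrix.cons_val, LinearMap.add_apply, LinearMap.smul_apply, LinearMap.sub_apply,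
        LinearMap.neg_apply, LinearMap.proj_apply, smul_eq_mul]
    · ring1
    · ring1
    · ring1
    · ring1
    · linear_combination (x 2 * y 3 - x 3 * y 2) * hD
    · ring1

theorem clsC (L : LieStruct 6) (a12 a13 a14 a15 a23 a24 a25 a34 a35 a45 : ℝ)
    (h : IsoF L (fun x y => ![0, 0, 0, 0, w x y 0 1 + w x y 2 3, a12 * w x y 0 1 + a13 * w x y 0 2 + a14 * w x y 0 3 + a15 * w x y 0 4 + a23 * w x y 1 2 + a24 * w x y 1 3 + a25 * w x y 1 4 + a34 * w x y 2 3 + a35 * w x y 2 4 + a45 * w x y 3 4])) : Cls L := by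
  have j1 := congrFun (h.jacobi ![1,0,0,0,0,0] ![0,1,0,0,0,0] ![0,0,1,0,0,0]) 5
  have j2 := congrFun (h.jacobi ![1,0,0,0,0,0] ![0,1,0,0,0,0] ![0,0,0,1,0,0]) 5
  have j3 := congrFun (h.jacobi ![1,0,0,0,0,0] ![0,0,1,0,0,0] ![0,0,0,1,0,0]) 5
  have j4 := congrFun (h.jacobi ![0,1,0,0,0,0] ![0,0,1,0,0,0] ![0,0,0,1,0,0]) 5
  simp [w] at j1 j2 j3 j4
  have j5 := congrFun (h.jacobi ![1,0,0,0,0,0] ![0,1,0,0,0,0] ![0,0,0,0,1,0]) 5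
  simp [w] at j5
  subst j1 j2 j3 j4
  obtain ⟨p, hp⟩ : ∃ p, 2 * p = a12 - a34 := ⟨(a12 - a34) / 2, by ring⟩
  replace h := h.step6 (fun x y => ![0, 0, 0, 0, w x y 0 1 + w x y 2 3, (2 * p) * w x y 0 1 + a13 * w x y 0 2 + a14 * w x y 0 3 + a23 * w x y 1 2 + a24 * w x y 1 3])
    (e 0) (e 1) (e 2) (e 3) (e 4) (e 5-a34 • e 4) (hG := by
      intro x y
      refine ⟨?_, ?_, ?_, ?_, ?_, ?_⟩ <;>
      simp only [w, Matrix.cons_val, LinearMap.smul_apply, LinearMap.sub_apply,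
          LinearMap.proj_apply, smul_eq_mul, hp]
      ring1)
  by_cases hd : 0 < a14 * a23 - a13 * a24 - p ^ 2
  · exact clsC4 L p (√(a14 * a23 - a13 * a24 - p ^ 2)) a13 a14 a23 a24
      (Real.sqrt_pos.2 hd).ne' (Real.sq_sqrt hd.le) h
  · have hs := Real.sq_sqrt (show 0 ≤ -(a14 * a23 - a13 * a24 - p ^ 2) by linarith)
    generalize √(-(a14 * a23 - a13 * a24 - p ^ 2)) = s at hs
    exact clsC3 L (p + s) (-p + s) a13 a14 a23 a24 (by linarith)
      (h.step6 _ (e 0) (e 1) (e 2) (e 3) (e 4) (e 5 + (-p + s) • e 4))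

set_option linter.unusedVariables false
set_option linter.unusedSimpArgs false

theorem clsD1 (L : LieStruct 6) (K Q : ℝ)
    (h : IsoF L (fun x y => ![0, 0, 0, w x y 0 1, w x y 0 2, w x y 1 3 + K * w x y 2 4 + Q * w x y 0 4])) : Cls L := by
  rcases lt_trichotomy K 0 with hK | rfl | hK
  · replace h := h.step6 (fun x y => ![0, 0, 0, w x y 0 1, w x y 0 2, w x y 1 3 + K * w x y 2 4]) (e 0) (e 1) (e 2 + (Q/K) • e 0) (e 3) (e 4) (e 5)
      (by intro x; simp only [LinearMap.add_apply, LinearMap.smul_apply, LinearMap.proj_apply,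
            smul_eq_mul]; grind)
      (by
        have hK0 := hK.ne
        intro x y
        refine ⟨?_, ?_, ?_, ?_, ?_, ?_⟩ <;>
        simp only [w, Matrix.cons_val, LinearMap.add_apply, LinearMap.smul_apply,
          LinearMap.proj_apply, smul_eq_mul] <;> first | done | ring1 | (field_simp; ring1))
    have hs := Real.sq_sqrt (show 0 ≤ -K by linarith)
    have hs0 := (Real.sqrt_pos.2 (show 0 < -K by linarith)).ne'
    generalize √(-K) = s at hs hs0
    obtain rfl : K = -s^2 := by linarith
    exact .m15 (h.step6 _ (e 1) (e 0) (s • e 2) (-e 3) (s • e 4) (-e 5))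
  · by_cases hQ : Q = 0
    · subst hQ
      exact .m22 (h.step6 _ (e 0) (e 1) (e 2) (e 3) (e 4) (e 5))
    · exact .m14 (h.step6 _ (e 0) (Q • e 2) (e 1) (Q • e 4) (e 3) (e 5))
  · have hK0 := hK.ne'
    replace h := h.step6 (fun x y => ![0, 0, 0, w x y 0 1, w x y 0 2, w x y 1 3 + K * w x y 2 4]) (e 0) (e 1) (e 2 + (Q/K) • e 0) (e 3) (e 4) (e 5)
    have hs := Real.sq_sqrt hK.le
    have hs0 := (Real.sqrt_pos.2 hK).ne'
    generalize √K = s at hs hs0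
    subst hs
    exact .m16 (h.step6 _ (e 1) (e 0) (s • e 2) (-e 3) (s • e 4) (-e 5))

theorem clsD2 (L : LieStruct 6) (r p q A B C : ℝ) (hA : A ≠ 0)
    (h : IsoF L (fun x y => ![0, 0, 0, w x y 0 1, w x y 0 2, r * w x y 1 2 + p * w x y 0 3 + q * w x y 0 4 + A * w x y 1 3 + B * w x y 1 4 + B * w x y 2 3 + C * w x y 2 4])) : Cls L :=
  clsD1 L (A*C-B^2) (A*q-p*B) (h.step6 _
    (e 0) (A • e 1 + B • e 2 + p • e 0) (e 2) (A • e 3 + B • e 4 + r • e 2) (e 4) (A • e 5 + (p*r) • e 4))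

theorem clsD3 (L : LieStruct 6) (r p q : ℝ) (hp : p ≠ 0)
    (h : IsoF L (fun x y => ![0, 0, 0, w x y 0 1, w x y 0 2, r * w x y 1 2 + p * w x y 0 3 + q * w x y 0 4])) : Cls L := by
  by_cases hr : r = 0
  · subst hr
    exact .m23 (h.step6 _ (e 0) (p • e 1 + q • e 2) (e 2) (p • e 3 + q • e 4) (e 4) (e 5))
  · exact .m21 (h.step6 _ (e 0) (p • e 1 + q • e 2) ((r/p) • e 2) (p • e 3 + q • e 4) ((r/p) • e 4) (e 5))

theorem clsD4 (L : LieStruct 6) (r p q A B C : ℝ)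
    (h : IsoF L (fun x y => ![0, 0, 0, w x y 0 1, w x y 0 2, r * w x y 1 2 + p * w x y 0 3 + q * w x y 0 4 + A * w x y 1 3 + B * w x y 1 4 + B * w x y 2 3 + C * w x y 2 4])) : Cls L := by
  by_cases hA : A = 0
  swap
  · exact clsD2 L r p q A B C hA h
  by_cases hC : C = 0
  swap
  · exact clsD2 L (-r) q p C B A hC (h.step6 _ (e 0) (e 2) (e 1) (e 4) (e 3) (e 5))
  subst hA hC
  by_cases hB : B = 0
  swap
  · exact clsD2 L r (p+q) q (2*B) B 0 (by simpa using hB) (h.step6 _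
      (e 0) (e 1) (e 2-e 1) (e 3) (e 4-e 3) (e 5))
  subst hB
  by_cases hp : p = 0
  swap
  · exact clsD3 L r p q hp (h.step6 _ (e 0) (e 1) (e 2) (e 3) (e 4) (e 5))
  by_cases hq : q = 0
  swap
  · exact clsD3 L (-r) q p hq (h.step6 _ (e 0) (e 2) (e 1) (e 4) (e 3) (e 5))
  subst hp hq
  by_cases hr : r = 0
  · subst hr
    exact .m31 (h.step6 _ (e 0) (e 1) (e 2) (e 5) (e 3) (e 4))
  · exact .m24 (h.step6 _ (e 0) (e 1) (e 2) (e 3) (e 4) ((1/r) • e 5))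

theorem clsD (L : LieStruct 6) (a12 a13 a14 a15 a23 a24 a25 a34 a35 a45 : ℝ)
    (h : IsoF L (fun x y => ![0, 0, 0, w x y 0 1, w x y 0 2, a12 * w x y 0 1 + a13 * w x y 0 2 + a14 * w x y 0 3 + a15 * w x y 0 4 + a23 * w x y 1 2 + a24 * w x y 1 3 + a25 * w x y 1 4 + a34 * w x y 2 3 + a35 * w x y 2 4 + a45 * w x y 3 4])) : Cls L := by
  have j1 := congrFun (h.jacobi ![1,0,0,0,0,0] ![0,1,0,0,0,0] ![0,0,1,0,0,0]) 5
  have j2 := congrFun (h.jacobi ![1,0,0,0,0,0] ![0,1,0,0,0,0] ![0,0,0,0,1,0]) 5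
  have j3 := congrFun (h.jacobi ![1,0,0,0,0,0] ![0,0,1,0,0,0] ![0,0,0,1,0,0]) 5
  have j4 := congrFun (h.jacobi ![1,0,0,0,0,0] ![0,1,0,0,0,0] ![0,0,0,1,0,0]) 5
  simp [w] at j1 j2 j3 j4
  obtain rfl : a34 = a25 := by linarith
  obtain rfl : a45 = 0 := by linarith
  exact clsD4 L a23 a14 a15 a24 a34 a35 (h.step6 _ (e 0) (e 1) (e 2) (e 3) (e 4) (e 5-a12 • e 3-a13 • e 4))

theorem clsE1 (L : LieStruct 6) (b c : ℝ)
    (h : IsoF L (fun x y => ![0, 0, 0, w x y 0 1, w x y 0 3, w x y 0 4 + b * w x y 1 2 + c * w x y 1 3])) : Cls L := by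
  by_cases hb : b = 0
  · subst hb
    by_cases hc : c = 0
    · subst hc
      exact .m13 (h.step6 _ (e 0) (e 1) (e 2) (e 3) (e 4) (e 5))
    · exact .m12 (h.step6 _ (e 0) (c • e 1) (e 2) (c • e 3) (c • e 4) (c • e 5))
  · by_cases hc : c = 0
    · subst hc
      exact .m10 (h.step6 _ (e 0) (e 1) (b • e 2) (e 3) (e 4) (e 5))
    · exact .m11 (h.step6 _ (e 0) (c • e 1) (b • e 2) (c • e 3) (c • e 4) (c • e 5))

theorem clsE2 (L : LieStruct 6) (a b : ℝ)
    (h : IsoF L (fun x y => ![0, 0, 0, w x y 0 1, w x y 0 3, a * w x y 0 2 + b * w x y 1 2 + w x y 1 3])) : Cls L := by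
  by_cases hb : b = 0
  · subst hb
    by_cases ha : a = 0
    · subst ha
      exact .m17 (h.step6 _ (e 0) (e 1) (e 2) (e 3) (e 4) (e 5))
    · exact .m19 (h.step6 _ (e 0) (e 1) (-a • e 2) (e 3) (e 4) (-e 5))
  · exact .m20 (h.step6 _ (e 0) (e 1 + (a/b) • e 0) (-b • e 2) (e 3 + b • e 2) (e 4) (e 5 + (a/b) • e 4))

theorem clsE (L : LieStruct 6) (a12 a13 a14 a15 a23 a24 a25 a34 a35 a45 : ℝ)
    (h : IsoF L (fun x y => ![0, 0, 0, w x y 0 1, w x y 0 3, a12 * w x y 0 1 + a13 * w x y 0 2 + a14 * w x y 0 3 + a15 * w x y 0 4 + a23 * w x y 1 2 + a24 * w x y 1 3 + a25 * w x y 1 4 + a34 * w x y 2 3 + a35 * w x y 2 4 + a45 * w x y 3 4])) : Cls L := by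
  have j1 := congrFun (h.jacobi ![1,0,0,0,0,0] ![0,1,0,0,0,0] ![0,0,1,0,0,0]) 5
  have j2 := congrFun (h.jacobi ![1,0,0,0,0,0] ![0,1,0,0,0,0] ![0,0,0,1,0,0]) 5
  have j3 := congrFun (h.jacobi ![1,0,0,0,0,0] ![0,0,1,0,0,0] ![0,0,0,1,0,0]) 5
  have j4 := congrFun (h.jacobi ![1,0,0,0,0,0] ![0,1,0,0,0,0] ![0,0,0,0,1,0]) 5
  simp [w] at j1 j2 j3 j4
  subst j1 j2 j3 j4
  by_cases hd : a15 = 0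
  swap
  · exact clsE1 L (a23/a15) (a24/a15) (h.step6 _
      (e 0) (e 1) (e 2) (e 3) (e 4 + (a13/a15) • e 2) ((1/a15) • e 5-(a12/a15) • e 3-(a14/a15) • e 4))
  subst hd
  by_cases hc : a24 = 0
  swap
  · exact clsE2 L (a13/a24) (a23/a24) (h.step6 _
      (e 0) (e 1) (e 2) (e 3) (e 4) ((1/a24) • e 5-(a12/a24) • e 3-(a14/a24) • e 4))
  subst hc
  by_cases hb : a23 = 0
  swap
  · exact .m22 (h.step6 _ (a23 • e 1 + a13 • e 0) (e 0) (e 2) (-a23 • e 3) (e 5-a12 • e 3-a14 • e 4) (-a23 • e 4))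
  subst hb
  by_cases ha : a13 = 0
  swap
  · exact .m23 (h.step6 _ (e 0) (e 1) (e 2) (e 3) ((1/a13) • e 5-(a12/a13) • e 3-(a14/a13) • e 4) (e 4))
  subst ha
  exact .m26 (h.step6 _ (e 0) (e 1) (e 2) (e 5-a12 • e 3-a14 • e 4) (e 3) (e 4))

theorem clsF2 (L : LieStruct 6) (a b : ℝ)
    (h : IsoF L (fun x y => ![0, 0, 0, w x y 0 1, w x y 0 3 + w x y 1 2, a * w x y 0 2 + (2 * b) * w x y 1 2 + w x y 1 3])) : Cls L := by
  rcases lt_trichotomy (b^2+a) 0 with hD | hD | hD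
  · have hs := Real.sq_sqrt (show 0 ≤ -(b^2+a) by linarith)
    have hs0 := (Real.sqrt_pos.2 (show 0 < -(b^2+a) by linarith)).ne'
    generalize √(-(b^2+a)) = y at hs hs0
    obtain rfl : a = -b^2-y^2 := by linarith
    exact .m18 (h.step6 _ (e 1-b • e 0) (y • e 0) ((y^2) • e 2) (-y • e 3-(y*b) • e 2) ((y^2) • e 4) (-y • e 5 + (y*b) • e 4))
  · obtain rfl : a = -b^2 := by linarith
    exact .m19 (h.step6 _ (e 1-b • e 0) (e 0) (e 2) (-e 3-b • e 2) (-e 5 + b • e 4) (e 4))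
  · have hs := Real.sq_sqrt hD.le
    have hs0 := (Real.sqrt_pos.2 hD).ne'
    generalize √(b^2+a) = s at hs hs0
    obtain rfl : a = s^2-b^2 := by linarith
    exact .m20 (h.step6 _ (e 1-(b-s) • e 0) (e 1-(b + s) • e 0) ((4*s^2) • e 2) ((2*s) • e 3 + (2*s*(b-s)) • e 2) ((2*s) • e 5-(2*s*(b-s)) • e 4) ((2*s) • e 5-(2*s*(b + s)) • e 4))

theorem clsF (L : LieStruct 6) (a12 a13 a14 a15 a23 a24 a25 a34 a35 a45 : ℝ)
    (h : IsoF L (fun x y => ![0, 0, 0, w x y 0 1, w x y 0 3 + w x y 1 2, a12 * w x y 0 1 + a13 * w x y 0 2 + a14 * w x y 0 3 + a15 * w x y 0 4 + a23 * w x y 1 2 + a24 * w x y 1 3 + a25 * w x y 1 4 + a34 * w x y 2 3 + a35 * w x y 2 4 + a45 * w x y 3 4])) : Cls L := by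
  have j1 := congrFun (h.jacobi ![1,0,0,0,0,0] ![0,1,0,0,0,0] ![0,0,1,0,0,0]) 5
  have j2 := congrFun (h.jacobi ![1,0,0,0,0,0] ![0,1,0,0,0,0] ![0,0,0,1,0,0]) 5
  have j3 := congrFun (h.jacobi ![1,0,0,0,0,0] ![0,0,1,0,0,0] ![0,0,0,1,0,0]) 5
  have j4 := congrFun (h.jacobi ![1,0,0,0,0,0] ![0,1,0,0,0,0] ![0,0,0,0,1,0]) 5
  have j5 := congrFun (h.jacobi ![0,1,0,0,0,0] ![0,0,1,0,0,0] ![0,0,0,1,0,0]) 5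
  simp [w] at j1 j2 j3 j4 j5
  obtain rfl : a25 = 0 := by linarith
  obtain rfl : a35 = 0 := by linarith
  obtain rfl : a45 = 0 := by linarith
  obtain rfl : a34 = -a15 := by linarith
  replace h := h.step6 (fun x y => ![0, 0, 0, w x y 0 1, w x y 0 3 + w x y 1 2, a13 * w x y 0 2 + (a23-a14) * w x y 1 2 + a24 * w x y 1 3 + a15 * w x y 0 4-a15 * w x y 2 3])
    (e 0) (e 1) (e 2) (e 3) (e 4) (e 5-a12 • e 3-a14 • e 4)
  generalize a23-a14 = b at h
  by_cases hd : a15 = 0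
  swap
  · replace h := h.step6 (fun x y => ![0, 0, 0, w x y 0 1, w x y 0 3 + w x y 1 2, (a13/a15) * w x y 0 2 + (2 * (b/a15/2)) * w x y 1 2 + (a24/a15) * w x y 1 3 + w x y 0 4-w x y 2 3])
      (e 0) (e 1) (e 2) (e 3) (e 4) ((1/a15) • e 5)
    generalize a13/a15 = α at h
    generalize b/a15/2 = μ at h
    generalize a24/a15 = γ at h
    replace h := h.step6 (fun x y => ![0, 0, 0, w x y 0 1, w x y 0 3 + w x y 1 2, (2 * μ) * w x y 1 2 + w x y 0 4-w x y 2 3 + (γ * α) * w x y 0 1])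
      (e 0) (e 1) (e 2-γ • e 1) (e 3) (e 4 + α • e 2-(α*γ) • e 1) (e 5)
    exact .m9 (h.step6 _ (e 0) (e 1) (-e 2-μ • e 0) (e 3 + μ • e 1) (e 4) (e 5-μ • e 4-(γ*α + μ^2) • e 3-((γ*α + μ^2)*μ) • e 1))
  subst hd
  by_cases hc : a24 = 0
  swap
  · exact clsF2 L (a13/a24) (b/a24/2) (h.step6 _ (e 0) (e 1) (e 2) (e 3) (e 4) ((1/a24) • e 5))
  subst hc
  by_cases hb : b = 0
  swap
  · exact .m22 (h.step6 _ (b • e 1 + a13 • e 0) (e 0) (e 2) (-b • e 3 + a13 • e 2) (e 5) (e 5-b • e 4))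
  subst hb
  by_cases ha : a13 = 0
  swap
  · exact .m21 (h.step6 _ (e 0) (e 1) (e 2) (e 3) ((1/a13) • e 5) (e 4))
  subst ha
  exact .m27 (h.step6 _ (e 1) (e 0) (e 5) (-e 2) (-e 3) (-e 4))

set_option linter.unusedVariables false
set_option linter.unusedSimpArgs false

theorem clsG1 (L : LieStruct 6) (p q r : ℝ) (hp : p ≠ 0)
    (h : IsoF L (fun x y => ![0, 0, w x y 0 1, w x y 0 2, w x y 1 2, p * w x y 0 3 + q * w x y 0 4 + q * w x y 1 3 + r * w x y 1 4])) : Cls L := by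
  replace h := h.step6 (fun x y => ![0, 0, w x y 0 1, w x y 0 2, w x y 1 2, w x y 0 3 + (p * r-q^2) * w x y 1 4])
    (p • e 0 + q • e 1) (e 1) (p • e 2) ((p^2) • e 3 + (p*q) • e 4) (p • e 4) ((p^2) • e 5)
  generalize p*r-q^2 = K at h
  rcases lt_trichotomy K 0 with hK | rfl | hK
  · have hs := Real.sq_sqrt (show 0 ≤ -K by linarith)
    have hs0 := (Real.sqrt_pos.2 (show 0 < -K by linarith)).ne'
    generalize √(-K) = s at hs hs0
    obtain rfl : K = -s^2 := by linarith
    exact .m7 (h.step6 _ (e 0) (s • e 1) (s • e 2) (s • e 3) ((s^2) • e 4) (s • e 5))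
  · exact .m6 (h.step6 _ (e 0) (e 1) (e 2) (e 3) (e 4) (e 5))
  · have hs := Real.sq_sqrt hK.le
    have hs0 := (Real.sqrt_pos.2 hK).ne'
    generalize √K = s at hs hs0
    subst hs
    exact .m8 (h.step6 _ (e 0) (s • e 1) (s • e 2) (s • e 3) ((s^2) • e 4) (s • e 5))

theorem clsG (L : LieStruct 6) (a12 a13 a14 a15 a23 a24 a25 a34 a35 a45 : ℝ)
    (h : IsoF L (fun x y => ![0, 0, w x y 0 1, w x y 0 2, w x y 1 2, a12 * w x y 0 1 + a13 * w x y 0 2 + a14 * w x y 0 3 + a15 * w x y 0 4 + a23 * w x y 1 2 + a24 * w x y 1 3 + a25 * w x y 1 4 + a34 * w x y 2 3 + a35 * w x y 2 4 + a45 * w x y 3 4])) : Cls L := by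
  have j1 := congrFun (h.jacobi ![1,0,0,0,0,0] ![0,1,0,0,0,0] ![0,0,1,0,0,0]) 5
  have j2 := congrFun (h.jacobi ![1,0,0,0,0,0] ![0,1,0,0,0,0] ![0,0,0,1,0,0]) 5
  have j3 := congrFun (h.jacobi ![1,0,0,0,0,0] ![0,1,0,0,0,0] ![0,0,0,0,1,0]) 5
  have j4 := congrFun (h.jacobi ![1,0,0,0,0,0] ![0,0,1,0,0,0] ![0,0,0,1,0,0]) 5
  have j5 := congrFun (h.jacobi ![1,0,0,0,0,0] ![0,0,1,0,0,0] ![0,0,0,0,1,0]) 5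
  have j6 := congrFun (h.jacobi ![0,1,0,0,0,0] ![0,0,1,0,0,0] ![0,0,0,1,0,0]) 5
  simp [w] at j1 j2 j3 j4 j5 j6
  obtain rfl : a34 = 0 := by linarith
  obtain rfl : a35 = 0 := by linarith
  obtain rfl : a45 = 0 := by linarith
  obtain rfl : a24 = a15 := by linarith
  replace h := h.step6 (fun x y => ![0, 0, w x y 0 1, w x y 0 2, w x y 1 2, a14 * w x y 0 3 + a24 * w x y 0 4 + a24 * w x y 1 3 + a25 * w x y 1 4])
    (e 0) (e 1) (e 2) (e 3) (e 4) (e 5-a12 • e 2-a13 • e 3-a23 • e 4)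
  by_cases hp : a14 = 0
  swap
  · exact clsG1 L _ _ _ hp h
  by_cases hr : a25 = 0
  swap
  · exact clsG1 L (-a25) (-a24) (-a14) (neg_ne_zero.2 hr) (h.step6 _ (e 1) (e 0) (-e 2) (-e 4) (-e 3) (e 5))
  subst hp hr
  by_cases hq : a24 = 0
  swap
  · exact clsG1 L (2*a24) a24 0 (by simpa using hq) (h.step6 _
      (e 0) (e 1-e 0) (e 2) (e 3) (e 4-e 3) (e 5))
  subst hq
  exact .m17 (h.step6 _ (e 0) (e 1) (e 5) (e 2) (e 3) (e 4))

theorem clsH (L : LieStruct 6) (a12 a13 a14 a15 a23 a24 a25 a34 a35 a45 : ℝ)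
    (h : IsoF L (fun x y => ![0, 0, w x y 0 1, w x y 0 2, w x y 0 3, a12 * w x y 0 1 + a13 * w x y 0 2 + a14 * w x y 0 3 + a15 * w x y 0 4 + a23 * w x y 1 2 + a24 * w x y 1 3 + a25 * w x y 1 4 + a34 * w x y 2 3 + a35 * w x y 2 4 + a45 * w x y 3 4])) : Cls L := by
  have j1 := congrFun (h.jacobi ![1,0,0,0,0,0] ![0,1,0,0,0,0] ![0,0,1,0,0,0]) 5
  have j2 := congrFun (h.jacobi ![1,0,0,0,0,0] ![0,1,0,0,0,0] ![0,0,0,1,0,0]) 5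
  have j3 := congrFun (h.jacobi ![1,0,0,0,0,0] ![0,1,0,0,0,0] ![0,0,0,0,1,0]) 5
  have j4 := congrFun (h.jacobi ![1,0,0,0,0,0] ![0,0,1,0,0,0] ![0,0,0,1,0,0]) 5
  have j5 := congrFun (h.jacobi ![1,0,0,0,0,0] ![0,0,1,0,0,0] ![0,0,0,0,1,0]) 5
  have j6 := congrFun (h.jacobi ![0,1,0,0,0,0] ![0,0,1,0,0,0] ![0,0,0,1,0,0]) 5
  simp [w] at j1 j2 j3 j4 j5 j6
  obtain rfl : a24 = 0 := by linarith
  obtain rfl : a35 = 0 := by linarith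
  obtain rfl : a45 = 0 := by linarith
  obtain rfl : a34 = -a25 := by linarith
  replace h := h.step6 (fun x y => ![0, 0, w x y 0 1, w x y 0 2, w x y 0 3, a23 * w x y 1 2 + a15 * w x y 0 4 + a25 * w x y 1 4-a25 * w x y 2 3])
    (e 0) (e 1) (e 2) (e 3) (e 4) (e 5-a12 • e 2-a13 • e 3-a14 • e 4)
  by_cases hc : a25 = 0
  swap
  · replace h := h.step6 (fun x y => ![0, 0, w x y 0 1, w x y 0 2, w x y 0 3, (2 * (a23/a25/2)) * w x y 1 2 + (a15/a25) * w x y 0 4 + w x y 1 4-w x y 2 3])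
      (e 0) (e 1) (e 2) (e 3) (e 4) ((1/a25) • e 5)
    generalize a23/a25/2 = α at h
    generalize a15/a25 = β at h
    exact .m2 (h.step6 _ (e 0) (e 1 + β • e 0) (e 2) (e 3 + α • e 1 + (α*β) • e 0) (e 4 + α • e 2) (-e 5-(2*α*β) • e 3))
  subst hc
  by_cases hb : a15 = 0
  swap
  · by_cases ha : a23 = 0
    · subst ha
      exact .m3 (h.step6 _ (e 0) (e 1) (e 2) (e 3) (e 4) ((1/a15) • e 5))
    · exact .m5 (h.step6 _ (e 0) ((a23/a15) • e 1) ((a23/a15) • e 2) ((a23/a15) • e 3) ((a23/a15) • e 4) ((a23/a15/a15) • e 5))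
  subst hb
  by_cases ha : a23 = 0
  · subst ha
    exact .m13 (h.step6 _ (e 0) (e 1) (e 5) (e 2) (e 3) (e 4))
  · exact .m6 (h.step6 _ (e 0) (e 1) (e 2) (e 3) ((1/a23) • e 5) (e 4))

theorem clsI (L : LieStruct 6) (a12 a13 a14 a15 a23 a24 a25 a34 a35 a45 : ℝ)
    (h : IsoF L (fun x y => ![0, 0, w x y 0 1, w x y 0 2, w x y 0 3 + w x y 1 2, a12 * w x y 0 1 + a13 * w x y 0 2 + a14 * w x y 0 3 + a15 * w x y 0 4 + a23 * w x y 1 2 + a24 * w x y 1 3 + a25 * w x y 1 4 + a34 * w x y 2 3 + a35 * w x y 2 4 + a45 * w x y 3 4])) : Cls L := by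
  have j1 := congrFun (h.jacobi ![1,0,0,0,0,0] ![0,1,0,0,0,0] ![0,0,1,0,0,0]) 5
  have j2 := congrFun (h.jacobi ![1,0,0,0,0,0] ![0,1,0,0,0,0] ![0,0,0,1,0,0]) 5
  have j3 := congrFun (h.jacobi ![1,0,0,0,0,0] ![0,1,0,0,0,0] ![0,0,0,0,1,0]) 5
  have j4 := congrFun (h.jacobi ![1,0,0,0,0,0] ![0,0,1,0,0,0] ![0,0,0,1,0,0]) 5
  have j5 := congrFun (h.jacobi ![1,0,0,0,0,0] ![0,0,1,0,0,0] ![0,0,0,0,1,0]) 5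
  have j6 := congrFun (h.jacobi ![0,1,0,0,0,0] ![0,0,1,0,0,0] ![0,0,0,1,0,0]) 5
  simp [w] at j1 j2 j3 j4 j5 j6
  obtain rfl : a35 = 0 := by linarith
  obtain rfl : a45 = 0 := by linarith
  obtain rfl : a24 = a15 := by linarith
  obtain rfl : a34 = -a25 := by linarith
  replace h := h.step6 (fun x y => ![0, 0, w x y 0 1, w x y 0 2, w x y 0 3 + w x y 1 2, (a23-a14) * w x y 1 2 + a24 * w x y 0 4 + a24 * w x y 1 3 + a25 * w x y 1 4-a25 * w x y 2 3])
    (e 0) (e 1) (e 2) (e 3) (e 4) (e 5-a12 • e 2-a13 • e 3-a14 • e 4)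
  generalize a23-a14 = a at h
  by_cases hc : a25 = 0
  swap
  · replace h := h.step6 (fun x y => ![0, 0, w x y 0 1, w x y 0 2, w x y 0 3 + w x y 1 2, (2 * (a/a25/2)) * w x y 1 2 + (a24/a25) * w x y 0 4 + (a24/a25) * w x y 1 3 + w x y 1 4-w x y 2 3])
      (e 0) (e 1) (e 2) (e 3) (e 4) ((1/a25) • e 5)
    generalize a/a25/2 = α at h
    generalize a24/a25 = β at h
    replace h := h.step6 (fun x y => ![0, 0, w x y 0 1, w x y 0 2, w x y 0 3 + w x y 1 2, w x y 1 4-w x y 2 3 + (2 * α-β^2) * w x y 1 2-(2 * α * β + β^3) * w x y 0 2-(2 * α * β^2) * w x y 0 1-(β^2) * w x y 0 3])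
      (e 0) (e 1 + β • e 0) (e 2-β • e 1-(β^2) • e 0) (e 3-β • e 2 + (β^2) • e 1 + (β^3) • e 0) (e 4 + (β^2) • e 2-(β^3) • e 1-(β^4) • e 0) (e 5)
    exact .m1 (h.step6 _ (e 0) (e 1) (e 2) (e 3 + α • e 1) (e 4 + α • e 2) (-e 5-(β^2) • e 4-(2*α*β + β^3) • e 3-(2*α*β^2) • e 2))
  subst hc
  by_cases hb : a24 = 0
  swap
  · replace h := h.step6 (fun x y => ![0, 0, w x y 0 1, w x y 0 2, w x y 0 3 + w x y 1 2, (-2 * (-a/a24/2)) * w x y 1 2 + w x y 0 4 + w x y 1 3])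
      (e 0) (e 1) (e 2) (e 3) (e 4) ((1/a24) • e 5)
    generalize -a/a24/2 = t at h
    exact .m4 (h.step6 _ (e 0) (e 1 + t • e 0) (e 2-t • e 1-(t^2) • e 0) (e 3-t • e 2) (e 4) (e 5 + t • e 4-(t^2) • e 3))
  subst hb
  by_cases ha : a = 0
  · subst ha
    exact .m12 (h.step6 _ (e 0) (e 1) (e 5) (e 2) (e 3) (e 4))
  · exact .m6 (h.step6 _ (e 0) (e 1) (e 2) (e 3) ((1/a) • e 5) (e 4-(1/a) • e 5))

theorem cls6 (L : LieStruct 6) (h : L.IsNilpotent) : Cls L := by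
  obtain ⟨M, hM, hF⟩ := L.ext6 h
  rcases cls5 M hM with hM | hM | hM | hM | hM | hM | hM | hM | hM <;>
  obtain ⟨a12, a13, a14, a15, a23, a24, a25, a34, a35, a45, h⟩ := hF _ hM
  · exact clsA L a12 a13 a14 a15 a23 a24 a25 a34 a35 a45 h
  · exact clsB L a12 a13 a14 a15 a23 a24 a25 a34 a35 a45 h
  · exact clsC L a12 a13 a14 a15 a23 a24 a25 a34 a35 a45 h
  · exact clsD L a12 a13 a14 a15 a23 a24 a25 a34 a35 a45 h
  · exact clsE L a12 a13 a14 a15 a23 a24 a25 a34 a35 a45 h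
  · exact clsF L a12 a13 a14 a15 a23 a24 a25 a34 a35 a45 h
  · exact clsG L a12 a13 a14 a15 a23 a24 a25 a34 a35 a45 h
  · exact clsH L a12 a13 a14 a15 a23 a24 a25 a34 a35 a45 h
  · exact clsI L a12 a13 a14 a15 a23 a24 a25 a34 a35 a45 h

set_option linter.unusedVariables false
set_option linter.unusedSimpArgs false

/-- Sparse structure constants of the models. -/
def tab : Fin 34 → Fin 6 → List (ℤ × Fin 6 × Fin 6) := ![
  ![[], [], [(1, 0, 1)], [(1, 0, 2)], [(1, 0, 3), (1, 1, 2)], [(1, 2, 3), (-1, 1, 4)]],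
  ![[], [], [(1, 0, 1)], [(1, 0, 2)], [(1, 0, 3)], [(1, 2, 3), (-1, 1, 4)]],
  ![[], [], [(1, 0, 1)], [(1, 0, 2)], [(1, 0, 3)], [(1, 0, 4)]],
  ![[], [], [(1, 0, 1)], [(1, 0, 2)], [(1, 0, 3), (1, 1, 2)], [(1, 1, 3), (1, 0, 4)]],
  ![[], [], [(1, 0, 1)], [(1, 0, 2)], [(1, 0, 3)], [(1, 1, 2), (1, 0, 4)]],
  ![[], [], [(1, 0, 1)], [(1, 0, 2)], [(1, 1, 2)], [(1, 0, 3)]],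
  ![[], [], [(1, 0, 1)], [(1, 0, 2)], [(1, 1, 2)], [(1, 0, 3), (-1, 1, 4)]],
  ![[], [], [(1, 0, 1)], [(1, 0, 2)], [(1, 1, 2)], [(1, 0, 3), (1, 1, 4)]],
  ![[], [], [], [(1, 0, 1)], [(1, 0, 3), (-1, 1, 2)], [(1, 0, 4), (1, 2, 3)]],
  ![[], [], [], [(1, 0, 1)], [(1, 0, 3)], [(1, 0, 4), (1, 1, 2)]],
  ![[], [], [], [(1, 0, 1)], [(1, 0, 3)], [(1, 0, 4), (1, 1, 2), (1, 1, 3)]],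
  ![[], [], [], [(1, 0, 1)], [(1, 0, 3)], [(1, 0, 4), (1, 1, 3)]],
  ![[], [], [], [(1, 0, 1)], [(1, 0, 3)], [(1, 0, 4)]],
  ![[], [], [], [(1, 0, 1)], [(1, 0, 2)], [(1, 0, 3), (1, 2, 4)]],
  ![[], [], [], [(1, 0, 1)], [(1, 1, 2)], [(1, 0, 3), (1, 2, 4)]],
  ![[], [], [], [(1, 0, 1)], [(1, 1, 2)], [(1, 0, 3), (-1, 2, 4)]],
  ![[], [], [], [(1, 0, 1)], [(1, 0, 3)], [(1, 1, 3)]],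
  ![[], [], [], [(1, 0, 1)], [(1, 0, 2), (-1, 1, 3)], [(1, 0, 3), (1, 1, 2)]],
  ![[], [], [], [(1, 0, 1)], [(1, 0, 3)], [(1, 0, 2), (-1, 1, 3)]],
  ![[], [], [], [(1, 0, 1)], [(1, 0, 2), (1, 0, 3)], [(1, 1, 3)]],
  ![[], [], [], [(1, 0, 1)], [(1, 0, 2)], [(1, 0, 3), (1, 1, 2)]],
  ![[], [], [], [(1, 0, 1)], [(1, 0, 2)], [(1, 1, 3)]],
  ![[], [], [], [(1, 0, 1)], [(1, 0, 2)], [(1, 0, 3)]],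
  ![[], [], [], [(1, 0, 1)], [(1, 0, 2)], [(1, 1, 2)]],
  ![[], [], [], [], [(1, 0, 1)], [(1, 0, 4), (1, 2, 3)]],
  ![[], [], [], [], [(1, 0, 1)], [(1, 0, 4)]],
  ![[], [], [], [], [(1, 0, 1)], [(1, 0, 3), (1, 1, 4)]],
  ![[], [], [], [], [(1, 0, 2), (-1, 1, 3)], [(1, 0, 3), (1, 1, 2)]],
  ![[], [], [], [], [(1, 0, 1)], [(1, 0, 3), (1, 1, 2)]],
  ![[], [], [], [], [(1, 0, 1)], [(1, 2, 3)]],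
  ![[], [], [], [], [(1, 0, 1)], [(1, 0, 2)]],
  ![[], [], [], [], [], [(1, 0, 1), (1, 2, 3)]],
  ![[], [], [], [], [], [(1, 0, 1)]],
  ![[], [], [], [], [], []]]

/-- A two-form given by a sparse list of coefficients. -/
def tfm (l : List (ℤ × Fin 6 × Fin 6)) (x y : Fin 6 → ℝ) : ℝ :=
  (l.map fun p => (p.1 : ℝ) * w x y p.2.1 p.2.2).sum

set_option maxHeartbeats 4000000 in
theorem mdl_eq (i : Fin 34) (x y : Fin 6 → ℝ) (k : Fin 6) : mdl i x y k = tfm (tab i k) x y := by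
  fin_cases i <;> dsimp only [mdl, tab, Fin.reduceFinMk, Matrix.cons_val] <;> fin_cases k <;> simp [tfm, sub_eq_add_neg, add_assoc]

theorem tfm_add_left (l) (x y z : Fin 6 → ℝ) : tfm l (x + y) z = tfm l x z + tfm l y z := by
  induction l with
  | nil => simp [tfm]
  | cons p l ih =>
    simp only [tfm, List.map_cons, List.sum_cons, w, Pi.add_apply] at ih ⊢
    rw [ih]; ring

theorem tfm_smul_left (l) (c : ℝ) (x z : Fin 6 → ℝ) : tfm l (c • x) z = c * tfm l x z := by
  induction l with
  | nil => simp [tfm]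
  | cons p l ih =>
    simp only [tfm, List.map_cons, List.sum_cons, w, Pi.smul_apply, smul_eq_mul] at ih ⊢
    rw [ih]; ring

theorem tfm_skew (l) (x y : Fin 6 → ℝ) : tfm l x y = - tfm l y x := by
  induction l with
  | nil => simp [tfm]
  | cons p l ih =>
    simp only [tfm, List.map_cons, List.sum_cons, w] at ih ⊢
    rw [ih]; ring

set_option maxHeartbeats 4000000 in
theorem mdl_jacobi (i : Fin 34) (x y z : Fin 6 → ℝ) :
    mdl i x (mdl i y z) + mdl i y (mdl i z x) + mdl i z (mdl i x y) = 0 := by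
  funext k
  fin_cases i <;> dsimp only [mdl, Fin.reduceFinMk, Matrix.cons_val] <;> fin_cases k <;> simp [w] <;> ring

/-- The models as Lie algebra structures. -/
def N (i : Fin 34) : LieStruct 6 where
  bracket := mdl i
  add_left x y z := by funext k; simp only [mdl_eq, Pi.add_apply, tfm_add_left]
  add_right x y z := by
    funext k
    simp only [mdl_eq, Pi.add_apply]
    rw [tfm_skew, tfm_add_left, tfm_skew _ x y, tfm_skew _ x z]; ring
  smul_left c x y := by
    funext k; simp only [mdl_eq, Pi.smul_apply, smul_eq_mul, tfm_smul_left]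
  smul_right c x y := by
    funext k
    simp only [mdl_eq, Pi.smul_apply, smul_eq_mul]
    rw [tfm_skew, tfm_smul_left, tfm_skew _ x y]; ring
  alt x := by
    funext k
    have := tfm_skew (tab i k) x x
    simp only [mdl_eq, Pi.zero_apply]
    linarith
  jacobi := mdl_jacobi i

theorem N_apply (i : Fin 34) (x y : Fin 6 → ℝ) (k : Fin 6) :
    (N i).bracket x y k = tfm (tab i k) x y := mdl_eq i x y k

theorem tab_tri : ∀ i k, ∀ p ∈ tab i k, p.2.1 < k ∧ p.2.2 < k := by decide +kernel

theorem N_nilp (i : Fin 34) : (N i).IsNilpotent := by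
  have key : ∀ m : ℕ, ∀ y ∈ lcs (N i) m, ∀ k : Fin 6, (k : ℕ) < m → y k = 0 := by
    intro m
    induction m with
    | zero => intro y _ k hk; omega
    | succ m ih =>
      intro y hy
      rw [lcs] at hy
      induction hy using Submodule.span_induction with
      | mem z hz =>
        obtain ⟨x, y, hy, rfl⟩ := hz
        intro k hk
        rw [N_apply, tfm]
        apply List.sum_eq_zero
        intro r hr
        obtain ⟨p, hp, rfl⟩ := List.mem_map.1 hr
        obtain ⟨h1, h2⟩ := tab_tri i k p hp
        have h3 := ih y hy p.2.1 (by have : (p.2.1 : ℕ) < k := h1; omega)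
        have h4 := ih y hy p.2.2 (by have : (p.2.2 : ℕ) < k := h2; omega)
        simp [w, h3, h4]
      | zero => intro k hk; rfl
      | add x y _ _ hx hy => intro k hk; simp [hx k hk, hy k hk]
      | smul c x _ hx => intro k hk; simp [hx k hk]
  refine ⟨6, (Submodule.eq_bot_iff _).2 fun y hy => ?_⟩
  funext k
  exact key 6 y hy k k.2

theorem IsoF.iso {L : LieStruct 6} {i : Fin 34} (h : IsoF L (mdl i)) : L.Iso (N i) := h

set_option linter.unusedVariables false
set_option linter.unusedSimpArgs false

/-- Expressions for characteristic subspaces. -/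
inductive Ex where
  | top : Ex
  | bot : Ex
  | brk : Ex → Ex → Ex
  | tr : Ex → Ex → Ex

/-- The characteristic subspace of `L` described by an expression. -/
def Ex.eval (L : LieStruct 6) : Ex → Submodule ℝ (Fin 6 → ℝ)
  | top => ⊤
  | bot => ⊥
  | brk a b => Submodule.span ℝ {z | ∃ x ∈ a.eval L, ∃ y ∈ b.eval L, z = L.bracket x y}
  | tr a b =>
    { carrier := {x | ∀ y ∈ a.eval L, L.bracket x y ∈ b.eval L}
      add_mem' := fun hx hy z hz => by
        rw [L.add_left]; exact Submodule.add_mem _ (hx z hz) (hy z hz)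
      zero_mem' := fun z hz => by
        have : L.bracket 0 z = 0 := by simpa using L.smul_left 0 0 z
        rw [this]; exact Submodule.zero_mem _
      smul_mem' := fun c x hx z hz => by
        rw [L.smul_left]; exact Submodule.smul_mem _ _ (hx z hz) }

theorem Ex.eval_iso {L L' : LieStruct 6} (f : (Fin 6 → ℝ) ≃ₗ[ℝ] (Fin 6 → ℝ))
    (hf : ∀ x y, f (L.bracket x y) = L'.bracket (f x) (f y)) (a : Ex) :
    ∀ x, f x ∈ a.eval L' ↔ x ∈ a.eval L := by
  induction a with
  | top => intro x; simp [eval]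
  | bot => intro x; simp [eval]
  | brk a b iha ihb =>
    have key : (eval L (brk a b)).map (f : (Fin 6 → ℝ) →ₗ[ℝ] (Fin 6 → ℝ)) = eval L' (brk a b) := by
      rw [eval, eval, Submodule.map_span]
      congr 1
      ext z
      constructor
      · rintro ⟨_, ⟨x, hx, y, hy, rfl⟩, rfl⟩
        exact ⟨f x, (iha x).2 hx, f y, (ihb y).2 hy, hf x y⟩
      · rintro ⟨x, hx, y, hy, rfl⟩
        obtain ⟨x, rfl⟩ := f.surjective x
        obtain ⟨y, rfl⟩ := f.surjective y
        exact ⟨_, ⟨x, (iha x).1 hx, y, (ihb y).1 hy, rfl⟩, hf x y⟩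
    intro x
    rw [← key]
    constructor
    · rintro ⟨y, hy, h⟩
      rwa [← f.injective h]
    · intro h; exact ⟨x, h, rfl⟩
  | tr a b iha ihb =>
    intro x
    constructor
    · intro h y hy
      rw [← ihb, hf]
      exact h _ ((iha y).2 hy)
    · intro h y hy
      obtain ⟨y, rfl⟩ := f.surjective y
      rw [← hf, ihb]
      exact h _ ((iha y).1 hy)

/-- Structure constants: the `k`-th coordinate of `[e_a, e_b]`. -/
def sc (l : List (ℤ × Fin 6 × Fin 6)) (a b : Fin 6) : ℤ :=
  (l.map fun p => if p.2.1 = a ∧ p.2.2 = b then p.1 else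
    if p.2.1 = b ∧ p.2.2 = a then -p.1 else 0).sum

/-- Coordinate subspaces. -/
def cs (S : Fin 6 → Bool) : Submodule ℝ (Fin 6 → ℝ) where
  carrier := {x | ∀ k, S k = false → x k = 0}
  add_mem' hx hy k hk := by simp [hx k hk, hy k hk]
  zero_mem' k hk := rfl
  smul_mem' c x hx k hk := by simp [hx k hk]

theorem tfm_eq (l) (hl : ∀ p ∈ l, p.2.1 < p.2.2) (x y : Fin 6 → ℝ) :
    tfm l x y = ∑ a, ∑ b, (sc l a b : ℝ) * (x a * y b) := by
  induction l with
  | nil => simp [tfm, sc]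
  | cons p l ih =>
    have h0 := hl p (by simp)
    have := ih (fun q hq => hl q (by simp [hq]))
    simp only [tfm, sc, List.map_cons, List.sum_cons] at this ⊢
    rw [this]
    push_cast
    simp only [add_mul, Finset.sum_add_distrib]
    congr 1
    obtain ⟨c, u, v⟩ := p
    simp only [w] at h0 ⊢
    have hne : u ≠ v := ne_of_lt h0
    have : ∀ a b, (if u = a ∧ v = b then (c : ℝ) else if u = b ∧ v = a then -(c : ℝ) else 0) =
        (if u = a then (if v = b then (c : ℝ) else 0) else 0) -
        (if v = a then (if u = b then (c : ℝ) else 0) else 0) := by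
      clear h0 hl ih this
      intro a b
      by_cases h1 : u = a
      · subst h1
        by_cases h2 : v = b
        · subst h2; simp [hne, hne.symm]
        · simp [h2, hne.symm]
      · by_cases h2 : v = a
        · subst h2
          by_cases h3 : u = b
          · subst h3; simp [hne]
          · simp [h3, hne]
        · simp [h1, h2]
    simp only [this, sub_mul, Finset.sum_sub_distrib]
    simp only [ite_mul, zero_mul, Finset.sum_ite_eq, Finset.mem_univ, if_true, Finset.sum_const_zero, mul_sub]
    congr 1
    · rw [Finset.sum_eq_single u] <;> simp +contextual [eq_comm]
    · rw [Finset.sum_eq_single v] <;> simp +contextual [eq_comm, mul_comm]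

theorem tab_lt : ∀ i k, ∀ p ∈ tab i k, p.2.1 < p.2.2 := by decide +kernel

theorem N_sum (i : Fin 34) (x y : Fin 6 → ℝ) (k : Fin 6) :
    (N i).bracket x y k = ∑ a, ∑ b, (sc (tab i k) a b : ℝ) * (x a * y b) := by
  rw [N_apply, tfm_eq _ (tab_lt i k)]

theorem N_single (i : Fin 34) (a b k : Fin 6) :
    (N i).bracket (Pi.single a 1) (Pi.single b 1) k = sc (tab i k) a b := by
  rw [N_sum, Finset.sum_eq_single a, Finset.sum_eq_single b]
  · simp
  · intro c _ hc; simp [hc]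
  · simp
  · intro c _ hc; simp [hc]
  · simp

theorem N_single_right (i : Fin 34) (x : Fin 6 → ℝ) (b k : Fin 6) :
    (N i).bracket x (Pi.single b 1) k = ∑ a, (sc (tab i k) a b : ℝ) * x a := by
  rw [N_sum]
  refine Finset.sum_congr rfl fun a _ => ?_
  rw [Finset.sum_eq_single b]
  · simp
  · intro c _ hc; simp [hc]
  · simp

theorem single_mem_cs {S : Fin 6 → Bool} {a : Fin 6} (h : S a = true) :
    (Pi.single a 1 : Fin 6 → ℝ) ∈ cs S := by
  intro k hk
  rw [Pi.single_apply, if_neg]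
  rintro rfl; simp [h] at hk

/-- Check that the bracket of two coordinate subspaces is a coordinate subspace. -/
def okB (i : Fin 34) (S T U : Fin 6 → Bool) : Prop :=
  (∀ k, U k = false → ∀ u, S u = true → ∀ v, T v = true → sc (tab i k) u v = 0) ∧
  (∀ k, U k = true → ∃ u, S u = true ∧ ∃ v, T v = true ∧ sc (tab i k) u v ≠ 0 ∧
        ∀ l, l ≠ k → sc (tab i l) u v = 0)

/-- Check that a transporter of two coordinate subspaces is a coordinate subspace. -/
def okT (i : Fin 34) (S T U : Fin 6 → Bool) : Prop :=
  (∀ u, U u = true → ∀ v, S v = true → ∀ l, T l = false → sc (tab i l) u v = 0) ∧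
  (∀ k, U k = false → ∃ v, S v = true ∧ ∃ l, T l = false ∧ sc (tab i l) k v ≠ 0 ∧
        ∀ m, m ≠ k → sc (tab i l) m v = 0 ∨ (k < m ∧ U m = false))

instance (i : Fin 34) (S T U : Fin 6 → Bool) : Decidable (okB i S T U) := by
  unfold okB; infer_instance

instance (i : Fin 34) (S T U : Fin 6 → Bool) : Decidable (okT i S T U) := by
  unfold okT; infer_instance

theorem eval_brk {i : Fin 34} {a b : Ex} {S T U : Fin 6 → Bool} (h : okB i S T U)
    (ea : a.eval (N i) = cs S) (eb : b.eval (N i) = cs T) : (Ex.brk a b).eval (N i) = cs U := by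
  obtain ⟨hk, h3⟩ := h
  rw [Ex.eval, ea, eb]
  apply le_antisymm
  · rw [Submodule.span_le]
    rintro _ ⟨x, hx, y, hy, rfl⟩ k hU
    rw [N_sum]
    refine Finset.sum_eq_zero fun u _ => Finset.sum_eq_zero fun v _ => ?_
    cases hu : S u with
    | false => rw [hx u hu]; ring
    | true =>
      cases hv : T v with
      | false => rw [hy v hv]; ring
      | true => rw [hk k hU u hu v hv]; simp
  · intro x hx
    rw [← Finset.univ_sum_single x]
    refine Submodule.sum_mem _ fun k _ => ?_
    cases hU : U k with
    | false => rw [hx k hU]; simp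
    | true =>
      obtain ⟨u, hu, v, hv, hne, hl⟩ := h3 k hU
      have hne' : (sc (tab i k) u v : ℝ) ≠ 0 := by exact_mod_cast hne
      have : (Pi.single k (x k) : Fin 6 → ℝ) = (x k / (sc (tab i k) u v : ℝ)) •
          (N i).bracket (Pi.single u 1) (Pi.single v 1) := by
        funext l
        rw [Pi.smul_apply, N_single]
        by_cases hlk : l = k
        · subst hlk; simp [hne']
        · simp [hl l hlk, hlk]
      rw [this]
      exact Submodule.smul_mem _ _ (Submodule.subset_span
        ⟨_, single_mem_cs hu, _, single_mem_cs hv, rfl⟩)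

theorem eval_tr {i : Fin 34} {a b : Ex} {S T U : Fin 6 → Bool} (h : okT i S T U)
    (ea : a.eval (N i) = cs S) (eb : b.eval (N i) = cs T) : (Ex.tr a b).eval (N i) = cs U := by
  obtain ⟨h1, h3⟩ := h
  ext x
  change (∀ y ∈ a.eval (N i), (N i).bracket x y ∈ b.eval (N i)) ↔ _
  rw [ea, eb]
  constructor
  · intro h k
    induction k using WellFoundedGT.induction with
    | ind k ih =>
    intro hk
    obtain ⟨v, hv, l, hl, hne, hm⟩ := h3 k hk
    have := h _ (single_mem_cs hv) l hl
    rw [N_single_right, Finset.sum_eq_single k] at this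
    · rcases mul_eq_zero.1 this with h' | h'
      · exact absurd (by exact_mod_cast h') hne
      · exact h'
    · intro m _ hmk
      rcases hm m hmk with h | ⟨h, h'⟩
      · rw [h]; simp
      · rw [ih m h h']; simp
    · simp
  · intro hx y hy l hl
    rw [N_sum]
    refine Finset.sum_eq_zero fun u _ => Finset.sum_eq_zero fun v _ => ?_
    cases hv : S v with
    | false => rw [hy v hv]; ring
    | true =>
      cases hu : U u with
      | false => rw [hx u hu]; ring
      | true => rw [h1 u hu v hv l hl]; simp

theorem cs_finrank (S : Fin 6 → Bool) :
    Module.finrank ℝ (cs S) = (Finset.univ.filter fun k => S k = true).card := by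
  let f : cs S ≃ₗ[ℝ] ({k // S k = true} → ℝ) :=
    { toFun := fun x k => x.1 k.1
      invFun := fun y => ⟨fun k => if h : S k = true then y ⟨k, h⟩ else 0, fun k hk => by simp [hk]⟩
      map_add' := fun x y => rfl
      map_smul' := fun c x => rfl
      left_inv := fun x => by
        ext k
        by_cases h : S k = true
        · simp [h]
        · simp only [h]; exact (x.2 k (by simpa using h)).symm
      right_inv := fun y => by funext k; simp [k.2] }
  rw [f.finrank_eq, Module.finrank_fintype_fun_eq_card, Fintype.card_subtype]

theorem cs_iso {L L' : LieStruct 6} (h : L.Iso L') (a : Ex) {S T : Fin 6 → Bool}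
    (hi : a.eval L = cs S) (hj : a.eval L' = cs T) :
    (Finset.univ.filter fun k => S k = true).card =
    (Finset.univ.filter fun k => T k = true).card := by
  obtain ⟨f, hf⟩ := h
  rw [← cs_finrank, ← cs_finrank, ← hi, ← hj]
  have : (a.eval L).map (f : (Fin 6 → ℝ) →ₗ[ℝ] (Fin 6 → ℝ)) = a.eval L' := by
    ext x
    obtain ⟨x, rfl⟩ := f.surjective x
    rw [Ex.eval_iso f hf]
    constructor
    · rintro ⟨y, hy, h⟩
      rwa [← f.injective h]
    · intro h; exact ⟨x, h, rfl⟩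
  rw [← this]
  exact (LinearEquiv.finrank_map_eq f _).symm

/-- The characteristic subspaces used to separate the models. -/
def xs : Fin 13 → Ex :=
  let C1 : Ex := .brk .top .top
  let C2 : Ex := .brk .top C1
  let C3 : Ex := .brk .top C2
  let C4 : Ex := .brk .top C3
  let Z : Ex := .tr .top .bot
  let CC : Ex := .tr C1 .bot
  let Z2 : Ex := .tr .top Z
  ![.top, .bot, C1, C2, C3, C4, Z, .tr C1 C4, CC, .brk .top CC, Z2, .tr Z2 .bot, .tr CC C2]

/-- The coordinates spanning the subspaces `xs` in each model, as bit masks. -/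
def msk : Fin 34 → Fin 13 → ℕ := ![
  ![63, 0, 60, 56, 48, 32, 32, 60, 48, 32, 48, 61, 63],
  ![63, 0, 60, 56, 48, 32, 32, 62, 48, 32, 48, 61, 63],
  ![63, 0, 60, 56, 48, 32, 32, 62, 62, 60, 48, 62, 62],
  ![63, 0, 60, 56, 48, 32, 32, 60, 60, 56, 48, 62, 63],
  ![63, 0, 60, 56, 48, 32, 32, 62, 60, 56, 48, 62, 63],
  ![63, 0, 60, 56, 32, 0, 48, 60, 60, 56, 56, 62, 63],
  ![63, 0, 60, 56, 32, 0, 32, 60, 60, 56, 56, 60, 63],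
  ![63, 0, 60, 56, 32, 0, 32, 60, 60, 56, 56, 60, 63],
  ![63, 0, 56, 48, 32, 0, 32, 58, 58, 56, 48, 62, 62],
  ![63, 0, 56, 48, 32, 0, 32, 62, 62, 56, 52, 60, 62],
  ![63, 0, 56, 48, 32, 0, 32, 60, 60, 48, 52, 60, 63],
  ![63, 0, 56, 48, 32, 0, 36, 60, 60, 48, 52, 62, 63],
  ![63, 0, 56, 48, 32, 0, 36, 62, 62, 56, 52, 62, 62],
  ![63, 0, 56, 32, 0, 0, 32, 58, 58, 40, 56, 58, 62],
  ![63, 0, 56, 32, 0, 0, 32, 58, 58, 56, 56, 58, 58],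
  ![63, 0, 56, 32, 0, 0, 32, 58, 58, 56, 56, 58, 58],
  ![63, 0, 56, 48, 0, 0, 52, 60, 60, 48, 60, 60, 63],
  ![63, 0, 56, 48, 0, 0, 48, 60, 60, 48, 60, 60, 63],
  ![63, 0, 56, 48, 0, 0, 48, 60, 60, 48, 60, 60, 63],
  ![63, 0, 56, 48, 0, 0, 48, 60, 60, 48, 60, 60, 63],
  ![63, 0, 56, 32, 0, 0, 48, 62, 62, 56, 60, 60, 62],
  ![63, 0, 56, 32, 0, 0, 48, 61, 61, 56, 60, 60, 56],
  ![63, 0, 56, 32, 0, 0, 48, 62, 62, 56, 60, 62, 62],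
  ![63, 0, 56, 0, 0, 0, 56, 63, 63, 56, 63, 56, 56],
  ![63, 0, 48, 32, 0, 0, 32, 62, 62, 48, 60, 50, 62],
  ![63, 0, 48, 32, 0, 0, 44, 62, 62, 48, 60, 62, 62],
  ![63, 0, 48, 32, 0, 0, 36, 61, 61, 48, 60, 60, 61],
  ![63, 0, 48, 0, 0, 0, 48, 63, 63, 48, 63, 48, 48],
  ![63, 0, 48, 0, 0, 0, 48, 63, 63, 48, 63, 48, 48],
  ![63, 0, 48, 0, 0, 0, 48, 63, 63, 48, 63, 48, 48],
  ![63, 0, 48, 0, 0, 0, 56, 63, 63, 48, 63, 56, 56],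
  ![63, 0, 32, 0, 0, 0, 48, 63, 63, 32, 63, 48, 48],
  ![63, 0, 32, 0, 0, 0, 60, 63, 63, 32, 63, 60, 60],
  ![63, 0, 0, 0, 0, 0, 63, 63, 63, 0, 63, 63, 63]]

/-- The set of coordinates given by a bit mask. -/
def bits (i : Fin 34) (j : Fin 13) (k : Fin 6) : Bool := Nat.testBit (msk i j) k

theorem bits_ok : ∀ i,
    (∀ k, bits i 0 k = true) ∧ (∀ k, bits i 1 k = false) ∧
    okB i (bits i 0) (bits i 0) (bits i 2) ∧ okB i (bits i 0) (bits i 2) (bits i 3) ∧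
    okB i (bits i 0) (bits i 3) (bits i 4) ∧ okB i (bits i 0) (bits i 4) (bits i 5) ∧
    okT i (bits i 0) (bits i 1) (bits i 6) ∧ okT i (bits i 2) (bits i 5) (bits i 7) ∧
    okT i (bits i 2) (bits i 1) (bits i 8) ∧ okB i (bits i 0) (bits i 8) (bits i 9) ∧
    okT i (bits i 0) (bits i 6) (bits i 10) ∧ okT i (bits i 10) (bits i 1) (bits i 11) ∧
    okT i (bits i 8) (bits i 3) (bits i 12) := by
  decide +kernel

theorem xs_eval (i : Fin 34) (j : Fin 13) : (xs j).eval (N i) = cs (bits i j) := by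
  obtain ⟨h0, h1, h2, h3, h4, h5, h6, h7, h8, h9, h10, h11, h12⟩ := bits_ok i
  have e0 : (xs 0).eval (N i) = cs (bits i 0) := by
    ext x; simp [xs, Ex.eval, cs, h0]
  have e1 : (xs 1).eval (N i) = cs (bits i 1) := by
    ext x; simp only [xs, Matrix.cons_val, Ex.eval, cs, Submodule.mem_bot, h1]
    exact ⟨fun h => by subst h; intro k _; rfl, fun h => funext fun k => h k trivial⟩
  have e2 := eval_brk h2 e0 e0
  have e3 := eval_brk h3 e0 e2
  have e4 := eval_brk h4 e0 e3
  have e5 := eval_brk h5 e0 e4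
  have e6 := eval_tr h6 e0 e1
  have e7 := eval_tr h7 e2 e5
  have e8 := eval_tr h8 e2 e1
  have e9 := eval_brk h9 e0 e8
  have e10 := eval_tr h10 e0 e6
  have e11 := eval_tr h11 e10 e1
  have e12 := eval_tr h12 e8 e3
  fin_cases j
  exacts [e0, e1, e2, e3, e4, e5, e6, e7, e8, e9, e10, e11, e12]

/-- Dimension of the `j`-th characteristic subspace of the `i`-th model. -/
def dm (i : Fin 34) (j : Fin 13) : ℕ := (Finset.univ.filter fun k => bits i j k = true).card

theorem dm_iso {i i' : Fin 34} (h : (N i).Iso (N i')) (j : Fin 13) : dm i j = dm i' j :=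
  cs_iso h (xs j) (xs_eval i j) (xs_eval i' j)

/-- The models admitting a complex structure. -/
def cxF (i : Fin 34) : Bool := Nat.testBit 17129504896 i

theorem sep_dm : ∀ i j : Fin 34, dm i 6 = dm j 6 → dm i 7 = dm j 7 → dm i 9 = dm j 9 →
    dm i 11 = dm j 11 → dm i 12 = dm j 12 → cxF i = cxF j → i ≠ j →
    (17 ≤ i ∧ i ≤ 19 ∧ 17 ≤ j ∧ j ≤ 19) ∨ (27 ≤ i ∧ i ≤ 29 ∧ 27 ≤ j ∧ j ≤ 29) := by
  decide +kernel

set_option linter.unusedVariables false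
set_option linter.unusedSimpArgs false

/-- Elements centralizing the derived algebra whose adjoint map has rank at most one. -/
def RK (L : LieStruct 6) (y : Fin 6 → ℝ) : Prop :=
  (∀ u v, L.bracket y (L.bracket u v) = 0) ∧
    ∃ z, ∀ x, ∃ t : ℝ, L.bracket y x = t • z

theorem RK.iso {L L' : LieStruct 6} {f : (Fin 6 → ℝ) ≃ₗ[ℝ] (Fin 6 → ℝ)}
    (hf : ∀ x y, f (L.bracket x y) = L'.bracket (f x) (f y)) (y : Fin 6 → ℝ) :
    RK L' (f y) ↔ RK L y := by
  constructor
  · rintro ⟨h1, z, h2⟩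
    refine ⟨fun u v => f.injective ?_, f.symm z, fun x => ?_⟩
    · rw [hf, hf, h1, map_zero]
    · obtain ⟨t, ht⟩ := h2 (f x)
      exact ⟨t, f.injective (by rw [hf, ht]; simp)⟩
  · rintro ⟨h1, z, h2⟩
    refine ⟨fun u v => ?_, f z, fun x => ?_⟩
    · obtain ⟨u, rfl⟩ := f.surjective u
      obtain ⟨v, rfl⟩ := f.surjective v
      rw [← hf, ← hf, h1, map_zero]
    · obtain ⟨x, rfl⟩ := f.surjective x
      obtain ⟨t, ht⟩ := h2 x
      exact ⟨t, by rw [← hf, ht]; simp⟩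

/-- There is a noncentral element satisfying `RK`. -/
def Q1 (L : LieStruct 6) : Prop := ∃ y, RK L y ∧ ∃ x, L.bracket y x ≠ 0

/-- The elements satisfying `RK` are not closed under addition. -/
def Q2 (L : LieStruct 6) : Prop := ∃ y y', RK L y ∧ RK L y' ∧ ¬ RK L (y + y')

theorem Q1.iso {L L' : LieStruct 6} (h : L.Iso L') (hq : Q1 L) : Q1 L' := by
  obtain ⟨f, hf⟩ := h
  obtain ⟨y, hy, x, hx⟩ := hq
  refine ⟨f y, (RK.iso hf y).2 hy, f x, ?_⟩
  rw [← hf]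
  exact fun h => hx (f.injective (by rw [h, map_zero]))

theorem Q2.iso {L L' : LieStruct 6} (h : L.Iso L') (hq : Q2 L) : Q2 L' := by
  obtain ⟨f, hf⟩ := h
  obtain ⟨y, y', hy, hy', hn⟩ := hq
  refine ⟨f y, f y', (RK.iso hf y).2 hy, (RK.iso hf y').2 hy', ?_⟩
  rwa [← map_add, RK.iso hf]

theorem rk_minor {L : LieStruct 6} {y : Fin 6 → ℝ} (h : RK L y) (x x' : Fin 6 → ℝ) (k l : Fin 6) :
    L.bracket y x k * L.bracket y x' l = L.bracket y x l * L.bracket y x' k := by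
  obtain ⟨h1, z, h2⟩ := h
  obtain ⟨t, ht⟩ := h2 x
  obtain ⟨s, hs⟩ := h2 x'
  rw [ht, hs]
  simp only [Pi.smul_apply, smul_eq_mul]
  ring

/-- Basis vectors. -/
def bs (a : Fin 6) : Fin 6 → ℝ := fun k => if k = a then 1 else 0

theorem nQ1_17 : ¬ Q1 (N 17) := by
  rintro ⟨y, hy, x, hx⟩
  apply hx
  have h1 := congrFun (hy.1 (bs 0) (bs 1)) 4
  have h2 := congrFun (hy.1 (bs 0) (bs 1)) 5
  have h3 := rk_minor hy (bs 0) (bs 1) 4 5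
  simp [N, mdl, w, bs] at h1 h2 h3
  have h4 : y 2 = 0 := by nlinarith [sq_nonneg (y 2), sq_nonneg (y 3)]
  have h5 : y 3 = 0 := by nlinarith [sq_nonneg (y 2), sq_nonneg (y 3)]
  funext k
  fin_cases k <;> simp [N, mdl, w, h1, h2, h4, h5]

theorem nQ1_27 : ¬ Q1 (N 27) := by
  rintro ⟨y, hy, x, hx⟩
  apply hx
  have h3 := rk_minor hy (bs 0) (bs 1) 4 5
  have h3' := rk_minor hy (bs 2) (bs 3) 4 5
  simp [N, mdl, w, bs] at h3 h3'
  have h4 : y 2 = 0 := by nlinarith [sq_nonneg (y 2), sq_nonneg (y 3)]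
  have h5 : y 3 = 0 := by nlinarith [sq_nonneg (y 2), sq_nonneg (y 3)]
  have h1 : y 0 = 0 := by nlinarith [sq_nonneg (y 0), sq_nonneg (y 1)]
  have h2 : y 1 = 0 := by nlinarith [sq_nonneg (y 0), sq_nonneg (y 1)]
  funext k
  fin_cases k <;> simp [N, mdl, w, h1, h2, h4, h5]

theorem RK_18 (y : Fin 6 → ℝ) : RK (N 18) y ↔ y 0 = 0 ∧ y 1 = 0 ∧ y 3 = 0 := by
  constructor
  · intro hy
    have h1 := congrFun (hy.1 (bs 0) (bs 1)) 4
    have h2 := congrFun (hy.1 (bs 0) (bs 1)) 5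
    have h3 := rk_minor hy (bs 0) (bs 1) 4 5
    simp [N, mdl, w, bs] at h1 h2 h3
    exact ⟨h1, h2, h3⟩
  · rintro ⟨h1, h2, h3⟩
    refine ⟨fun u v => ?_, bs 5, fun x => ⟨- (x 0 * y 2), ?_⟩⟩
    · funext k
      fin_cases k <;> simp [N, mdl, w, h1, h2, h3]
    · funext k
      fin_cases k <;> simp [N, mdl, w, h1, h2, h3, bs, mul_comm]

theorem RK_28 (y : Fin 6 → ℝ) : RK (N 28) y ↔ y 0 = 0 ∧ y 1 = 0 := by
  constructor
  · intro hy
    have h1 := rk_minor hy (bs 0) (bs 2) 4 5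
    have h2 := rk_minor hy (bs 1) (bs 3) 4 5
    simp [N, mdl, w, bs] at h1 h2
    exact ⟨h2, h1⟩
  · rintro ⟨h1, h2⟩
    refine ⟨fun u v => ?_, bs 5, fun x => ⟨- (x 0 * y 3) - x 1 * y 2, ?_⟩⟩
    · funext k
      fin_cases k <;> simp [N, mdl, w, h1, h2]
    · funext k
      fin_cases k <;> simp [N, mdl, w, h1, h2, bs] <;> ring

theorem Q1_18 : Q1 (N 18) :=
  ⟨bs 2, (RK_18 _).2 (by simp [bs]), bs 0, fun h => by
    have := congrFun h 5
    simp [N, mdl, w, bs] at this⟩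

theorem Q1_28 : Q1 (N 28) :=
  ⟨bs 2, (RK_28 _).2 (by simp [bs]), bs 1, fun h => by
    have := congrFun h 5
    simp [N, mdl, w, bs] at this⟩

theorem nQ2_18 : ¬ Q2 (N 18) := by
  rintro ⟨y, y', h, h', hn⟩
  rw [RK_18] at h h' hn
  simp_all

theorem nQ2_28 : ¬ Q2 (N 28) := by
  rintro ⟨y, y', h, h', hn⟩
  rw [RK_28] at h h' hn
  simp_all

theorem RK_19 : RK (N 19) (bs 2) := by
  refine ⟨fun u v => ?_, bs 4, fun x => ⟨- x 0, ?_⟩⟩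
  · funext k
    fin_cases k <;> simp [N, mdl, w, bs]
  · funext k
    fin_cases k <;> simp [N, mdl, w, bs]

theorem Q1_19 : Q1 (N 19) :=
  ⟨bs 2, RK_19, bs 0, fun h => by
    have := congrFun h 4
    simp [N, mdl, w, bs] at this⟩

theorem Q2_19 : Q2 (N 19) := by
  refine ⟨bs 2, bs 3 - bs 2, RK_19, ?_, ?_⟩
  · refine ⟨fun u v => ?_, bs 5, fun x => ⟨- x 1, ?_⟩⟩
    · funext k
      fin_cases k <;> simp [N, mdl, w, bs]
    · funext k
      fin_cases k <;> simp [N, mdl, w, bs]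
  · intro h
    have h3 := rk_minor h (bs 0) (bs 1) 4 5
    simp [N, mdl, w, bs] at h3

theorem RK_29 : RK (N 29) (bs 0) := by
  refine ⟨fun u v => ?_, bs 4, fun x => ⟨x 1, ?_⟩⟩
  · funext k
    fin_cases k <;> simp [N, mdl, w, bs]
  · funext k
    fin_cases k <;> simp [N, mdl, w, bs]

theorem Q1_29 : Q1 (N 29) :=
  ⟨bs 0, RK_29, bs 1, fun h => by
    have := congrFun h 4
    simp [N, mdl, w, bs] at this⟩

theorem Q2_29 : Q2 (N 29) := by
  refine ⟨bs 0, bs 2, RK_29, ?_, ?_⟩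
  · refine ⟨fun u v => ?_, bs 5, fun x => ⟨x 3, ?_⟩⟩
    · funext k
      fin_cases k <;> simp [N, mdl, w, bs]
    · funext k
      fin_cases k <;> simp [N, mdl, w, bs]
  · intro h
    have h3 := rk_minor h (bs 1) (bs 3) 4 5
    simp [N, mdl, w, bs] at h3

theorem LieStruct.Iso.symm {L L' : LieStruct 6} (h : L.Iso L') : L'.Iso L := by
  obtain ⟨f, hf⟩ := h
  exact ⟨f.symm, fun x y => f.injective (by rw [hf]; simp)⟩

theorem LieStruct.Iso.trans {L L' L'' : LieStruct 6} (h : L.Iso L') (h' : L'.Iso L'') :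
    L.Iso L'' := by
  obtain ⟨f, hf⟩ := h
  obtain ⟨g, hg⟩ := h'
  exact ⟨f.trans g, fun x y => by simp [hf, hg]⟩

theorem N_inj {i j : Fin 34} (h : (N i).Iso (N j)) (hc : cxF i = cxF j) : i = j := by
  by_contra hne
  have hs := sep_dm i j (dm_iso h 6) (dm_iso h 7) (dm_iso h 9) (dm_iso h 11) (dm_iso h 12) hc hne
  have q1 : Q1 (N i) ↔ Q1 (N j) := ⟨Q1.iso h, Q1.iso h.symm⟩
  have q2 : Q2 (N i) ↔ Q2 (N j) := ⟨Q2.iso h, Q2.iso h.symm⟩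
  have hi : i = 17 ∨ i = 18 ∨ i = 19 ∨ i = 27 ∨ i = 28 ∨ i = 29 := by omega
  have hj : j = 17 ∨ j = 18 ∨ j = 19 ∨ j = 27 ∨ j = 28 ∨ j = 29 := by omega
  rcases hi with rfl | rfl | rfl | rfl | rfl | rfl <;>
    rcases hj with rfl | rfl | rfl | rfl | rfl | rfl <;>
    simp_all [Q1_18, Q1_19, Q1_28, Q1_29, nQ1_17, nQ1_27, Q2_19, Q2_29, nQ2_18, nQ2_28]

set_option linter.unusedVariables false
set_option linter.unusedSimpArgs false

/-- Constructor for complex structures on the models. -/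
theorem cxm (i : Fin 34) (J : Fin 6 → ((Fin 6 → ℝ) →ₗ[ℝ] ℝ))
    (h1 : ∀ x k, J k (fun l => J l x) = - x k := by
      intro x k
      fin_cases k <;> simp <;> ring)
    (h2 : ∀ x y k, mdl i (fun l => J l x) (fun l => J l y) k - mdl i x y k
      - J k (mdl i (fun l => J l x) y) - J k (mdl i x (fun l => J l y)) = 0 := by
      intro x y k
      dsimp only [mdl, Matrix.cons_val]
      fin_cases k <;> simp [w] <;> ring) :
    (N i).AdmitsComplex :=
  ⟨LinearMap.pi J, fun x => funext fun k => h1 x k, fun x y => funext fun k => h2 x y k⟩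

set_option maxHeartbeats 4000000 in
theorem cx_yes (i : Fin 34) (h : cxF i = true) : (N i).AdmitsComplex := by
  have hi : ∀ i : Fin 34, cxF i = true → i = 7 ∨ i = 15 ∨ i = 16 ∨ i = 17 ∨ i = 18 ∨ i = 19 ∨ i = 20 ∨ i = 21 ∨ i = 22 ∨ i = 23 ∨ i = 26 ∨ i = 27 ∨ i = 28 ∨ i = 29 ∨ i = 30 ∨ i = 31 ∨ i = 32 ∨ i = 33 := by
    decide +kernel
  rcases hi i h with rfl | rfl | rfl | rfl | rfl | rfl | rfl | rfl | rfl | rfl | rfl | rfl | rfl | rfl | rfl | rfl | rfl | rfl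
  · exact cxm 7 ![-e 1, e 0, -e 5, -e 4, e 3, e 2]
  · exact cxm 15 ![-e 2, -e 5, e 0, e 4, -e 3, e 1]
  · exact cxm 16 ![-e 1, e 0, -e 3, e 2, -e 5, e 4]
  · exact cxm 17 ![-e 1, e 0, -e 3, e 2, -e 5, e 4]
  · exact cxm 18 ![-e 1, e 0, -e 3, e 2, (1/2 : ℝ) • e 5, (-2 : ℝ) • e 4]
  · exact cxm 19 ![-e 1, e 0, -e 3, e 2, -e 4 + (-2 : ℝ) • e 5, e 4 + e 5]
  · exact cxm 20 ![-e 1, e 0, -e 3, e 2, (-1/2 : ℝ) • e 5, (2 : ℝ) • e 4]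
  · exact cxm 21 ![-e 1, e 0, e 2 + (-2 : ℝ) • e 3, e 2 - e 3, -e 4 + (-2 : ℝ) • e 5, e 4 + e 5]
  · exact cxm 22 ![-e 1, e 0, -e 3, e 2, -e 5, e 4]
  · exact cxm 23 ![-e 1, e 0, -e 3, e 2, -e 5, e 4]
  · exact cxm 26 ![-e 1, e 0, -e 5, -e 4, e 3, e 2]
  · exact cxm 27 ![-e 1, e 0, -e 3, e 2, -e 5, e 4]
  · exact cxm 28 ![-e 1, e 0, e 3, -e 2, -e 5, e 4]
  · exact cxm 29 ![-e 1, e 0, -e 3, e 2, -e 5, e 4]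
  · exact cxm 30 ![-e 3, -e 2, e 1, e 0, -e 5, e 4]
  · exact cxm 31 ![-e 1, e 0, -e 3, e 2, -e 5, e 4]
  · exact cxm 32 ![-e 1, e 0, -e 3, e 2, -e 5, e 4]
  · exact cxm 33 ![-e 1, e 0, -e 3, e 2, -e 5, e 4]

set_option linter.unusedVariables false
set_option linter.unusedSimpArgs false

/-- Constructor for symplectic structures on the models; `Y` is the inverse matrix of the form. -/
theorem sym (i : Fin 34) (l : List (ℤ × Fin 6 × Fin 6)) (Y : Fin 6 → Fin 6 → ℝ)
    (h1 : ∀ x k, tfm l x (Y k) = x k := by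
      intro x k
      fin_cases k <;> simp [tfm, w] <;> ring)
    (h2 : ∀ x y z, tfm l (mdl i x y) z + tfm l (mdl i y z) x + tfm l (mdl i z x) y = 0 := by
      intro x y z
      dsimp only [mdl, Matrix.cons_val]
      simp [tfm, w] <;> ring) :
    (N i).AdmitsSymplectic := by
  refine ⟨LinearMap.mk₂ ℝ (tfm l) (tfm_add_left l) (tfm_smul_left l) (fun x y z => ?_)
    (fun c x y => ?_), fun x => ?_, fun x hx => ?_, fun x y z => h2 x y z⟩
  · rw [tfm_skew, tfm_add_left, tfm_skew _ x y, tfm_skew _ x z]; ring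
  · rw [tfm_skew, tfm_smul_left, tfm_skew _ x y, smul_eq_mul]; ring
  · have := tfm_skew l x x
    rw [LinearMap.mk₂_apply]; linarith
  · funext k
    rw [← h1 x k]
    exact hx (Y k)

/-- The models admitting a symplectic structure. -/
def syF (i : Fin 34) : Bool := Nat.testBit 15015485436 i

set_option maxHeartbeats 4000000 in
theorem sy_yes (i : Fin 34) (h : syF i = true) : (N i).AdmitsSymplectic := by
  have hi : ∀ i : Fin 34, syF i = true → i = 2 ∨ i = 3 ∨ i = 4 ∨ i = 5 ∨ i = 6 ∨ i = 7 ∨ i = 8 ∨ i = 9 ∨ i = 10 ∨ i = 11 ∨ i = 12 ∨ i = 17 ∨ i = 18 ∨ i = 19 ∨ i = 20 ∨ i = 21 ∨ i = 22 ∨ i = 23 ∨ i = 25 ∨ i = 26 ∨ i = 27 ∨ i = 28 ∨ i = 29 ∨ i = 30 ∨ i = 32 ∨ i = 33 := by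
    decide +kernel
  rcases hi i h with rfl | rfl | rfl | rfl | rfl | rfl | rfl | rfl | rfl | rfl | rfl | rfl | rfl | rfl | rfl | rfl | rfl | rfl | rfl | rfl | rfl | rfl | rfl | rfl | rfl | rfl
  · exact sym 2 [(1, 0, 5), (1, 1, 4), (-1, 2, 3)] ![![0, 0, 0, 0, 0, 1], ![0, 0, 0, 0, 1, 0], ![0, 0, 0, -1, 0, 0], ![0, 0, 1, 0, 0, 0], ![0, -1, 0, 0, 0, 0], ![-1, 0, 0, 0, 0, 0]]
  · exact sym 3 [(1, 0, 5), (-1, 1, 4), (2, 2, 3)] ![![0, 0, 0, 0, 0, 1], ![0, 0, 0, 0, -1, 0], ![0, 0, 0, 1/2, 0, 0], ![0, 0, -1/2, 0, 0, 0], ![0, 1, 0, 0, 0, 0], ![-1, 0, 0, 0, 0, 0]]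
  · exact sym 4 [(1, 0, 5), (1, 1, 3), (1, 1, 4), (-1, 2, 3)] ![![0, 0, 0, 0, 0, 1], ![0, 0, 0, 0, 1, 0], ![0, 0, 0, -1, 1, 0], ![0, 0, 1, 0, 0, 0], ![0, -1, -1, 0, 0, 0], ![-1, 0, 0, 0, 0, 0]]
  · exact sym 5 [(1, 0, 4), (1, 1, 3), (1, 1, 5), (-1, 2, 3)] ![![0, 0, 0, 0, 1, 0], ![0, 0, 0, 0, 0, 1], ![0, 0, 0, -1, 0, 1], ![0, 0, 1, 0, 0, 0], ![-1, 0, 0, 0, 0, 0], ![0, -1, -1, 0, 0, 0]]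
  · exact sym 6 [(1, 0, 4), (1, 0, 5), (1, 1, 3), (-1, 2, 4)] ![![0, 0, 0, 0, 0, 1], ![0, 0, 0, 1, 0, 0], ![0, 0, 0, 0, -1, 1], ![0, -1, 0, 0, 0, 0], ![0, 0, 1, 0, 0, 0], ![-1, 0, -1, 0, 0, 0]]
  · exact sym 7 [(1, 0, 4), (1, 0, 5), (1, 1, 3), (1, 2, 4)] ![![0, 0, 0, 0, 0, 1], ![0, 0, 0, 1, 0, 0], ![0, 0, 0, 0, 1, -1], ![0, -1, 0, 0, 0, 0], ![0, 0, -1, 0, 0, 0], ![-1, 0, 1, 0, 0, 0]]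
  · exact sym 8 [(1, 0, 5), (1, 1, 3), (1, 2, 4)] ![![0, 0, 0, 0, 0, 1], ![0, 0, 0, 1, 0, 0], ![0, 0, 0, 0, 1, 0], ![0, -1, 0, 0, 0, 0], ![0, 0, -1, 0, 0, 0], ![-1, 0, 0, 0, 0, 0]]
  · exact sym 9 [(1, 0, 2), (1, 1, 5), (-1, 3, 4)] ![![0, 0, 1, 0, 0, 0], ![0, 0, 0, 0, 0, 1], ![-1, 0, 0, 0, 0, 0], ![0, 0, 0, 0, -1, 0], ![0, 0, 0, 1, 0, 0], ![0, -1, 0, 0, 0, 0]]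
  · exact sym 10 [(1, 0, 2), (1, 1, 5), (-1, 3, 4)] ![![0, 0, 1, 0, 0, 0], ![0, 0, 0, 0, 0, 1], ![-1, 0, 0, 0, 0, 0], ![0, 0, 0, 0, -1, 0], ![0, 0, 0, 1, 0, 0], ![0, -1, 0, 0, 0, 0]]
  · exact sym 11 [(1, 0, 2), (1, 1, 5), (-1, 3, 4)] ![![0, 0, 1, 0, 0, 0], ![0, 0, 0, 0, 0, 1], ![-1, 0, 0, 0, 0, 0], ![0, 0, 0, 0, -1, 0], ![0, 0, 0, 1, 0, 0], ![0, -1, 0, 0, 0, 0]]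
  · exact sym 12 [(1, 0, 2), (1, 1, 5), (-1, 3, 4)] ![![0, 0, 1, 0, 0, 0], ![0, 0, 0, 0, 0, 1], ![-1, 0, 0, 0, 0, 0], ![0, 0, 0, 0, -1, 0], ![0, 0, 0, 1, 0, 0], ![0, -1, 0, 0, 0, 0]]
  · exact sym 17 [(1, 0, 4), (1, 0, 5), (-1, 1, 5), (-1, 2, 3)] ![![0, 0, 0, 0, 1, 0], ![0, 0, 0, 0, 1, -1], ![0, 0, 0, -1, 0, 0], ![0, 0, 1, 0, 0, 0], ![-1, -1, 0, 0, 0, 0], ![0, 1, 0, 0, 0, 0]]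
  · exact sym 18 [(1, 0, 4), (1, 1, 5), (1, 2, 3)] ![![0, 0, 0, 0, 1, 0], ![0, 0, 0, 0, 0, 1], ![0, 0, 0, 1, 0, 0], ![0, 0, -1, 0, 0, 0], ![-1, 0, 0, 0, 0, 0], ![0, -1, 0, 0, 0, 0]]
  · exact sym 19 [(1, 0, 5), (1, 1, 4), (1, 2, 3)] ![![0, 0, 0, 0, 0, 1], ![0, 0, 0, 0, 1, 0], ![0, 0, 0, 1, 0, 0], ![0, 0, -1, 0, 0, 0], ![0, -1, 0, 0, 0, 0], ![-1, 0, 0, 0, 0, 0]]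
  · exact sym 20 [(1, 0, 5), (1, 1, 3), (1, 1, 4), (1, 2, 4)] ![![0, 0, 0, 0, 0, 1], ![0, 0, 0, 1, 0, 0], ![0, 0, 0, -1, 1, 0], ![0, -1, 1, 0, 0, 0], ![0, 0, -1, 0, 0, 0], ![-1, 0, 0, 0, 0, 0]]
  · exact sym 21 [(1, 0, 3), (1, 1, 5), (1, 2, 4)] ![![0, 0, 0, 1, 0, 0], ![0, 0, 0, 0, 0, 1], ![0, 0, 0, 0, 1, 0], ![-1, 0, 0, 0, 0, 0], ![0, 0, -1, 0, 0, 0], ![0, -1, 0, 0, 0, 0]]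
  · exact sym 22 [(1, 0, 5), (1, 1, 3), (1, 2, 4)] ![![0, 0, 0, 0, 0, 1], ![0, 0, 0, 1, 0, 0], ![0, 0, 0, 0, 1, 0], ![0, -1, 0, 0, 0, 0], ![0, 0, -1, 0, 0, 0], ![-1, 0, 0, 0, 0, 0]]
  · exact sym 23 [(1, 0, 3), (1, 1, 5), (1, 2, 4)] ![![0, 0, 0, 1, 0, 0], ![0, 0, 0, 0, 0, 1], ![0, 0, 0, 0, 1, 0], ![-1, 0, 0, 0, 0, 0], ![0, 0, -1, 0, 0, 0], ![0, -1, 0, 0, 0, 0]]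
  · exact sym 25 [(1, 0, 5), (1, 1, 4), (1, 2, 3)] ![![0, 0, 0, 0, 0, 1], ![0, 0, 0, 0, 1, 0], ![0, 0, 0, 1, 0, 0], ![0, 0, -1, 0, 0, 0], ![0, -1, 0, 0, 0, 0], ![-1, 0, 0, 0, 0, 0]]
  · exact sym 26 [(1, 0, 2), (1, 1, 5), (1, 3, 4)] ![![0, 0, 1, 0, 0, 0], ![0, 0, 0, 0, 0, 1], ![-1, 0, 0, 0, 0, 0], ![0, 0, 0, 0, 1, 0], ![0, 0, 0, -1, 0, 0], ![0, -1, 0, 0, 0, 0]]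
  · exact sym 27 [(1, 0, 1), (1, 2, 4), (-1, 3, 5)] ![![0, 1, 0, 0, 0, 0], ![-1, 0, 0, 0, 0, 0], ![0, 0, 0, 0, 1, 0], ![0, 0, 0, 0, 0, -1], ![0, 0, -1, 0, 0, 0], ![0, 0, 0, 1, 0, 0]]
  · exact sym 28 [(1, 0, 2), (1, 1, 5), (1, 3, 4)] ![![0, 0, 1, 0, 0, 0], ![0, 0, 0, 0, 0, 1], ![-1, 0, 0, 0, 0, 0], ![0, 0, 0, 0, 1, 0], ![0, 0, 0, -1, 0, 0], ![0, -1, 0, 0, 0, 0]]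
  · exact sym 29 [(1, 0, 2), (1, 1, 4), (1, 3, 5)] ![![0, 0, 1, 0, 0, 0], ![0, 0, 0, 0, 1, 0], ![-1, 0, 0, 0, 0, 0], ![0, 0, 0, 0, 0, 1], ![0, -1, 0, 0, 0, 0], ![0, 0, 0, -1, 0, 0]]
  · exact sym 30 [(1, 0, 3), (1, 1, 4), (1, 2, 5)] ![![0, 0, 0, 1, 0, 0], ![0, 0, 0, 0, 1, 0], ![0, 0, 0, 0, 0, 1], ![-1, 0, 0, 0, 0, 0], ![0, -1, 0, 0, 0, 0], ![0, 0, -1, 0, 0, 0]]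
  · exact sym 32 [(1, 0, 2), (1, 1, 5), (1, 3, 4)] ![![0, 0, 1, 0, 0, 0], ![0, 0, 0, 0, 0, 1], ![-1, 0, 0, 0, 0, 0], ![0, 0, 0, 0, 1, 0], ![0, 0, 0, -1, 0, 0], ![0, -1, 0, 0, 0, 0]]
  · exact sym 33 [(1, 0, 1), (1, 2, 3), (1, 4, 5)] ![![0, 1, 0, 0, 0, 0], ![-1, 0, 0, 0, 0, 0], ![0, 0, 0, 1, 0, 0], ![0, 0, -1, 0, 0, 0], ![0, 0, 0, 0, 0, 1], ![0, 0, 0, 0, -1, 0]]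

set_option linter.unusedVariables false
set_option linter.unusedSimpArgs false

theorem bs_sum (x : Fin 6 → ℝ) : x = ∑ k, x k • bs k := by
  funext l
  simp [bs, Finset.sum_apply]

theorem bs_bracket (i : Fin 34) (a b : Fin 6) :
    (N i).bracket (bs a) (bs b) = ∑ k, (sc (tab i k) a b : ℝ) • bs k := by
  have h : ∀ a, bs a = Pi.single a 1 := by
    intro a; funext k; simp [bs, Pi.single_apply]
  rw [bs_sum ((N i).bracket (bs a) (bs b))]
  refine Finset.sum_congr rfl fun k _ => ?_
  rw [h a, h b, N_single]

/-- Closedness of a two-form on basis vectors. -/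
theorem sycl {i : Fin 34} {ω : (Fin 6 → ℝ) →ₗ[ℝ] (Fin 6 → ℝ) →ₗ[ℝ] ℝ}
    (hc : ∀ x y z, ω ((N i).bracket x y) z + ω ((N i).bracket y z) x + ω ((N i).bracket z x) y = 0)
    (a b c : Fin 6) :
    ∑ k, (sc (tab i k) a b : ℝ) * ω (bs k) (bs c) + ∑ k, (sc (tab i k) b c : ℝ) * ω (bs k) (bs a) +
      ∑ k, (sc (tab i k) c a : ℝ) * ω (bs k) (bs b) = 0 := by
  have := hc (bs a) (bs b) (bs c)
  rw [bs_bracket, bs_bracket, bs_bracket] at this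
  simpa using this

theorem sy_rad {ω : (Fin 6 → ℝ) →ₗ[ℝ] (Fin 6 → ℝ) →ₗ[ℝ] ℝ}
    (ha : ∀ x, ω x x = 0) (hn : ∀ x, (∀ y, ω x y = 0) → x = 0) (h0 : ω (bs 0) (bs 5) = 0)
    (h1 : ω (bs 1) (bs 5) = 0) (h2 : ω (bs 2) (bs 5) = 0) (h3 : ω (bs 3) (bs 5) = 0)
    (h4 : ω (bs 4) (bs 5) = 0) : False := by
  have hs : ∀ x y, ω x y = - ω y x := by
    intro x y
    have := ha (x + y)
    simp [ha] at this
    linarith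
  have := hn (bs 5) (fun y => by
    rw [hs, bs_sum y]
    simp [Fin.sum_univ_six, h0, h1, h2, h3, h4, ha])
  have := congrFun this 5
  simp [bs] at this

/-- A convenient way of producing alternation equations. -/
theorem sy_alt {ω : (Fin 6 → ℝ) →ₗ[ℝ] (Fin 6 → ℝ) →ₗ[ℝ] ℝ}
    (ha : ∀ x, ω x x = 0) (x y) : ω x y = - ω y x := by
  have := ha (x + y)
  simp [ha] at this
  linarith

theorem nsy1 : ¬ (N 0).AdmitsSymplectic := by
  rintro ⟨ω, ha, hn, hc⟩
  have h126 := sycl hc 0 1 5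
  have h125 := sycl hc 0 1 4
  have h134 := sycl hc 0 2 3
  have h234 := sycl hc 1 2 3
  have h135 := sycl hc 0 2 4
  have h136 := sycl hc 0 2 5
  have h146 := sycl hc 0 3 5
  simp [Fin.sum_univ_six, sc, tab, ha, sy_alt ha (bs 5) _, sy_alt ha (bs 4) (bs 2), sy_alt ha (bs 4) (bs 3)] at h126 h125 h134 h234 h135 h136 h146
  apply sy_rad ha hn <;> linarith

theorem nsy2 : ¬ (N 1).AdmitsSymplectic := by
  rintro ⟨ω, ha, hn, hc⟩
  have h126 := sycl hc 0 1 5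
  have h125 := sycl hc 0 1 4
  have h134 := sycl hc 0 2 3
  have h234 := sycl hc 1 2 3
  have h136 := sycl hc 0 2 5
  have h146 := sycl hc 0 3 5
  simp [Fin.sum_univ_six, sc, tab, ha, sy_alt ha (bs 5) _, sy_alt ha (bs 4) (bs 2), sy_alt ha (bs 4) (bs 3)] at h126 h125 h134 h234 h136 h146
  apply sy_rad ha hn <;> linarith

theorem nsy14 : ¬ (N 13).AdmitsSymplectic := by
  rintro ⟨ω, ha, hn, hc⟩
  have h135 := sycl hc 0 2 4
  have h124 := sycl hc 0 1 3
  have h134 := sycl hc 0 2 3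
  have h125 := sycl hc 0 1 4
  have h126 := sycl hc 0 1 5
  have h136 := sycl hc 0 2 5
  simp [Fin.sum_univ_six, sc, tab, ha, sy_alt ha (bs 5) _, sy_alt ha (bs 4) (bs 2), sy_alt ha (bs 4) (bs 3)] at h135 h124 h134 h125 h126 h136
  apply sy_rad ha hn <;> linarith

theorem nsy15 : ¬ (N 14).AdmitsSymplectic := by
  rintro ⟨ω, ha, hn, hc⟩
  have h135 := sycl hc 0 2 4
  have h124 := sycl hc 0 1 3
  have h134 := sycl hc 0 2 3
  have h126 := sycl hc 0 1 5
  have h145 := sycl hc 0 3 4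
  simp [Fin.sum_univ_six, sc, tab, ha, sy_alt ha (bs 5) _, sy_alt ha (bs 4) (bs 2), sy_alt ha (bs 4) (bs 3)] at h135 h124 h134 h126 h145
  apply sy_rad ha hn <;> linarith

theorem nsy16 : ¬ (N 15).AdmitsSymplectic := by
  rintro ⟨ω, ha, hn, hc⟩
  have h135 := sycl hc 0 2 4
  have h124 := sycl hc 0 1 3
  have h134 := sycl hc 0 2 3
  have h126 := sycl hc 0 1 5
  have h145 := sycl hc 0 3 4
  simp [Fin.sum_univ_six, sc, tab, ha, sy_alt ha (bs 5) _, sy_alt ha (bs 4) (bs 2), sy_alt ha (bs 4) (bs 3)] at h135 h124 h134 h126 h145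
  apply sy_rad ha hn <;> linarith

theorem nsy25 : ¬ (N 24).AdmitsSymplectic := by
  rintro ⟨ω, ha, hn, hc⟩
  have h134 := sycl hc 0 2 3
  have h125 := sycl hc 0 1 4
  have h135 := sycl hc 0 2 4
  have h145 := sycl hc 0 3 4
  have h126 := sycl hc 0 1 5
  simp [Fin.sum_univ_six, sc, tab, ha, sy_alt ha (bs 5) _, sy_alt ha (bs 4) (bs 2), sy_alt ha (bs 4) (bs 3)] at h134 h125 h135 h145 h126
  apply sy_rad ha hn <;> linarith

theorem nsy32 : ¬ (N 31).AdmitsSymplectic := by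
  rintro ⟨ω, ha, hn, hc⟩
  have h134 := sycl hc 0 2 3
  have h234 := sycl hc 1 2 3
  have h123 := sycl hc 0 1 2
  have h124 := sycl hc 0 1 3
  have h125 := sycl hc 0 1 4
  simp [Fin.sum_univ_six, sc, tab, ha, sy_alt ha (bs 5) _, sy_alt ha (bs 4) (bs 2), sy_alt ha (bs 4) (bs 3)] at h134 h234 h123 h124 h125
  apply sy_rad ha hn <;> linarith

theorem exists_ker (u v : Fin 3 → ℝ) : ∃ x : Fin 3 → ℝ, x ≠ 0 ∧
    x 0 * u 0 + x 1 * u 1 + x 2 * u 2 = 0 ∧ x 0 * v 0 + x 1 * v 1 + x 2 * v 2 = 0 := by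
  let f : (Fin 3 → ℝ) →ₗ[ℝ] (Fin 2 → ℝ) := Matrix.mulVecLin (Matrix.of ![u, v])
  have hk : f.ker ≠ ⊥ := LinearMap.ker_ne_bot_of_finrank_lt (by simp)
  obtain ⟨x, hx, hx0⟩ := Submodule.exists_mem_ne_zero_of_ne_bot hk
  refine ⟨x, hx0, ?_, ?_⟩
  · have := congrFun (LinearMap.mem_ker.1 hx) 0
    simp [f, Matrix.mulVecLin_apply, Matrix.mulVec, dotProduct, Fin.sum_univ_three] at this
    linarith
  · have := congrFun (LinearMap.mem_ker.1 hx) 1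
    simp [f, Matrix.mulVecLin_apply, Matrix.mulVec, dotProduct, Fin.sum_univ_three] at this
    linarith

theorem nsy17 : ¬ (N 16).AdmitsSymplectic := by
  rintro ⟨ω, ha, hn, hc⟩
  have h123 := sycl hc 0 1 2
  have h125 := sycl hc 0 1 4
  have h126 := sycl hc 0 1 5
  have h146 := sycl hc 0 3 5
  have h134 := sycl hc 0 2 3
  have h234 := sycl hc 1 2 3
  simp [Fin.sum_univ_six, sc, tab, ha] at h123 h125 h126 h146 h134 h234
  obtain ⟨x, hx, h0, h1⟩ := exists_ker ![ω (bs 2) (bs 0), ω (bs 3) (bs 0), ω (bs 4) (bs 0)]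
    ![ω (bs 2) (bs 1), ω (bs 3) (bs 1), ω (bs 4) (bs 1)]
  have hs := sy_alt ha
  have := hn (x 0 • bs 2 + x 1 • bs 3 + x 2 • bs 4) (fun y => by
    have a34 : ω (bs 2) (bs 3) = 0 := by rw [hs]; linarith
    have a43 : ω (bs 3) (bs 2) = 0 := h123
    have a45 : ω (bs 3) (bs 4) = 0 := by linarith
    have a54 : ω (bs 4) (bs 3) = 0 := by rw [hs]; linarith
    have a46 : ω (bs 3) (bs 5) = 0 := by linarith
    have a53 : ω (bs 4) (bs 2) = 0 := by linarith
    have a35 : ω (bs 2) (bs 4) = 0 := by rw [hs]; linarith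
    have a36 : ω (bs 2) (bs 5) = 0 := by rw [hs]; linarith
    have a56 : ω (bs 4) (bs 5) = 0 := h146
    rw [bs_sum y]
    simp [Fin.sum_univ_six, ha, a34, a43, a45, a54, a46, a53, a35, a36, a56] at h0 h1 ⊢
    linear_combination y 0 * h0 + y 1 * h1)
  have e0 := congrFun this 2
  have e1 := congrFun this 3
  have e2 := congrFun this 4
  simp [bs] at e0 e1 e2
  apply hx
  funext k
  fin_cases k <;> simp [e0, e1, e2]

theorem sy_no (i : Fin 34) (h : syF i = false) : ¬ (N i).AdmitsSymplectic := by
  have hi : ∀ i : Fin 34, syF i = false → i = 0 ∨ i = 1 ∨ i = 13 ∨ i = 14 ∨ i = 15 ∨ i = 16 ∨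
      i = 24 ∨ i = 31 := by
    decide +kernel
  rcases hi i h with rfl | rfl | rfl | rfl | rfl | rfl | rfl | rfl
  exacts [nsy1, nsy2, nsy14, nsy15, nsy16, nsy17, nsy25, nsy32]

set_option linter.unusedVariables false
set_option linter.unusedSimpArgs false

theorem exists_step (L : LieStruct 6) (hL : L.IsNilpotent) (U : Submodule ℝ (Fin 6 → ℝ))
    (hU : U ≠ ⊤) : ∃ x, x ∉ U ∧ ∀ v, L.bracket v x ∈ U := by
  classical
  have hex : ∃ k, lcs L k ≤ U := by
    obtain ⟨k, hk⟩ := hL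
    exact ⟨k, by rw [hk]; exact bot_le⟩
  obtain ⟨n, hn⟩ : ∃ n, Nat.find hex = n + 1 := by
    refine Nat.exists_eq_succ_of_ne_zero fun h0 => hU ?_
    have := Nat.find_spec hex
    rw [h0] at this
    exact top_le_iff.1 this
  have h1 := Nat.find_spec hex
  have h2 := Nat.find_min hex (m := n) (by omega)
  rw [hn] at h1
  obtain ⟨x, hx, hxU⟩ := SetLike.not_le_iff_exists.1 h2
  exact ⟨x, hxU, fun v => h1 (Submodule.subset_span ⟨v, x, hx, rfl⟩)⟩

/-- Complex scalar multiplication of a vector, for the complex structure `J`. -/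
def cm (J : (Fin 6 → ℝ) →ₗ[ℝ] (Fin 6 → ℝ)) (x : Fin 6 → ℝ) : ℂ →ₗ[ℝ] (Fin 6 → ℝ) where
  toFun z := z.re • x + z.im • J x
  map_add' z z' := by simp only [Complex.add_re, Complex.add_im]; module
  map_smul' c z := by simp only [Complex.real_smul, Complex.mul_re, Complex.mul_im,
    Complex.ofReal_re, Complex.ofReal_im, RingHom.id_apply]; module

theorem cm_apply (J : (Fin 6 → ℝ) →ₗ[ℝ] (Fin 6 → ℝ)) (x : Fin 6 → ℝ) (z : ℂ) :
    cm J x z = z.re • x + z.im • J x := rfl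

theorem cm_mul {J : (Fin 6 → ℝ) →ₗ[ℝ] (Fin 6 → ℝ)} (hJ : ∀ x, J (J x) = -x) (x : Fin 6 → ℝ)
    (c z : ℂ) : c.re • cm J x z + c.im • J (cm J x z) = cm J x (c * z) := by
  simp only [cm_apply, map_add, map_smul, hJ, Complex.mul_re, Complex.mul_im]
  module

theorem cm_I {J : (Fin 6 → ℝ) →ₗ[ℝ] (Fin 6 → ℝ)} (hJ : ∀ x, J (J x) = -x) (x : Fin 6 → ℝ)
    (z : ℂ) : J (cm J x z) = cm J x (Complex.I * z) := by
  have := cm_mul hJ x Complex.I z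
  simpa using this

section
variable {L : LieStruct 6} {J : (Fin 6 → ℝ) →ₗ[ℝ] (Fin 6 → ℝ)}

theorem key2 (hN : ∀ x y, L.bracket (J x) (J y) - L.bracket x y
      - J (L.bracket (J x) y) - J (L.bracket x (J y)) = 0)
    (f : (Fin 6 → ℝ) →ₗ[ℝ] ℂ) (hf : ∀ v, f (J v) = Complex.I * f v) (x x' : Fin 6 → ℝ) (s t : ℂ) :
    f (L.bracket (cm J x s) (cm J x' t)) = s * f (L.bracket x (cm J x' t)) +
      t * f (L.bracket (cm J x s) x') - s * t * f (L.bracket x x') := by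
  have h := congrArg f (hN x x')
  simp only [map_sub, hf, map_zero] at h
  simp only [cm_apply, L.add_left, L.add_right, L.smul_left, L.smul_right, map_add, map_smul,
    Complex.real_smul, smul_add]
  have hs := Complex.re_add_im s
  have ht := Complex.re_add_im t
  set s0 : ℂ := (s.re : ℂ)
  set s1 : ℂ := (s.im : ℂ)
  set t0 : ℂ := (t.re : ℂ)
  set t1 : ℂ := (t.im : ℂ)
  rw [← hs, ← ht]
  have hI := Complex.I_sq
  linear_combination (s1 * t1) * h + (s1 * t1 * f (L.bracket x x')) * hI

theorem key3 (hN : ∀ x y, L.bracket (J x) (J y) - L.bracket x y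
      - J (L.bracket (J x) y) - J (L.bracket x (J y)) = 0)
    (f : (Fin 6 → ℝ) →ₗ[ℝ] ℂ) (hf : ∀ v, f (J v) = Complex.I * f v)
    (x1 x2 x3 : Fin 6 → ℝ) (s1 s2 s3 t1 t2 t3 : ℂ) (y z : Fin 6 → ℝ)
    (hy : y = cm J x1 s1 + cm J x2 s2 + cm J x3 s3) (hz : z = cm J x1 t1 + cm J x2 t2 + cm J x3 t3) :
    f (L.bracket y z) = s1 * f (L.bracket x1 z) + s2 * f (L.bracket x2 z) + s3 * f (L.bracket x3 z)
      - t1 * f (L.bracket x1 y) - t2 * f (L.bracket x2 y) - t3 * f (L.bracket x3 y)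
      - (s1 * t2 - s2 * t1) * f (L.bracket x1 x2) - (s1 * t3 - s3 * t1) * f (L.bracket x1 x3)
      - (s2 * t3 - s3 * t2) * f (L.bracket x2 x3) := by
  have k := key2 hN f hf
  have sk : ∀ x y, f (L.bracket x y) = - f (L.bracket y x) := fun x y => by
    rw [L.skew, map_neg]
  have al : ∀ x, f (L.bracket x x) = 0 := fun x => by rw [L.alt, map_zero]
  subst hy hz
  simp only [L.add_left, L.add_right, map_add]
  rw [k x1 x1, k x1 x2, k x1 x3, k x2 x1, k x2 x2, k x2 x3, k x3 x1, k x3 x2, k x3 x3,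
    al, al, al, sk x2 x1, sk x3 x1, sk x3 x2,
    sk (cm J x1 s1) x1, sk (cm J x1 s1) x2, sk (cm J x1 s1) x3,
    sk (cm J x2 s2) x1, sk (cm J x2 s2) x2, sk (cm J x2 s2) x3,
    sk (cm J x3 s3) x1, sk (cm J x3 s3) x2, sk (cm J x3 s3) x3]
  ring
end

/-- The structure equations of a nilpotent Lie algebra with complex structure. -/
theorem cx_struct (L : LieStruct 6) (hL : L.IsNilpotent) (hC : L.AdmitsComplex) :
    ∃ p q r : (Fin 6 → ℝ) →ₗ[ℝ] ℂ, ∃ g h d : (Fin 6 → ℝ) → ℂ,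
      (∀ y z, p (L.bracket y z) = 0) ∧
      (∀ y z, q (L.bracket y z) = p y * g z - p z * g y) ∧
      (∀ y z, r (L.bracket y z) = p y * h z - p z * h y + (q y * d z - q z * d y)) ∧
      (∀ x, p x = 0 → q x = 0 → r x = 0 → x = 0) ∧
      (∃ x, p x = 1) ∧ (∃ x, p x = Complex.I) := by
  obtain ⟨J, hJ, hN⟩ := hC
  have fV : Module.finrank ℝ (Fin 6 → ℝ) = 6 := by simp
  obtain ⟨x1, hx1, b1⟩ := exists_step L hL ⊥ (by
    intro h
    have : Module.finrank ℝ (⊤ : Submodule ℝ (Fin 6 → ℝ)) = 0 := by rw [← h]; simp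
    rw [finrank_top, fV] at this
    omega)
  obtain ⟨x2, hx2, b2⟩ := exists_step L hL (cm J x1).range (by
    intro h
    have h1 := LinearMap.finrank_range_le (cm J x1)
    rw [h, finrank_top, fV, Complex.finrank_real_complex] at h1
    omega)
  obtain ⟨x3, hx3, b3⟩ := exists_step L hL ((cm J x1).coprod (cm J x2)).range (by
    intro h
    have h1 := LinearMap.finrank_range_le ((cm J x1).coprod (cm J x2))
    rw [h, finrank_top, fV, Module.finrank_prod, Complex.finrank_real_complex] at h1
    omega)
  let Φ : ((ℂ × ℂ) × ℂ) →ₗ[ℝ] (Fin 6 → ℝ) := ((cm J x1).coprod (cm J x2)).coprod (cm J x3)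
  have hΦ : ∀ z, Φ z = cm J x1 z.1.1 + cm J x2 z.1.2 + cm J x3 z.2 := fun z => by
    simp [Φ]
  have cm1 : ∀ x, cm J x 1 = x := fun x => by simp [cm_apply]
  have hinj : Function.Injective Φ := by
    rw [← LinearMap.ker_eq_bot, Submodule.eq_bot_iff]
    rintro ⟨⟨z1, z2⟩, z3⟩ hz
    rw [LinearMap.mem_ker, hΦ] at hz
    simp only at hz
    have hmul : ∀ c : ℂ, cm J x1 (c * z1) + cm J x2 (c * z2) + cm J x3 (c * z3) = 0 := by
      intro c
      rw [← cm_mul hJ, ← cm_mul hJ, ← cm_mul hJ]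
      have : c.re • (cm J x1 z1 + cm J x2 z2 + cm J x3 z3) +
        c.im • J (cm J x1 z1 + cm J x2 z2 + cm J x3 z3) = 0 := by simp [hz]
      rw [← this]
      simp only [map_add]
      module
    have h3 : z3 = 0 := by
      by_contra h3
      apply hx3
      have := hmul z3⁻¹
      rw [inv_mul_cancel₀ h3, cm1] at this
      refine ⟨-(z3⁻¹ * z1, z3⁻¹ * z2), ?_⟩
      rw [map_neg, LinearMap.coprod_apply]
      exact (eq_neg_of_add_eq_zero_right this).symm
    subst h3
    have h2 : z2 = 0 := by
      by_contra h3
      apply hx2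
      have := hmul z2⁻¹
      rw [inv_mul_cancel₀ h3, cm1, mul_zero, map_zero, add_zero] at this
      refine ⟨-(z2⁻¹ * z1), ?_⟩
      rw [map_neg]
      exact (eq_neg_of_add_eq_zero_right this).symm
    subst h2
    have h1 : z1 = 0 := by
      by_contra h3
      apply hx1
      have := hmul z1⁻¹
      rw [inv_mul_cancel₀ h3, cm1, mul_zero, map_zero, add_zero, map_zero, add_zero] at this
      exact this
    subst h1
    rfl
  let Ψ := LinearEquiv.ofInjectiveOfFinrankEq Φ hinj (by
    simp [Complex.finrank_real_complex])
  have hΨ : ∀ z, Ψ z = Φ z := fun z => rfl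
  have hΨs : ∀ v z, v = Φ z → Ψ.symm v = z := fun v z h => by
    rw [h, ← hΨ, LinearEquiv.symm_apply_apply]
  let r : (Fin 6 → ℝ) →ₗ[ℝ] ℂ := LinearMap.fst ℝ ℂ ℂ ∘ₗ LinearMap.fst ℝ (ℂ × ℂ) ℂ ∘ₗ Ψ.symm.toLinearMap
  let q : (Fin 6 → ℝ) →ₗ[ℝ] ℂ := LinearMap.snd ℝ ℂ ℂ ∘ₗ LinearMap.fst ℝ (ℂ × ℂ) ℂ ∘ₗ Ψ.symm.toLinearMap
  let p : (Fin 6 → ℝ) →ₗ[ℝ] ℂ := LinearMap.snd ℝ (ℂ × ℂ) ℂ ∘ₗ Ψ.symm.toLinearMap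
  have hv : ∀ v, v = cm J x1 (r v) + cm J x2 (q v) + cm J x3 (p v) := fun v => by
    have := hΦ (Ψ.symm v)
    rw [← hΨ, LinearEquiv.apply_symm_apply] at this
    exact this
  have hval : ∀ s t u, r (cm J x1 s + cm J x2 t + cm J x3 u) = s ∧
      q (cm J x1 s + cm J x2 t + cm J x3 u) = t ∧ p (cm J x1 s + cm J x2 t + cm J x3 u) = u := by
    intro s t u
    have := hΨs _ ((s, t), u) (hΦ ((s, t), u)).symm
    refine ⟨?_, ?_, ?_⟩
    · exact congrArg (fun z => z.1.1) this
    · exact congrArg (fun z => z.1.2) this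
    · exact congrArg (fun z => z.2) this
  have hJv : ∀ v, J v = cm J x1 (Complex.I * r v) + cm J x2 (Complex.I * q v) +
      cm J x3 (Complex.I * p v) := fun v => by
    conv_lhs => rw [hv v]
    rw [map_add, map_add, cm_I hJ, cm_I hJ, cm_I hJ]
  have hr : ∀ v, r (J v) = Complex.I * r v := fun v => by rw [hJv]; exact (hval _ _ _).1
  have hq : ∀ v, q (J v) = Complex.I * q v := fun v => by rw [hJv]; exact (hval _ _ _).2.1
  have hp : ∀ v, p (J v) = Complex.I * p v := fun v => by rw [hJv]; exact (hval _ _ _).2.2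
  have c1 : ∀ v, L.bracket x1 v = 0 := fun v => by
    rw [L.skew]; simpa using b1 v
  have c2 : ∀ v, ∃ s, L.bracket x2 v = cm J x1 s + cm J x2 0 + cm J x3 0 := fun v => by
    obtain ⟨s, hs⟩ := b2 v
    exact ⟨-s, by rw [L.skew, ← hs]; simp⟩
  have c3 : ∀ v, ∃ s t, L.bracket x3 v = cm J x1 s + cm J x2 t + cm J x3 0 := fun v => by
    obtain ⟨s, hs⟩ := b3 v
    exact ⟨-s.1, -s.2, by rw [L.skew, ← hs]; simp [add_comm]⟩
  have p2 : ∀ v, p (L.bracket x2 v) = 0 := fun v => by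
    obtain ⟨s, hs⟩ := c2 v
    rw [hs]; exact (hval _ _ _).2.2
  have q2 : ∀ v, q (L.bracket x2 v) = 0 := fun v => by
    obtain ⟨s, hs⟩ := c2 v
    rw [hs]; exact (hval _ _ _).2.1
  have p3 : ∀ v, p (L.bracket x3 v) = 0 := fun v => by
    obtain ⟨s, t, hs⟩ := c3 v
    rw [hs]; exact (hval _ _ _).2.2
  refine ⟨p, q, r, fun z => q (L.bracket x3 z),
    fun z => r (L.bracket x3 z) - q z * r (L.bracket x3 x2), fun z => r (L.bracket x2 z),
    fun y z => ?_, fun y z => ?_, fun y z => ?_, fun x h1 h2 h3 => ?_,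
    ⟨cm J x1 0 + cm J x2 0 + cm J x3 1, (hval _ _ _).2.2⟩,
    ⟨cm J x1 0 + cm J x2 0 + cm J x3 Complex.I, (hval _ _ _).2.2⟩⟩
  · rw [key3 hN p hp x1 x2 x3 _ _ _ _ _ _ y z (hv y) (hv z)]
    simp [c1, p2, p3]
  · rw [key3 hN q hq x1 x2 x3 _ _ _ _ _ _ y z (hv y) (hv z)]
    simp [c1, q2]
  · rw [key3 hN r hr x1 x2 x3 _ _ _ _ _ _ y z (hv y) (hv z), L.skew x3 x2]
    simp only [c1, map_zero, map_neg]
    ring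
  · rw [hv x, h1, h2, h3]
    simp

set_option linter.unusedVariables false
set_option linter.unusedSimpArgs false

/-- The structure equations of a complex structure in the standard basis. -/
structure CX (i : Fin 34) (a b c g h d : Fin 6 → ℂ) : Prop where
  ea : ∀ j k, ∑ l, (sc (tab i l) j k : ℂ) * a l = 0
  eb : ∀ j k, ∑ l, (sc (tab i l) j k : ℂ) * b l = a j * g k - a k * g j
  ec : ∀ j k, ∑ l, (sc (tab i l) j k : ℂ) * c l = a j * h k - a k * h j + (b j * d k - b k * d j)
  inj : ∀ x : Fin 6 → ℝ, ∑ l, (x l : ℂ) * a l = 0 → ∑ l, (x l : ℂ) * b l = 0 →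
    ∑ l, (x l : ℂ) * c l = 0 → x = 0
  one : ∃ x : Fin 6 → ℝ, ∑ l, (x l : ℂ) * a l = 1
  im : ∃ x : Fin 6 → ℝ, ∑ l, (x l : ℂ) * a l = Complex.I

theorem lin_bs (p : (Fin 6 → ℝ) →ₗ[ℝ] ℂ) (x : Fin 6 → ℝ) :
    p x = ∑ l, (x l : ℂ) * p (bs l) := by
  conv_lhs => rw [bs_sum x]
  simp

theorem lin_br (p : (Fin 6 → ℝ) →ₗ[ℝ] ℂ) (i : Fin 34) (j k : Fin 6) :
    p ((N i).bracket (bs j) (bs k)) = ∑ l, (sc (tab i l) j k : ℂ) * p (bs l) := by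
  rw [bs_bracket]
  simp

theorem CX.mk' (i : Fin 34) (hC : (N i).AdmitsComplex) : ∃ a b c g h d, CX i a b c g h d := by
  obtain ⟨p, q, r, g, h, d, h1, h2, h3, h4, ⟨x, hx⟩, ⟨y, hy⟩⟩ := cx_struct (N i) (N_nilp i) hC
  refine ⟨fun k => p (bs k), fun k => q (bs k), fun k => r (bs k), fun k => g (bs k),
    fun k => h (bs k), fun k => d (bs k), ?_, ?_, ?_, ?_, ⟨x, ?_⟩, ⟨y, ?_⟩⟩
  · intro j k; rw [← lin_br]; exact h1 _ _
  · intro j k; rw [← lin_br]; exact h2 _ _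
  · intro j k; rw [← lin_br]; exact h3 _ _
  · intro x e1 e2 e3
    exact h4 x (by rwa [lin_bs]) (by rwa [lin_bs]) (by rwa [lin_bs])
  · rw [← lin_bs]; exact hx
  · rw [← lin_bs]; exact hy

namespace CX
variable {i : Fin 34} {a b c g h d : Fin 6 → ℂ}

/-- The values of the closed form do not lie on a real line. -/
theorem rk (H : CX i a b c g h d) (z : ℂ) (t : Fin 6 → ℝ) (ht : ∀ k, a k = t k * z) : False := by
  obtain ⟨x, hx⟩ := H.one
  obtain ⟨y, hy⟩ := H.im
  have e : ∀ x : Fin 6 → ℝ, ∑ l, (x l : ℂ) * a l = ((∑ l, x l * t l : ℝ) : ℂ) * z := by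
    intro x
    rw [Complex.ofReal_sum, Finset.sum_mul]
    refine Finset.sum_congr rfl fun k _ => ?_
    rw [ht k]; push_cast; ring
  rw [e] at hx hy
  generalize (∑ l, x l * t l : ℝ) = u at hx
  generalize (∑ l, y l * t l : ℝ) = v at hy
  have h1 : (u : ℂ) * Complex.I = v := by
    rw [← hy, mul_left_comm, hx, mul_one]
  have h2 := congrArg Complex.im h1
  simp at h2
  subst h2
  simp at hx

theorem rk1 (H : CX i a b c g h d) (j : Fin 6) (hj : ∀ k, k ≠ j → a k = 0) : False := by
  refine H.rk (a j) (fun k => if k = j then 1 else 0) fun k => ?_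
  by_cases h : k = j
  · subst h; simp
  · simp [h, hj k h]

theorem rk2 (H : CX i a b c g h d) (j l : Fin 6) (hjl : j ≠ l)
    (hj : ∀ k, k ≠ j → k ≠ l → a k = 0) :
    a j ≠ 0 ∧ a l ≠ 0 ∧ a j ^ 2 ≠ a l ^ 2 := by
  refine ⟨fun h0 => ?_, fun h0 => ?_, fun h0 => ?_⟩
  · refine H.rk1 l fun k hk => ?_
    by_cases h : k = j
    · subst h; exact h0
    · exact hj k h hk
  · refine H.rk1 j fun k hk => ?_
    by_cases h : k = l
    · subst h; exact h0
    · exact hj k hk h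
  · rcases sq_eq_sq_iff_eq_or_eq_neg.mp h0 with h1 | h1
    · refine H.rk (a l) (fun k => if k = j ∨ k = l then 1 else 0) fun k => ?_
      by_cases h : k = j
      · subst h; simp [h1]
      · by_cases h' : k = l
        · subst h'; simp
        · simp [h, h', hj k h h']
    · refine H.rk (a l) (fun k => if k = j then -1 else if k = l then 1 else 0) fun k => ?_
      by_cases h : k = j
      · subst h; simp [h1]
      · by_cases h' : k = l
        · subst h'; simp [h]
        · simp [h, h', hj k h h']

/-- The first two forms cannot vanish on three independent vectors. -/
theorem k3 (H : CX i a b c g h d) (x y z : Fin 6 → ℝ)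
    (hx : ∑ l, (x l : ℂ) * a l = 0 ∧ ∑ l, (x l : ℂ) * b l = 0)
    (hy : ∑ l, (y l : ℂ) * a l = 0 ∧ ∑ l, (y l : ℂ) * b l = 0)
    (hz : ∑ l, (z l : ℂ) * a l = 0 ∧ ∑ l, (z l : ℂ) * b l = 0)
    (hi : ∀ s t u : ℝ, s • x + t • y + u • z = 0 → s = 0 ∧ t = 0 ∧ u = 0) : False := by
  have key : ∀ (f : Fin 6 → ℂ) (s t u : ℝ), ∑ l, ((s • x + t • y + u • z) l : ℂ) * f l =
      s * ∑ l, (x l : ℂ) * f l + t * ∑ l, (y l : ℂ) * f l + u * ∑ l, (z l : ℂ) * f l := by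
    intro f s t u
    rw [Finset.mul_sum, Finset.mul_sum, Finset.mul_sum, ← Finset.sum_add_distrib,
      ← Finset.sum_add_distrib]
    refine Finset.sum_congr rfl fun k _ => ?_
    simp only [Pi.add_apply, Pi.smul_apply, smul_eq_mul]
    push_cast; ring
  obtain ⟨v, hv, h1, h2⟩ := exists_ker
    ![(∑ l, (x l : ℂ) * c l).re, (∑ l, (y l : ℂ) * c l).re, (∑ l, (z l : ℂ) * c l).re]
    ![(∑ l, (x l : ℂ) * c l).im, (∑ l, (y l : ℂ) * c l).im, (∑ l, (z l : ℂ) * c l).im]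
  have := H.inj (v 0 • x + v 1 • y + v 2 • z) (by rw [key, hx.1, hy.1, hz.1]; simp)
    (by rw [key, hx.2, hy.2, hz.2]; simp) (by
      rw [key]
      generalize ∑ l, (x l : ℂ) * c l = X at *
      generalize ∑ l, (y l : ℂ) * c l = Y at *
      generalize ∑ l, (z l : ℂ) * c l = Z at *
      apply Complex.ext
      · simpa using h1
      · simpa using h2)
  obtain ⟨e0, e1, e2⟩ := hi _ _ _ this
  apply hv
  funext k
  fin_cases k
  · exact e0
  · exact e1
  · exact e2

theorem sbs (f : Fin 6 → ℂ) (k : Fin 6) : ∑ l, ((bs k l : ℝ) : ℂ) * f l = f k := by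
  rw [Finset.sum_eq_single k]
  · simp [bs]
  · intro l _ hl; simp [bs, hl]
  · simp

theorem k3b (H : CX i a b c g h d) (j k l : Fin 6) (hjk : j ≠ k) (hjl : j ≠ l) (hkl : k ≠ l)
    (aj : a j = 0) (ak : a k = 0) (al : a l = 0) (bj : b j = 0) (bk : b k = 0) (bl : b l = 0) :
    False := by
  refine H.k3 (bs j) (bs k) (bs l) (by rw [sbs, sbs]; exact ⟨aj, bj⟩)
    (by rw [sbs, sbs]; exact ⟨ak, bk⟩) (by rw [sbs, sbs]; exact ⟨al, bl⟩) fun s t u h => ?_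
  have h1 := congrFun h j
  have h2 := congrFun h k
  have h3 := congrFun h l
  simp [bs, hjk, hjl, hkl, hjk.symm, hjl.symm, hkl.symm] at h1 h2 h3
  exact ⟨h1, h2, h3⟩

theorem cne (H : CX i a b c g h d) (j : Fin 6) (aj : a j = 0) (bj : b j = 0) : c j ≠ 0 := by
  intro cj
  have := H.inj (bs j) (by rw [sbs]; exact aj) (by rw [sbs]; exact bj) (by rw [sbs]; exact cj)
  have := congrFun this j
  simp [bs] at this

/-- The wedge identity for the third structure equation. -/
theorem f4 (H : CX i a b c g h d) (j k l m : Fin 6) :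
    (a j * b k - a k * b j) * (∑ s, (sc (tab i s) l m : ℂ) * c s)
    - (a j * b l - a l * b j) * (∑ s, (sc (tab i s) k m : ℂ) * c s)
    + (a j * b m - a m * b j) * (∑ s, (sc (tab i s) k l : ℂ) * c s)
    + (a k * b l - a l * b k) * (∑ s, (sc (tab i s) j m : ℂ) * c s)
    - (a k * b m - a m * b k) * (∑ s, (sc (tab i s) j l : ℂ) * c s)
    + (a l * b m - a m * b l) * (∑ s, (sc (tab i s) j k : ℂ) * c s) = 0 := by
  rw [H.ec, H.ec, H.ec, H.ec, H.ec, H.ec]; ring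

end CX

theorem fin6_of {P : Fin 6 → Prop} (h0 : P 0) (h1 : P 1) (h2 : P 2) (h3 : P 3) (h4 : P 4)
    (h5 : P 5) : ∀ k, P k := by
  intro k; fin_cases k <;> assumption

theorem CX.fil {i : Fin 34} {a b c g h d : Fin 6 → ℂ} (H : CX i a b c g h d)
    (h2 : a 2 = 0) (h3 : a 3 = 0) (h4 : a 4 = 0) (h5 : a 5 = 0) :
    a 0 ≠ 0 ∧ a 1 ≠ 0 ∧ a 0 ^ 2 ≠ a 1 ^ 2 :=
  H.rk2 0 1 (by decide) (fin6_of (by simp) (by simp) (by simp [h2]) (by simp [h3]) (by simp [h4])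
    (by simp [h5]))

theorem CX.thr {i : Fin 34} {a b c g h d : Fin 6 → ℂ} (H : CX i a b c g h d)
    (h3 : a 3 = 0) (h4 : a 4 = 0) (h5 : a 5 = 0) :
    (a 2 = 0 → a 0 ≠ 0 ∧ a 1 ≠ 0 ∧ a 0 ^ 2 ≠ a 1 ^ 2) ∧
    (a 1 = 0 → a 0 ≠ 0 ∧ a 2 ≠ 0 ∧ a 0 ^ 2 ≠ a 2 ^ 2) :=
  ⟨fun h => H.fil h h3 h4 h5, fun h => H.rk2 0 2 (by decide) (fin6_of (by simp) (by simp [h])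
    (by simp) (by simp [h3]) (by simp [h4]) (by simp [h5]))⟩

set_option linter.unusedVariables false
set_option linter.unusedSimpArgs false

theorem ncx1 : ¬ (N 0).AdmitsComplex := by
  intro hC
  obtain ⟨a, b, c, g, h, d, H⟩ := CX.mk' _ hC
  have A01 := H.ea 0 1
  have A02 := H.ea 0 2
  have A03 := H.ea 0 3
  have A14 := H.ea 1 4
  have B13 := H.eb 1 3
  have B12 := H.eb 1 2
  have B03 := H.eb 0 3
  have B02 := H.eb 0 2
  have B23 := H.eb 2 3
  simp only [Fin.sum_univ_six, sc, tab, Matrix.cons_val, List.map_cons, List.map_nil, List.sum_cons, List.sum_nil, reduceIte, Fin.isValue, Fin.reduceEq, and_self, and_true, and_false, true_and, false_and, Int.cast_zero, Int.cast_one, Int.cast_neg, zero_mul, one_mul, neg_mul, add_zero, zero_add, neg_zero, mul_zero, sub_zero, zero_sub] at A01 A02 A03 A14 B13 B12 B03 B02 B23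
  obtain ⟨h0, h1, -⟩ := H.fil (by grind) (by grind) (by grind) (by grind)
  exact H.k3b 3 4 5 (by decide) (by decide) (by decide) (by grind) (by grind) (by grind) (by grind) (by grind) (by grind)

theorem ncx2 : ¬ (N 1).AdmitsComplex := by
  intro hC
  obtain ⟨a, b, c, g, h, d, H⟩ := CX.mk' _ hC
  have A01 := H.ea 0 1
  have A02 := H.ea 0 2
  have A03 := H.ea 0 3
  have A14 := H.ea 1 4
  have B12 := H.eb 1 2
  have B13 := H.eb 1 3
  have B02 := H.eb 0 2
  have B03 := H.eb 0 3
  have B23 := H.eb 2 3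
  simp only [Fin.sum_univ_six, sc, tab, Matrix.cons_val, List.map_cons, List.map_nil, List.sum_cons, List.sum_nil, reduceIte, Fin.isValue, Fin.reduceEq, and_self, and_true, and_false, true_and, false_and, Int.cast_zero, Int.cast_one, Int.cast_neg, zero_mul, one_mul, neg_mul, add_zero, zero_add, neg_zero, mul_zero, sub_zero, zero_sub] at A01 A02 A03 A14 B12 B13 B02 B03 B23
  obtain ⟨h0, h1, -⟩ := H.fil (by grind) (by grind) (by grind) (by grind)
  exact H.k3b 3 4 5 (by decide) (by decide) (by decide) (by grind) (by grind) (by grind) (by grind) (by grind) (by grind)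

theorem ncx3 : ¬ (N 2).AdmitsComplex := by
  intro hC
  obtain ⟨a, b, c, g, h, d, H⟩ := CX.mk' _ hC
  have A01 := H.ea 0 1
  have A02 := H.ea 0 2
  have A03 := H.ea 0 3
  have A04 := H.ea 0 4
  have B12 := H.eb 1 2
  have B13 := H.eb 1 3
  have B14 := H.eb 1 4
  have B02 := H.eb 0 2
  have B03 := H.eb 0 3
  have B04 := H.eb 0 4
  simp only [Fin.sum_univ_six, sc, tab, Matrix.cons_val, List.map_cons, List.map_nil, List.sum_cons, List.sum_nil, reduceIte, Fin.isValue, Fin.reduceEq, and_self, and_true, and_false, true_and, false_and, Int.cast_zero, Int.cast_one, Int.cast_neg, zero_mul, one_mul, neg_mul, add_zero, zero_add, neg_zero, mul_zero, sub_zero, zero_sub] at A01 A02 A03 A04 B12 B13 B14 B02 B03 B04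
  obtain ⟨h0, h1, -⟩ := H.fil (by grind) (by grind) (by grind) (by grind)
  exact H.k3b 3 4 5 (by decide) (by decide) (by decide) (by grind) (by grind) (by grind) (by grind) (by grind) (by grind)

theorem ncx4 : ¬ (N 3).AdmitsComplex := by
  intro hC
  obtain ⟨a, b, c, g, h, d, H⟩ := CX.mk' _ hC
  have A01 := H.ea 0 1
  have A02 := H.ea 0 2
  have A03 := H.ea 0 3
  have A04 := H.ea 0 4
  have B14 := H.eb 1 4
  have B04 := H.eb 0 4
  have B13 := H.eb 1 3
  have B12 := H.eb 1 2
  have B03 := H.eb 0 3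
  have B02 := H.eb 0 2
  simp only [Fin.sum_univ_six, sc, tab, Matrix.cons_val, List.map_cons, List.map_nil, List.sum_cons, List.sum_nil, reduceIte, Fin.isValue, Fin.reduceEq, and_self, and_true, and_false, true_and, false_and, Int.cast_zero, Int.cast_one, Int.cast_neg, zero_mul, one_mul, neg_mul, add_zero, zero_add, neg_zero, mul_zero, sub_zero, zero_sub] at A01 A02 A03 A04 B14 B04 B13 B12 B03 B02
  obtain ⟨h0, h1, -⟩ := H.fil (by grind) (by grind) (by grind) (by grind)
  exact H.k3b 3 4 5 (by decide) (by decide) (by decide) (by grind) (by grind) (by grind) (by grind) (by grind) (by grind)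

theorem ncx5 : ¬ (N 4).AdmitsComplex := by
  intro hC
  obtain ⟨a, b, c, g, h, d, H⟩ := CX.mk' _ hC
  have A01 := H.ea 0 1
  have A02 := H.ea 0 2
  have A03 := H.ea 0 3
  have A04 := H.ea 0 4
  have B13 := H.eb 1 3
  have B14 := H.eb 1 4
  have B03 := H.eb 0 3
  have B04 := H.eb 0 4
  have B12 := H.eb 1 2
  have B02 := H.eb 0 2
  simp only [Fin.sum_univ_six, sc, tab, Matrix.cons_val, List.map_cons, List.map_nil, List.sum_cons, List.sum_nil, reduceIte, Fin.isValue, Fin.reduceEq, and_self, and_true, and_false, true_and, false_and, Int.cast_zero, Int.cast_one, Int.cast_neg, zero_mul, one_mul, neg_mul, add_zero, zero_add, neg_zero, mul_zero, sub_zero, zero_sub] at A01 A02 A03 A04 B13 B14 B03 B04 B12 B02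
  obtain ⟨h0, h1, -⟩ := H.fil (by grind) (by grind) (by grind) (by grind)
  exact H.k3b 3 4 5 (by decide) (by decide) (by decide) (by grind) (by grind) (by grind) (by grind) (by grind) (by grind)

theorem ncx6 : ¬ (N 5).AdmitsComplex := by
  intro hC
  obtain ⟨a, b, c, g, h, d, H⟩ := CX.mk' _ hC
  have A01 := H.ea 0 1
  have A02 := H.ea 0 2
  have A03 := H.ea 0 3
  have A12 := H.ea 1 2
  have B02 := H.eb 0 2
  have B12 := H.eb 1 2
  have B13 := H.eb 1 3
  have B03 := H.eb 0 3
  have F0134 := H.f4 0 1 3 4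
  simp only [Fin.sum_univ_six, sc, tab, Matrix.cons_val, List.map_cons, List.map_nil, List.sum_cons, List.sum_nil, reduceIte, Fin.isValue, Fin.reduceEq, and_self, and_true, and_false, true_and, false_and, Int.cast_zero, Int.cast_one, Int.cast_neg, zero_mul, one_mul, neg_mul, add_zero, zero_add, neg_zero, mul_zero, sub_zero, zero_sub] at A01 A02 A03 A12 B02 B12 B13 B03 F0134
  obtain ⟨h0, h1, h2⟩ := H.fil (by grind) (by grind) (by grind) (by grind)
  have a5 : a 5 = 0 := by grind
  have b5 : b 5 = 0 := by grind
  have c5 := H.cne 5 a5 b5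
  have g2 : g 2 = 0 := by grind
  exact H.k3b 3 4 5 (by decide) (by decide) (by decide) (by grind) (by grind) (by grind) (by grind) (by grind) (by grind)

theorem ncx7 : ¬ (N 6).AdmitsComplex := by
  intro hC
  obtain ⟨a, b, c, g, h, d, H⟩ := CX.mk' _ hC
  have A01 := H.ea 0 1
  have A02 := H.ea 0 2
  have A03 := H.ea 0 3
  have A12 := H.ea 1 2
  have B02 := H.eb 0 2
  have B12 := H.eb 1 2
  have B13 := H.eb 1 3
  have B03 := H.eb 0 3
  have F0134 := H.f4 0 1 3 4
  simp only [Fin.sum_univ_six, sc, tab, Matrix.cons_val, List.map_cons, List.map_nil, List.sum_cons, List.sum_nil, reduceIte, Fin.isValue, Fin.reduceEq, and_self, and_true, and_false, true_and, false_and, Int.cast_zero, Int.cast_one, Int.cast_neg, zero_mul, one_mul, neg_mul, add_zero, zero_add, neg_zero, mul_zero, sub_zero, zero_sub] at A01 A02 A03 A12 B02 B12 B13 B03 F0134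
  obtain ⟨h0, h1, h2⟩ := H.fil (by grind) (by grind) (by grind) (by grind)
  have a5 : a 5 = 0 := by grind
  have b5 : b 5 = 0 := by grind
  have c5 := H.cne 5 a5 b5
  have g2 : g 2 = 0 := by grind
  exact H.k3b 3 4 5 (by decide) (by decide) (by decide) (by grind) (by grind) (by grind) (by grind) (by grind) (by grind)

theorem ncx9 : ¬ (N 8).AdmitsComplex := by
  intro hC
  obtain ⟨a, b, c, g, h, d, H⟩ := CX.mk' _ hC
  have A01 := H.ea 0 1
  have A03 := H.ea 0 3
  have A04 := H.ea 0 4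
  have B01 := H.eb 0 1
  have B02 := H.eb 0 2
  have B12 := H.eb 1 2
  have B03 := H.eb 0 3
  have B04 := H.eb 0 4
  have B13 := H.eb 1 3
  have B23 := H.eb 2 3
  have B14 := H.eb 1 4
  have B24 := H.eb 2 4
  have C34 := H.ec 3 4
  have C14 := H.ec 1 4
  have C04 := H.ec 0 4
  simp only [Fin.sum_univ_six, sc, tab, Matrix.cons_val, List.map_cons, List.map_nil, List.sum_cons, List.sum_nil, reduceIte, Fin.isValue, Fin.reduceEq, and_self, and_true, and_false, true_and, false_and, Int.cast_zero, Int.cast_one, Int.cast_neg, zero_mul, one_mul, neg_mul, add_zero, zero_add, neg_zero, mul_zero, sub_zero, zero_sub] at A01 A03 A04 B01 B02 B12 B03 B04 B13 B23 B14 B24 C34 C14 C04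
  have a3 : a 3 = 0 := by grind
  have a4 : a 4 = 0 := by grind
  have a5 : a 5 = 0 := by grind
  obtain ⟨h1, h2⟩ := H.thr a3 a4 a5
  have g4 : g 4 = 0 := by grind
  have b5 : b 5 = 0 := by grind
  have g3 : g 3 = 0 := by grind
  have b4 : b 4 = 0 := by grind
  have b3 : b 3 ≠ 0 := fun b3 => H.k3b 3 4 5 (by decide) (by decide) (by decide) a3 a4 a5 b3 b4 b5
  have a2 : a 2 = 0 := by grind
  have c5 := H.cne 5 a5 b5
  have d4 : d 4 = 0 := by grind
  have h4 : h 4 = 0 := by grind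
  grind

theorem ncx10 : ¬ (N 9).AdmitsComplex := by
  intro hC
  obtain ⟨a, b, c, g, h, d, H⟩ := CX.mk' _ hC
  have A01 := H.ea 0 1
  have A03 := H.ea 0 3
  have A04 := H.ea 0 4
  have B01 := H.eb 0 1
  have B02 := H.eb 0 2
  have B12 := H.eb 1 2
  have B03 := H.eb 0 3
  have B04 := H.eb 0 4
  have B13 := H.eb 1 3
  have B23 := H.eb 2 3
  have B14 := H.eb 1 4
  have B24 := H.eb 2 4
  have C34 := H.ec 3 4
  have C14 := H.ec 1 4
  have C04 := H.ec 0 4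
  simp only [Fin.sum_univ_six, sc, tab, Matrix.cons_val, List.map_cons, List.map_nil, List.sum_cons, List.sum_nil, reduceIte, Fin.isValue, Fin.reduceEq, and_self, and_true, and_false, true_and, false_and, Int.cast_zero, Int.cast_one, Int.cast_neg, zero_mul, one_mul, neg_mul, add_zero, zero_add, neg_zero, mul_zero, sub_zero, zero_sub] at A01 A03 A04 B01 B02 B12 B03 B04 B13 B23 B14 B24 C34 C14 C04
  have a3 : a 3 = 0 := by grind
  have a4 : a 4 = 0 := by grind
  have a5 : a 5 = 0 := by grind
  obtain ⟨h1, h2⟩ := H.thr a3 a4 a5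
  have g4 : g 4 = 0 := by grind
  have b5 : b 5 = 0 := by grind
  have g3 : g 3 = 0 := by grind
  have b4 : b 4 = 0 := by grind
  have b3 : b 3 ≠ 0 := fun b3 => H.k3b 3 4 5 (by decide) (by decide) (by decide) a3 a4 a5 b3 b4 b5
  have a2 : a 2 = 0 := by grind
  have c5 := H.cne 5 a5 b5
  have d4 : d 4 = 0 := by grind
  have h4 : h 4 = 0 := by grind
  grind

theorem ncx11 : ¬ (N 10).AdmitsComplex := by
  intro hC
  obtain ⟨a, b, c, g, h, d, H⟩ := CX.mk' _ hC
  have A01 := H.ea 0 1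
  have A03 := H.ea 0 3
  have A04 := H.ea 0 4
  have B01 := H.eb 0 1
  have B02 := H.eb 0 2
  have B12 := H.eb 1 2
  have B03 := H.eb 0 3
  have B04 := H.eb 0 4
  have B13 := H.eb 1 3
  have B23 := H.eb 2 3
  have B14 := H.eb 1 4
  have B24 := H.eb 2 4
  have C34 := H.ec 3 4
  have C14 := H.ec 1 4
  have C04 := H.ec 0 4
  simp only [Fin.sum_univ_six, sc, tab, Matrix.cons_val, List.map_cons, List.map_nil, List.sum_cons, List.sum_nil, reduceIte, Fin.isValue, Fin.reduceEq, and_self, and_true, and_false, true_and, false_and, Int.cast_zero, Int.cast_one, Int.cast_neg, zero_mul, one_mul, neg_mul, add_zero, zero_add, neg_zero, mul_zero, sub_zero, zero_sub] at A01 A03 A04 B01 B02 B12 B03 B04 B13 B23 B14 B24 C34 C14 C04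
  have a3 : a 3 = 0 := by grind
  have a4 : a 4 = 0 := by grind
  have a5 : a 5 = 0 := by grind
  obtain ⟨h1, h2⟩ := H.thr a3 a4 a5
  have g4 : g 4 = 0 := by grind
  have b5 : b 5 = 0 := by grind
  have g3 : g 3 = 0 := by grind
  have b4 : b 4 = 0 := by grind
  have b3 : b 3 ≠ 0 := fun b3 => H.k3b 3 4 5 (by decide) (by decide) (by decide) a3 a4 a5 b3 b4 b5
  have a2 : a 2 = 0 := by grind
  have c5 := H.cne 5 a5 b5
  have d4 : d 4 = 0 := by grind
  have h4 : h 4 = 0 := by grind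
  grind

theorem ncx12 : ¬ (N 11).AdmitsComplex := by
  intro hC
  obtain ⟨a, b, c, g, h, d, H⟩ := CX.mk' _ hC
  have A01 := H.ea 0 1
  have A03 := H.ea 0 3
  have A04 := H.ea 0 4
  have B01 := H.eb 0 1
  have B02 := H.eb 0 2
  have B12 := H.eb 1 2
  have B03 := H.eb 0 3
  have B04 := H.eb 0 4
  have B13 := H.eb 1 3
  have B23 := H.eb 2 3
  have B14 := H.eb 1 4
  have B24 := H.eb 2 4
  have C34 := H.ec 3 4
  have C14 := H.ec 1 4
  have C04 := H.ec 0 4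
  simp only [Fin.sum_univ_six, sc, tab, Matrix.cons_val, List.map_cons, List.map_nil, List.sum_cons, List.sum_nil, reduceIte, Fin.isValue, Fin.reduceEq, and_self, and_true, and_false, true_and, false_and, Int.cast_zero, Int.cast_one, Int.cast_neg, zero_mul, one_mul, neg_mul, add_zero, zero_add, neg_zero, mul_zero, sub_zero, zero_sub] at A01 A03 A04 B01 B02 B12 B03 B04 B13 B23 B14 B24 C34 C14 C04
  have a3 : a 3 = 0 := by grind
  have a4 : a 4 = 0 := by grind
  have a5 : a 5 = 0 := by grind
  obtain ⟨h1, h2⟩ := H.thr a3 a4 a5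
  have g4 : g 4 = 0 := by grind
  have b5 : b 5 = 0 := by grind
  have g3 : g 3 = 0 := by grind
  have b4 : b 4 = 0 := by grind
  have b3 : b 3 ≠ 0 := fun b3 => H.k3b 3 4 5 (by decide) (by decide) (by decide) a3 a4 a5 b3 b4 b5
  have a2 : a 2 = 0 := by grind
  have c5 := H.cne 5 a5 b5
  have d4 : d 4 = 0 := by grind
  have h4 : h 4 = 0 := by grind
  grind

theorem ncx13 : ¬ (N 12).AdmitsComplex := by
  intro hC
  obtain ⟨a, b, c, g, h, d, H⟩ := CX.mk' _ hC
  have A01 := H.ea 0 1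
  have A03 := H.ea 0 3
  have A04 := H.ea 0 4
  have B01 := H.eb 0 1
  have B02 := H.eb 0 2
  have B12 := H.eb 1 2
  have B03 := H.eb 0 3
  have B04 := H.eb 0 4
  have B13 := H.eb 1 3
  have B23 := H.eb 2 3
  have B14 := H.eb 1 4
  have B24 := H.eb 2 4
  have C34 := H.ec 3 4
  have C14 := H.ec 1 4
  have C04 := H.ec 0 4
  simp only [Fin.sum_univ_six, sc, tab, Matrix.cons_val, List.map_cons, List.map_nil, List.sum_cons, List.sum_nil, reduceIte, Fin.isValue, Fin.reduceEq, and_self, and_true, and_false, true_and, false_and, Int.cast_zero, Int.cast_one, Int.cast_neg, zero_mul, one_mul, neg_mul, add_zero, zero_add, neg_zero, mul_zero, sub_zero, zero_sub] at A01 A03 A04 B01 B02 B12 B03 B04 B13 B23 B14 B24 C34 C14 C04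
  have a3 : a 3 = 0 := by grind
  have a4 : a 4 = 0 := by grind
  have a5 : a 5 = 0 := by grind
  obtain ⟨h1, h2⟩ := H.thr a3 a4 a5
  have g4 : g 4 = 0 := by grind
  have b5 : b 5 = 0 := by grind
  have g3 : g 3 = 0 := by grind
  have b4 : b 4 = 0 := by grind
  have b3 : b 3 ≠ 0 := fun b3 => H.k3b 3 4 5 (by decide) (by decide) (by decide) a3 a4 a5 b3 b4 b5
  have a2 : a 2 = 0 := by grind
  have c5 := H.cne 5 a5 b5
  have d4 : d 4 = 0 := by grind
  have h4 : h 4 = 0 := by grind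
  grind

theorem ncx14 : ¬ (N 13).AdmitsComplex := by
  intro hC
  obtain ⟨a, b, c, g, h, d, H⟩ := CX.mk' _ hC
  have A01 := H.ea 0 1
  have A02 := H.ea 0 2
  have A03 := H.ea 0 3
  have B01 := H.eb 0 1
  have B02 := H.eb 0 2
  have B12 := H.eb 1 2
  have B03 := H.eb 0 3
  have B13 := H.eb 1 3
  have B23 := H.eb 2 3
  have B04 := H.eb 0 4
  have B14 := H.eb 1 4
  have B24 := H.eb 2 4
  have F0134 := H.f4 0 1 3 4
  have F1234 := H.f4 1 2 3 4
  have F0234 := H.f4 0 2 3 4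
  simp only [Fin.sum_univ_six, sc, tab, Matrix.cons_val, List.map_cons, List.map_nil, List.sum_cons, List.sum_nil, reduceIte, Fin.isValue, Fin.reduceEq, and_self, and_true, and_false, true_and, false_and, Int.cast_zero, Int.cast_one, Int.cast_neg, zero_mul, one_mul, neg_mul, add_zero, zero_add, neg_zero, mul_zero, sub_zero, zero_sub] at A01 A02 A03 B01 B02 B12 B03 B13 B23 B04 B14 B24 F0134 F1234 F0234
  have a3 : a 3 = 0 := by grind
  have a4 : a 4 = 0 := by grind
  have a5 : a 5 = 0 := by grind
  obtain ⟨h1, h2⟩ := H.thr a3 a4 a5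
  have b5 : b 5 = 0 := by grind
  have c5 := H.cne 5 a5 b5
  have b34 : b 3 ≠ 0 ∨ b 4 ≠ 0 := by
    by_contra! hb
    exact H.k3b 3 4 5 (by decide) (by decide) (by decide) a3 a4 a5 hb.1 hb.2 b5
  have a1 : a 1 = 0 := by grind
  grind

theorem ncx15 : ¬ (N 14).AdmitsComplex := by
  intro hC
  obtain ⟨a, b, c, g, h, d, H⟩ := CX.mk' _ hC
  have A01 := H.ea 0 1
  have A03 := H.ea 0 3
  have A12 := H.ea 1 2
  have B01 := H.eb 0 1
  have B02 := H.eb 0 2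
  have B12 := H.eb 1 2
  have B03 := H.eb 0 3
  have B13 := H.eb 1 3
  have B23 := H.eb 2 3
  have B04 := H.eb 0 4
  have B14 := H.eb 1 4
  have B24 := H.eb 2 4
  have F0134 := H.f4 0 1 3 4
  have F1234 := H.f4 1 2 3 4
  have F0234 := H.f4 0 2 3 4
  simp only [Fin.sum_univ_six, sc, tab, Matrix.cons_val, List.map_cons, List.map_nil, List.sum_cons, List.sum_nil, reduceIte, Fin.isValue, Fin.reduceEq, and_self, and_true, and_false, true_and, false_and, Int.cast_zero, Int.cast_one, Int.cast_neg, zero_mul, one_mul, neg_mul, add_zero, zero_add, neg_zero, mul_zero, sub_zero, zero_sub] at A01 A03 A12 B01 B02 B12 B03 B13 B23 B04 B14 B24 F0134 F1234 F0234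
  have a3 : a 3 = 0 := by grind
  have a4 : a 4 = 0 := by grind
  have a5 : a 5 = 0 := by grind
  obtain ⟨h1, h2⟩ := H.thr a3 a4 a5
  have b5 : b 5 = 0 := by grind
  have c5 := H.cne 5 a5 b5
  have b34 : b 3 ≠ 0 ∨ b 4 ≠ 0 := by
    by_contra! hb
    exact H.k3b 3 4 5 (by decide) (by decide) (by decide) a3 a4 a5 hb.1 hb.2 b5
  have a1 : a 1 = 0 := by grind
  grind

set_option linter.unusedVariables false
set_option linter.unusedSimpArgs false

/-- The final step for the algebras with four-dimensional abelianization. -/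
theorem CX.four {i : Fin 34} {a b c g h d : Fin 6 → ℂ} (H : CX i a b c g h d)
    (a4 : a 4 = 0) (a5 : a 5 = 0) (b4 : b 4 = 0) (b5 : b 5 = 0)
    (h12 : a 1 * b 2 = a 2 * b 1) (h13 : a 1 * b 3 = a 3 * b 1) (h23 : a 2 * b 3 = a 3 * b 2) :
    False := by
  have hw : ∃ u v w : ℝ, (u ≠ 0 ∨ v ≠ 0 ∨ w ≠ 0) ∧ u * a 1 + v * a 2 + w * a 3 = 0 ∧
      u * b 1 + v * b 2 + w * b 3 = 0 := by
    have ker : ∀ f : Fin 6 → ℂ, ∃ u v w : ℝ, (u ≠ 0 ∨ v ≠ 0 ∨ w ≠ 0) ∧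
        u * f 1 + v * f 2 + w * f 3 = 0 := by
      intro f
      obtain ⟨x, hx, e1, e2⟩ := exists_ker ![(f 1).re, (f 2).re, (f 3).re]
        ![(f 1).im, (f 2).im, (f 3).im]
      refine ⟨x 0, x 1, x 2, ?_, ?_⟩
      · by_contra! h0
        apply hx
        funext k
        fin_cases k
        · exact h0.1
        · exact h0.2.1
        · exact h0.2.2
      · apply Complex.ext
        · simpa using e1
        · simpa using e2
    by_cases h0 : a 1 = 0 ∧ a 2 = 0 ∧ a 3 = 0
    · obtain ⟨u, v, w, hn, e⟩ := ker b
      exact ⟨u, v, w, hn, by simp [h0.1, h0.2.1, h0.2.2], e⟩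
    · obtain ⟨u, v, w, hn, e⟩ := ker a
      refine ⟨u, v, w, hn, e, ?_⟩
      generalize (u : ℂ) = u' at *
      generalize (v : ℂ) = v' at *
      generalize (w : ℂ) = w' at *
      by_cases k1 : a 1 = 0
      · by_cases k2 : a 2 = 0
        · have k3 : a 3 ≠ 0 := by grind
          apply mul_left_cancel₀ k3
          linear_combination b 3 * e - u' * h13 - v' * h23
        · apply mul_left_cancel₀ k2
          linear_combination b 2 * e - u' * h12 + w' * h23
      · apply mul_left_cancel₀ k1
        linear_combination b 1 * e + v' * h12 + w' * h13
  obtain ⟨u, v, w, hn, e1, e2⟩ := hw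
  refine H.k3 ![0, u, v, w, 0, 0] (bs 4) (bs 5) ?_ (by rw [CX.sbs, CX.sbs]; exact ⟨a4, b4⟩)
    (by rw [CX.sbs, CX.sbs]; exact ⟨a5, b5⟩) fun s t r hs => ?_
  · constructor
    · simpa [Fin.sum_univ_six] using e1
    · simpa [Fin.sum_univ_six] using e2
  · have h1 := congrFun hs 1
    have h2 := congrFun hs 2
    have h3 := congrFun hs 3
    have h4 := congrFun hs 4
    have h5 := congrFun hs 5
    rw [Pi.add_apply, Pi.add_apply, Pi.smul_apply, Pi.smul_apply, Pi.smul_apply] at h1 h2 h3 h4 h5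
    simp [bs] at h1 h2 h3 h4 h5
    refine ⟨?_, h4, h5⟩
    grind

theorem ncx25 : ¬ (N 24).AdmitsComplex := by
  intro hC
  obtain ⟨a, b, c, g, h, d, H⟩ := CX.mk' _ hC
  have A01 := H.ea 0 1
  have A04 := H.ea 0 4
  have B01 := H.eb 0 1
  have B02 := H.eb 0 2
  have B03 := H.eb 0 3
  have B12 := H.eb 1 2
  have B13 := H.eb 1 3
  have B23 := H.eb 2 3
  have B04 := H.eb 0 4
  have B14 := H.eb 1 4
  have B24 := H.eb 2 4
  have B34 := H.eb 3 4
  have F0124 := H.f4 0 1 2 4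
  have F0134 := H.f4 0 1 3 4
  have F0234 := H.f4 0 2 3 4
  simp only [Fin.sum_univ_six, sc, tab, Matrix.cons_val, List.map_cons, List.map_nil, List.sum_cons, List.sum_nil, reduceIte, Fin.isValue, Fin.reduceEq, and_self, and_true, and_false, true_and, false_and, Int.cast_zero, Int.cast_one, Int.cast_neg, zero_mul, one_mul, neg_mul, add_zero, zero_add, neg_zero, mul_zero, sub_zero, zero_sub] at A01 A04 B01 B02 B03 B12 B13 B23 B04 B14 B24 B34 F0124 F0134 F0234
  have a4 : a 4 = 0 := by grind
  have a5 : a 5 = 0 := by grind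
  have hr : a 1 = 0 → a 2 = 0 → a 3 = 0 → False := fun h1 h2 h3 =>
    H.rk1 0 (fin6_of (by simp) (by simp [h1]) (by simp [h2]) (by simp [h3]) (by simp [a4]) (by simp [a5]))
  have g4 : g 4 = 0 := by grind
  have b5 : b 5 = 0 := by grind
  have c5 := H.cne 5 a5 b5
  by_cases b4 : b 4 = 0
  · exact H.four a4 a5 b4 b5 (by grind) (by grind) (by grind)
  · have a2 : a 2 = 0 := by grind
    have a3 : a 3 = 0 := by grind
    have a1 : a 1 ≠ 0 := fun h => hr h a2 a3
    exact H.k3b 2 3 5 (by decide) (by decide) (by decide) a2 a3 a5 (by grind) (by grind) b5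

theorem ncx26 : ¬ (N 25).AdmitsComplex := by
  intro hC
  obtain ⟨a, b, c, g, h, d, H⟩ := CX.mk' _ hC
  have A01 := H.ea 0 1
  have A04 := H.ea 0 4
  have B01 := H.eb 0 1
  have B02 := H.eb 0 2
  have B03 := H.eb 0 3
  have B12 := H.eb 1 2
  have B13 := H.eb 1 3
  have B23 := H.eb 2 3
  have B04 := H.eb 0 4
  have B14 := H.eb 1 4
  have B24 := H.eb 2 4
  have B34 := H.eb 3 4
  have F0124 := H.f4 0 1 2 4
  have F0134 := H.f4 0 1 3 4
  have F0234 := H.f4 0 2 3 4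
  simp only [Fin.sum_univ_six, sc, tab, Matrix.cons_val, List.map_cons, List.map_nil, List.sum_cons, List.sum_nil, reduceIte, Fin.isValue, Fin.reduceEq, and_self, and_true, and_false, true_and, false_and, Int.cast_zero, Int.cast_one, Int.cast_neg, zero_mul, one_mul, neg_mul, add_zero, zero_add, neg_zero, mul_zero, sub_zero, zero_sub] at A01 A04 B01 B02 B03 B12 B13 B23 B04 B14 B24 B34 F0124 F0134 F0234
  have a4 : a 4 = 0 := by grind
  have a5 : a 5 = 0 := by grind
  have hr : a 1 = 0 → a 2 = 0 → a 3 = 0 → False := fun h1 h2 h3 =>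
    H.rk1 0 (fin6_of (by simp) (by simp [h1]) (by simp [h2]) (by simp [h3]) (by simp [a4]) (by simp [a5]))
  have g4 : g 4 = 0 := by grind
  have b5 : b 5 = 0 := by grind
  have c5 := H.cne 5 a5 b5
  by_cases b4 : b 4 = 0
  · exact H.four a4 a5 b4 b5 (by grind) (by grind) (by grind)
  · have a2 : a 2 = 0 := by grind
    have a3 : a 3 = 0 := by grind
    have a1 : a 1 ≠ 0 := fun h => hr h a2 a3
    exact H.k3b 2 3 5 (by decide) (by decide) (by decide) a2 a3 a5 (by grind) (by grind) b5

theorem cx_no (i : Fin 34) (h : cxF i = false) : ¬ (N i).AdmitsComplex := by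
  revert i
  have key : ∀ i : Fin 34, cxF i = false → i = 0 ∨ i = 1 ∨ i = 2 ∨ i = 3 ∨ i = 4 ∨ i = 5 ∨ i = 6 ∨ i = 8 ∨ i = 9 ∨ i = 10 ∨ i = 11 ∨ i = 12 ∨ i = 13 ∨ i = 14 ∨ i = 24 ∨ i = 25 := by decide +kernel
  intro i h
  rcases key i h with rfl | rfl | rfl | rfl | rfl | rfl | rfl | rfl | rfl | rfl | rfl | rfl | rfl | rfl | rfl | rfl
  · exact ncx1
  · exact ncx2
  · exact ncx3
  · exact ncx4
  · exact ncx5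
  · exact ncx6
  · exact ncx7
  · exact ncx9
  · exact ncx10
  · exact ncx11
  · exact ncx12
  · exact ncx13
  · exact ncx14
  · exact ncx15
  · exact ncx25
  · exact ncx26


theorem LieStruct.Iso.cx {L L' : LieStruct 6} (h : L.Iso L') (hC : L.AdmitsComplex) :
    L'.AdmitsComplex := by
  obtain ⟨f, hf⟩ := h
  obtain ⟨J, h1, h2⟩ := hC
  refine ⟨f.toLinearMap ∘ₗ J ∘ₗ f.symm.toLinearMap, fun x => by simp [h1], fun x y => ?_⟩
  have := congrArg f (h2 (f.symm x) (f.symm y))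
  have hs : ∀ x y, f.symm (L'.bracket x y) = L.bracket (f.symm x) (f.symm y) := fun x y =>
    f.injective (by rw [hf]; simp)
  simpa [hf, hs] using this

theorem LieStruct.Iso.sy {L L' : LieStruct 6} (h : L.Iso L') (hC : L.AdmitsSymplectic) :
    L'.AdmitsSymplectic := by
  obtain ⟨f, hf⟩ := h
  obtain ⟨ω, h1, h2, h3⟩ := hC
  have hs : ∀ x y, f.symm (L'.bracket x y) = L.bracket (f.symm x) (f.symm y) := fun x y =>
    f.injective (by rw [hf]; simp)
  refine ⟨ω.compl₁₂ f.symm.toLinearMap f.symm.toLinearMap, fun x => by simp [h1],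
    fun x hx => ?_, fun x y z => by simpa [hs] using h3 (f.symm x) (f.symm y) (f.symm z)⟩
  have := h2 (f.symm x) (fun y => by simpa using hx (f y))
  simpa using this

theorem LieStruct.Iso.nilp {L L' : LieStruct 6} (h : L.Iso L') (hC : L.IsNilpotent) :
    L'.IsNilpotent := by
  obtain ⟨f, hf⟩ := h
  exact LieStruct.isNilpotent_of_surj f.toLinearMap f.surjective hf hC

theorem cx_iff (i : Fin 34) : (N i).AdmitsComplex ↔ cxF i = true := by
  refine ⟨fun h => ?_, cx_yes i⟩
  by_contra h'
  exact cx_no i (by simpa using h') h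

theorem sy_iff (i : Fin 34) : (N i).AdmitsSymplectic ↔ syF i = true := by
  refine ⟨fun h => ?_, sy_yes i⟩
  by_contra h'
  exact sy_no i (by simpa using h') h

theorem N_inj' {i j : Fin 34} (h : (N i).Iso (N j)) : i = j := by
  refine N_inj h ?_
  rw [Bool.eq_iff_iff, ← cx_iff, ← cx_iff]
  exact ⟨h.cx, h.symm.cx⟩

theorem ex_N (L : LieStruct 6) (h : L.IsNilpotent) : ∃ i, L.Iso (N i) := by
  obtain ⟨i, hi⟩ := cls6 L h
  exact ⟨i, hi.iso⟩

/-- Counting isomorphism classes satisfying an invariant property. -/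
theorem card_quot (P : LieStruct 6 → Prop) (F : Fin 34 → Bool)
    (hn : ∀ L, P L → L.IsNilpotent) (hP : ∀ L L', L.Iso L' → P L → P L')
    (hF : ∀ i, P (N i) ↔ F i = true) :
    Nat.card (Quot (IsoOn P)) = (Finset.univ.filter fun i => F i = true).card := by
  have e : {i : Fin 34 // F i = true} ≃ Quot (IsoOn P) := by
    refine Equiv.ofBijective (fun i => Quot.mk _ ⟨N i.1, (hF i.1).2 i.2⟩) ⟨?_, ?_⟩
    · intro i j hij
      have key : ∀ x y : {L // P L}, Relation.EqvGen (IsoOn P) x y → x.1.Iso y.1 := by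
        intro x y h
        induction h with
        | rel x y h => exact h
        | refl x => exact ⟨LinearEquiv.refl ℝ _, fun _ _ => rfl⟩
        | symm x y _ h => exact h.symm
        | trans x y z _ _ h h' => exact h.trans h'
      exact Subtype.ext (N_inj' (key _ _ (Quot.eqvGen_exact hij)))
    · intro q
      induction q using Quot.ind with
      | mk L =>
        obtain ⟨i, hi⟩ := ex_N L.1 (hn _ L.2)
        exact ⟨⟨i, (hF i).1 (hP _ _ hi L.2)⟩, (Quot.sound (r := IsoOn P) (a := L)
          (b := ⟨N i, hP _ _ hi L.2⟩) hi).symm⟩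
  rw [← Nat.card_congr e, Nat.card_eq_fintype_card, Fintype.card_subtype]

/-- There are exactly 34 isomorphism classes of real 6-dimensional nilpotent Lie
algebras: 15 admit both complex and symplectic structures, 3 admit complex but not
symplectic structures, 11 admit symplectic but not complex structures, and 5 admit
neither. -/
theorem nilpotent_six_dimensional_classification :
    Nat.card (Quot (IsoOn (n := 6) fun L => L.IsNilpotent)) = 34 ∧
    Nat.card (Quot (IsoOn (n := 6) fun L =>
      L.IsNilpotent ∧ L.AdmitsComplex ∧ L.AdmitsSymplectic)) = 15 ∧
    Nat.card (Quot (IsoOn (n := 6) fun L =>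
      L.IsNilpotent ∧ L.AdmitsComplex ∧ ¬L.AdmitsSymplectic)) = 3 ∧
    Nat.card (Quot (IsoOn (n := 6) fun L =>
      L.IsNilpotent ∧ ¬L.AdmitsComplex ∧ L.AdmitsSymplectic)) = 11 ∧
    Nat.card (Quot (IsoOn (n := 6) fun L =>
      L.IsNilpotent ∧ ¬L.AdmitsComplex ∧ ¬L.AdmitsSymplectic)) = 5 := by
  refine ⟨?_, ?_, ?_, ?_, ?_⟩
  · rw [card_quot _ (fun _ => true) (fun L h => h) (fun L L' h h' => h.nilp h')
      (fun i => by simp [N_nilp])]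
    simp
  · rw [card_quot _ (fun i => cxF i && syF i) (fun L h => h.1)
      (fun L L' h h' => ⟨h.nilp h'.1, h.cx h'.2.1, h.sy h'.2.2⟩)
      (fun i => by simp [N_nilp, cx_iff, sy_iff])]
    decide +kernel
  · rw [card_quot _ (fun i => cxF i && !syF i) (fun L h => h.1)
      (fun L L' h h' => ⟨h.nilp h'.1, h.cx h'.2.1, fun k => h'.2.2 (h.symm.sy k)⟩)
      (fun i => by simp [N_nilp, cx_iff, sy_iff])]
    decide +kernel
  · rw [card_quot _ (fun i => !cxF i && syF i) (fun L h => h.1)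
      (fun L L' h h' => ⟨h.nilp h'.1, fun k => h'.2.1 (h.symm.cx k), h.sy h'.2.2⟩)
      (fun i => by simp [N_nilp, cx_iff, sy_iff])]
    decide +kernel
  · rw [card_quot _ (fun i => !cxF i && !syF i) (fun L h => h.1)
      (fun L L' h h' => ⟨h.nilp h'.1, fun k => h'.2.1 (h.symm.cx k),
        fun k => h'.2.2 (h.symm.sy k)⟩)
      (fun i => by simp [N_nilp, cx_iff, sy_iff])]
    decide +kernel
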